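/- arXiv:2106.13968 — 6 statements merged into one kernel-verified Lean document; each statement's English description precedes it below -/
import Mathlib

section
/- Fix p ∈ (0,1) and for each i ∈ ℕ set n_i = ⌊(1/(1−p))^{i+1/2} · i⌋. Then the probability under G(n_i, p) that there exist positive integers k, ℓ, m with k + ℓ + m ≤ n_i such that X(k,ℓ,m) > 0 tends to 0 as i → ∞. -/
open MeasureTheory Filter Real

noncomputable instance simpleGraphMeasurableSpace {n : ℕ} :
    MeasurableSpace (SimpleGraph (Fin n)) := ⊤

/-- The binomial random graph `G(n,p)`: the measure on simple graphs on `Fin n`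
assigning to each graph `G` the probability `p^{e(G)} * (1-p)^{n(n-1)/2 - e(G)}`. -/
noncomputable def gnp (n : ℕ) (p : ℝ) : Measure (SimpleGraph (Fin n)) :=
  Measure.sum fun G : SimpleGraph (Fin n) =>
    ENNReal.ofReal (p ^ Nat.card G.edgeSet *
      (1 - p) ^ (n * (n - 1) / 2 - Nat.card G.edgeSet)) • Measure.dirac G

/-- The tuple `(X₁,x₁,X₂,x₂,X₃,x₃)` is special: the `Xᵢ` are pairwise disjoint, `xᵢ ∈ Xᵢ`,
every vertex outside `X₁ ∪ X₂ ∪ X₃` has a neighbor in each `Xᵢ`, and for distinct `i,j`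
the only edge between `Xᵢ` and `Xⱼ` is `{xᵢ, xⱼ}`. -/
def SpecialTuple {n : ℕ} (G : SimpleGraph (Fin n)) (X₁ X₂ X₃ : Finset (Fin n))
    (x₁ x₂ x₃ : Fin n) : Prop :=
  Disjoint X₁ X₂ ∧ Disjoint X₁ X₃ ∧ Disjoint X₂ X₃ ∧
  x₁ ∈ X₁ ∧ x₂ ∈ X₂ ∧ x₃ ∈ X₃ ∧
  (∀ v : Fin n, v ∉ X₁ → v ∉ X₂ → v ∉ X₃ →
    (∃ u ∈ X₁, G.Adj v u) ∧ (∃ u ∈ X₂, G.Adj v u) ∧ (∃ u ∈ X₃, G.Adj v u)) ∧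
  (∀ u ∈ X₁, ∀ v ∈ X₂, (G.Adj u v ↔ u = x₁ ∧ v = x₂)) ∧
  (∀ u ∈ X₁, ∀ v ∈ X₃, (G.Adj u v ↔ u = x₁ ∧ v = x₃)) ∧
  (∀ u ∈ X₂, ∀ v ∈ X₃, (G.Adj u v ↔ u = x₂ ∧ v = x₃))

/-- `X(k,ℓ,m)`: the number of special tuples `(X₁,x₁,X₂,x₂,X₃,x₃)` with
`|X₁| = k`, `|X₂| = ℓ`, `|X₃| = m`. -/
noncomputable def countX {n : ℕ} (G : SimpleGraph (Fin n)) (k l m : ℕ) : ℕ :=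
  Nat.card {t : Finset (Fin n) × Finset (Fin n) × Finset (Fin n) × Fin n × Fin n × Fin n //
    t.1.card = k ∧ t.2.1.card = l ∧ t.2.2.1.card = m ∧
    SpecialTuple G t.1 t.2.1 t.2.2.1 t.2.2.2.1 t.2.2.2.2.1 t.2.2.2.2.2}

/-- The expectation of `X(k,ℓ,m)` under `G(n,p)`. -/
noncomputable def expX (n : ℕ) (p : ℝ) (k l m : ℕ) : ℝ :=
  ∫ G, (countX G k l m : ℝ) ∂ gnp n p

/-- The sequence `n_i = ⌊(1/(1-p))^{i+1/2} · i⌋`. -/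
noncomputable def nseq1 (p : ℝ) (i : ℕ) : ℕ :=
  Nat.floor ((1 / (1 - p)) ^ ((i : ℝ) + 1 / 2) * i)

/-- The law on `Bool` under which `true` has probability `p`. -/
noncomputable def edgeLaw (p : ℝ) : Measure Bool :=
  ENNReal.ofReal p • Measure.dirac true + ENNReal.ofReal (1 - p) • Measure.dirac false

/-- Independent `p`-biased bits indexed by a finite type. -/
noncomputable def edgeProduct (E : Type*) [Fintype E] (p : ℝ) : Measure (E → Bool) :=
  Measure.pi fun _ => edgeLaw p

/-- The graph whose edges are the non-diagonal pairs marked `true`. -/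
def ofMarking {n : ℕ} (ω : Sym2 (Fin n) → Bool) : SimpleGraph (Fin n) :=
  SimpleGraph.fromEdgeSet {e | ω e = true}

lemma ofMarking_adj {n : ℕ} (ω : Sym2 (Fin n) → Bool) (u v : Fin n) :
    (ofMarking ω).Adj u v ↔ ω s(u, v) = true ∧ u ≠ v := by
  simp [ofMarking]

lemma edgeLaw_true (p : ℝ) : edgeLaw p {true} = ENNReal.ofReal p := by
  simp [edgeLaw]

lemma edgeLaw_false (p : ℝ) : edgeLaw p {false} = ENNReal.ofReal (1 - p) := by
  simp [edgeLaw]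

lemma isProbabilityMeasure_edgeLaw {p : ℝ} (hp : p ∈ Set.Ioo (0 : ℝ) 1) :
    IsProbabilityMeasure (edgeLaw p) := by
  constructor
  simp only [edgeLaw, Measure.add_apply, Measure.smul_apply, measure_univ, smul_eq_mul, mul_one]
  rw [← ENNReal.ofReal_add hp.1.le (by linarith [hp.2])]
  simp

lemma isProbabilityMeasure_edgeProduct {p : ℝ} (hp : p ∈ Set.Ioo (0 : ℝ) 1)
    (E : Type*) [Fintype E] : IsProbabilityMeasure (edgeProduct E p) := by
  have := isProbabilityMeasure_edgeLaw hp
  unfold edgeProduct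
  infer_instance

lemma gnp_singleton {n : ℕ} (p : ℝ) (G : SimpleGraph (Fin n)) :
    gnp n p {G} = ENNReal.ofReal (p ^ Nat.card G.edgeSet *
      (1 - p) ^ (n * (n - 1) / 2 - Nat.card G.edgeSet)) := by
  classical
  have hm : MeasurableSet ({G} : Set (SimpleGraph (Fin n))) := trivial
  unfold gnp
  rw [Measure.sum_apply _ hm, tsum_eq_single G]
  · rw [Measure.smul_apply, Measure.dirac_apply' _ hm]
    simp
  · intro H hH
    rw [Measure.smul_apply, Measure.dirac_apply' _ hm]
    simp [hH]

lemma ofMarking_preimage_singleton {n : ℕ} (G : SimpleGraph (Fin n)) :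
    ofMarking ⁻¹' {G} = Set.univ.pi fun e : Sym2 (Fin n) =>
      {b : Bool | e.IsDiag ∨ (b = true ↔ e ∈ G.edgeSet)} := by
  ext ω
  simp only [Set.mem_preimage, Set.mem_singleton_iff, Set.mem_pi, Set.mem_univ, true_implies,
    Set.mem_ofPred_eq]
  constructor
  · rintro rfl e
    by_cases he : e.IsDiag
    · exact Or.inl he
    · right
      simp [ofMarking, SimpleGraph.edgeSet_fromEdgeSet, he]
  · intro h
    ext u v
    rw [ofMarking_adj]
    by_cases huv : u = v
    · simp [huv]
    · have := h s(u, v)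
      simp only [Sym2.mk_isDiag_iff, huv, false_or, SimpleGraph.mem_edgeSet] at this
      simp [huv, this]

lemma edgeProduct_ofMarking_singleton {n : ℕ} {p : ℝ} (hp : p ∈ Set.Ioo (0 : ℝ) 1)
    (G : SimpleGraph (Fin n)) :
    edgeProduct (Sym2 (Fin n)) p (ofMarking ⁻¹' {G}) = gnp n p {G} := by
  classical
  have := isProbabilityMeasure_edgeLaw hp
  have hfac : ∀ e : Sym2 (Fin n),
      edgeLaw p {b : Bool | e.IsDiag ∨ (b = true ↔ e ∈ G.edgeSet)} =
        if e.IsDiag then 1 else if e ∈ G.edgeSet then ENNReal.ofReal p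
          else ENNReal.ofReal (1 - p) := by
    intro e
    split_ifs with h1 h2
    · simpa [h1] using measure_univ (μ := edgeLaw p)
    · rw [← edgeLaw_true]
      congr 1
      ext b
      simp [h1, h2]
    · rw [← edgeLaw_false]
      congr 1
      ext b
      simp [h1, h2]
  rw [ofMarking_preimage_singleton, edgeProduct, Measure.pi_pi, gnp_singleton,
    Finset.prod_congr rfl fun e _ => hfac e]
  have hcard : (Finset.univ.filter fun e : Sym2 (Fin n) => ¬ e.IsDiag).card = n * (n - 1) / 2 := by
    have := Sym2.card_subtype_not_diag (α := Fin n)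
    rw [Fintype.card_subtype, Fintype.card_fin, Nat.choose_two_right] at this
    exact this
  have hsub : (Finset.univ.filter fun e : Sym2 (Fin n) => ¬ e.IsDiag).filter
      (fun e => e ∈ G.edgeSet) = G.edgeFinset := by
    ext e
    simp only [Finset.mem_filter, Finset.mem_univ, true_and, SimpleGraph.mem_edgeFinset,
      and_iff_right_iff_imp]
    exact fun h => G.not_isDiag_of_mem_edgeSet h
  have hE : G.edgeFinset.card = Nat.card G.edgeSet := by
    rw [Nat.card_eq_fintype_card, SimpleGraph.edgeFinset_card]
  have hsplit := Finset.card_filter_add_card_filter_not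
    (s := Finset.univ.filter fun e : Sym2 (Fin n) => ¬ e.IsDiag) (fun e => e ∈ G.edgeSet)
  rw [hsub, hcard, hE] at hsplit
  rw [Finset.prod_ite, Finset.prod_const_one, one_mul, Finset.prod_ite, Finset.prod_const,
    Finset.prod_const, hsub, hE, ENNReal.ofReal_mul (pow_nonneg hp.1.le _),
    ENNReal.ofReal_pow hp.1.le, ENNReal.ofReal_pow (by linarith [hp.2])]
  congr 2
  omega

lemma gnp_apply {n : ℕ} {p : ℝ} (hp : p ∈ Set.Ioo (0 : ℝ) 1) (A : Set (SimpleGraph (Fin n))) :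
    gnp n p A = edgeProduct (Sym2 (Fin n)) p (ofMarking ⁻¹' A) := by
  have : MeasurableSingletonClass (SimpleGraph (Fin n)) := ⟨fun _ => trivial⟩
  have hm : Measurable (ofMarking (n := n)) := measurable_of_finite _
  have h : gnp n p = (edgeProduct (Sym2 (Fin n)) p).map ofMarking := by
    refine Measure.ext_of_singleton fun G => ?_
    rw [Measure.map_apply hm trivial, edgeProduct_ofMarking_singleton hp]
  rw [h, Measure.map_apply hm trivial]

section Cylinders

variable {E : Type*} [Fintype E]

/-- The markings that are `false` on `S` and `true` on `T`. -/
def bitCylinder (S T : Finset E) : Set (E → Bool) :=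
  {ω | (∀ e ∈ S, ω e = false) ∧ ∀ e ∈ T, ω e = true}

lemma edgeProduct_inter {p : ℝ} (hp : p ∈ Set.Ioo (0 : ℝ) 1) {S T : Finset E}
    (hST : Disjoint S T) {A B : Set (E → Bool)}
    (hA : ∀ ω ω' : E → Bool, (∀ e ∈ S, ω e = ω' e) → ω ∈ A → ω' ∈ A)
    (hB : ∀ ω ω' : E → Bool, (∀ e ∈ T, ω e = ω' e) → ω ∈ B → ω' ∈ B) :
    edgeProduct E p (A ∩ B) = edgeProduct E p A * edgeProduct E p B := by
  have := isProbabilityMeasure_edgeLaw hp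
  have hind : ProbabilityTheory.iIndepFun (fun (i : E) (ω : E → Bool) => ω i)
      (edgeProduct E p) :=
    ProbabilityTheory.iIndepFun_pi (X := fun _ => id) fun _ => aemeasurable_id
  have h := hind.indepFun_finset S T hST fun i => measurable_pi_apply i
  have key : ∀ (F : Finset E) (C : Set (E → Bool)),
      (∀ ω ω' : E → Bool, (∀ e ∈ F, ω e = ω' e) → ω ∈ C → ω' ∈ C) →
      (fun (ω : E → Bool) (i : F) => ω i) ⁻¹' ((fun (ω : E → Bool) (i : F) => ω i) '' C) = C := by
    intro F C hC
    refine Set.Subset.antisymm ?_ (Set.subset_preimage_image _ _)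
    rintro ω ⟨ω', hω', heq⟩
    exact hC ω' ω (fun e he => congrFun heq ⟨e, he⟩) hω'
  have := h.measure_inter_preimage_eq_mul _ _
    (Set.toFinite ((fun (ω : E → Bool) (i : S) => ω i) '' A)).measurableSet
    (Set.toFinite ((fun (ω : E → Bool) (i : T) => ω i) '' B)).measurableSet
  rwa [key S A hA, key T B hB] at this

lemma edgeProduct_bitCylinder [DecidableEq E] {p : ℝ} (hp : p ∈ Set.Ioo (0 : ℝ) 1) {S T : Finset E}
    (hST : Disjoint S T) :
    edgeProduct E p (bitCylinder S T) = ENNReal.ofReal ((1 - p) ^ S.card * p ^ T.card) := by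
  have := isProbabilityMeasure_edgeLaw hp
  have hset : bitCylinder S T = Set.univ.pi fun e : E =>
      {b : Bool | (e ∈ S → b = false) ∧ (e ∈ T → b = true)} := by
    ext ω
    simp only [bitCylinder, Set.mem_ofPred_eq, Set.mem_pi, Set.mem_univ, true_implies]
    exact ⟨fun h e => ⟨h.1 e, h.2 e⟩, fun h => ⟨fun e => (h e).1, fun e => (h e).2⟩⟩
  have hfac : ∀ e : E, edgeLaw p {b : Bool | (e ∈ S → b = false) ∧ (e ∈ T → b = true)} =
      (if e ∈ S then ENNReal.ofReal (1 - p) else 1) * (if e ∈ T then ENNReal.ofReal p else 1) := by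
    intro e
    by_cases h1 : e ∈ S
    · have h2 : e ∉ T := Finset.disjoint_left.1 hST h1
      simp [h1, h2, ← edgeLaw_false]
    · by_cases h2 : e ∈ T
      · simp [h1, h2, ← edgeLaw_true]
      · simpa [h1, h2] using measure_univ (μ := edgeLaw p)
  rw [hset, edgeProduct, Measure.pi_pi, Finset.prod_congr rfl fun e _ => hfac e,
    Finset.prod_mul_distrib, Finset.prod_ite_mem, Finset.prod_ite_mem, Finset.univ_inter,
    Finset.univ_inter, Finset.prod_const, Finset.prod_const,
    ENNReal.ofReal_mul (pow_nonneg (by linarith [hp.2]) _), ENNReal.ofReal_pow hp.1.le,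
    ENNReal.ofReal_pow (by linarith [hp.2])]

lemma edgeProduct_avoid_cylinders [DecidableEq E] {p : ℝ} (hp : p ∈ Set.Ioo (0 : ℝ) 1) {ι : Type*}
    (s : Finset ι) (S T : ι → Finset E) (hST : ∀ j ∈ s, Disjoint (S j) (T j))
    (hdis : ∀ i ∈ s, ∀ j ∈ s, i ≠ j → Disjoint (S i ∪ T i) (S j ∪ T j)) :
    edgeProduct E p {ω | ∀ j ∈ s, ω ∉ bitCylinder (S j) (T j)} =
      ENNReal.ofReal (∏ j ∈ s, (1 - (1 - p) ^ (S j).card * p ^ (T j).card)) := by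
  classical
  have := isProbabilityMeasure_edgeProduct hp E
  have hq : 0 ≤ 1 - p := by linarith [hp.2]
  have hle : ∀ j, (1 - p) ^ (S j).card * p ^ (T j).card ≤ 1 := fun j =>
    mul_le_one₀ (pow_le_one₀ hq (by linarith [hp.1])) (pow_nonneg hp.1.le _)
      (pow_le_one₀ hp.1.le hp.2.le)
  induction s using Finset.induction_on with
  | empty => simp
  | insert a s ha ih =>
    have hset : {ω | ∀ j ∈ insert a s, ω ∉ bitCylinder (S j) (T j)} =
        (bitCylinder (S a) (T a))ᶜ ∩ {ω | ∀ j ∈ s, ω ∉ bitCylinder (S j) (T j)} := by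
      ext ω
      simp
    have hcyl : ∀ (j : ι) (ω ω' : E → Bool), (∀ e ∈ S j ∪ T j, ω e = ω' e) →
        ω ∉ bitCylinder (S j) (T j) → ω' ∉ bitCylinder (S j) (T j) := by
      intro j ω ω' h hω hω'
      refine hω ⟨fun e he => ?_, fun e he => ?_⟩
      · rw [h e (Finset.mem_union_left _ he)]
        exact hω'.1 e he
      · rw [h e (Finset.mem_union_right _ he)]
        exact hω'.2 e he
    rw [hset, edgeProduct_inter hp (S := S a ∪ T a) (T := s.biUnion fun j => S j ∪ T j),
      ih (fun j hj => hST j (Finset.mem_insert_of_mem hj))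
        (fun i hi j hj => hdis i (Finset.mem_insert_of_mem hi) j (Finset.mem_insert_of_mem hj)),
      Finset.prod_insert ha, ENNReal.ofReal_mul (by linarith [hle a]),
      prob_compl_eq_one_sub (Set.toFinite _).measurableSet,
      edgeProduct_bitCylinder hp (hST a (Finset.mem_insert_self a s)),
      ENNReal.ofReal_sub _ (mul_nonneg (pow_nonneg hq _) (pow_nonneg hp.1.le _)),
      ENNReal.ofReal_one]
    · rw [Finset.disjoint_biUnion_right]
      intro j hj
      exact hdis a (Finset.mem_insert_self a s) j (Finset.mem_insert_of_mem hj)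
        (fun h => ha (h ▸ hj))
    · exact hcyl a
    · intro ω ω' h hω j hj
      exact hcyl j ω ω' (fun e he => h e (Finset.mem_biUnion.2 ⟨j, hj, he⟩)) (hω j hj)

end Cylinders

lemma isProbabilityMeasure_gnp {p : ℝ} (hp : p ∈ Set.Ioo (0 : ℝ) 1) (n : ℕ) :
    IsProbabilityMeasure (gnp n p) := by
  have := isProbabilityMeasure_edgeProduct hp (Sym2 (Fin n))
  constructor
  rw [gnp_apply hp, Set.preimage_univ, measure_univ]

lemma gnp_real_le_prod {n : ℕ} {p : ℝ} (hp : p ∈ Set.Ioo (0 : ℝ) 1) {ι : Type*}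
    (s : Finset ι) (S T : ι → Finset (Sym2 (Fin n))) (hST : ∀ j ∈ s, Disjoint (S j) (T j))
    (hdis : ∀ i ∈ s, ∀ j ∈ s, i ≠ j → Disjoint (S i ∪ T i) (S j ∪ T j))
    (Q : Set (SimpleGraph (Fin n)))
    (hQ : ∀ ω, ofMarking ω ∈ Q → ∀ j ∈ s, ω ∉ bitCylinder (S j) (T j)) :
    (gnp n p).real Q ≤ ∏ j ∈ s, (1 - (1 - p) ^ (S j).card * p ^ (T j).card) := by
  have hq : 0 ≤ 1 - p := by linarith [hp.2]
  refine ENNReal.toReal_le_of_le_ofReal (Finset.prod_nonneg fun j _ => sub_nonneg.2 ?_) ?_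
  · exact mul_le_one₀ (pow_le_one₀ hq (by linarith [hp.1])) (pow_nonneg hp.1.le _)
      (pow_le_one₀ hp.1.le hp.2.le)
  · rw [← edgeProduct_avoid_cylinders hp s S T hST hdis, gnp_apply hp]
    exact measure_mono fun ω hω => hQ ω hω

lemma gnp_real_no_edges_le {n : ℕ} {p : ℝ} (hp : p ∈ Set.Ioo (0 : ℝ) 1) {A B : Finset (Fin n)}
    (hAB : Disjoint A B) :
    (gnp n p).real {G | ∀ u ∈ A, ∀ v ∈ B, ¬ G.Adj u v} ≤ (1 - p) ^ (A.card * B.card) := by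
  classical
  refine (gnp_real_le_prod hp (A ×ˢ B) (fun _ => ∅) (fun x => {s(x.1, x.2)}) ?_ ?_ _ ?_).trans ?_
  · simp
  · rintro ⟨u, v⟩ h ⟨u', v'⟩ h' hne
    simp only [Finset.mem_product] at h h'
    simp only [Finset.empty_union, Finset.disjoint_singleton, ne_eq, Sym2.eq_iff]
    rintro (⟨rfl, rfl⟩ | ⟨rfl, rfl⟩)
    · exact hne rfl
    · exact Finset.disjoint_left.1 hAB h.1 h'.2
  · rintro ω hω ⟨u, v⟩ h hcyl
    simp only [Finset.mem_product] at h
    refine hω u h.1 v h.2 ?_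
    rw [ofMarking_adj]
    exact ⟨hcyl.2 _ (by simp), fun e => Finset.disjoint_left.1 hAB h.1 (e ▸ h.2)⟩
  · simp [Finset.card_product]

lemma card_image_star {V : Type*} [DecidableEq V] (v : V) (X : Finset V) :
    (X.image fun u => s(v, u)).card = X.card :=
  Finset.card_image_of_injective _ fun _ _ h => Sym2.congr_right.1 h

lemma gnp_real_undominated_le {n : ℕ} {p : ℝ} (hp : p ∈ Set.Ioo (0 : ℝ) 1)
    {A B : Finset (Fin n)} {y : Fin n} (hAB : Disjoint A B) (hy : y ∈ B) :
    (gnp n p).real {G | ∀ v, v ∉ A → v ∉ B → (∀ u ∈ A, ¬ G.Adj v u) → ¬ G.Adj v y} ≤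
      (1 - (1 - p) ^ A.card * p) ^ (n - (A.card + B.card)) := by
  classical
  have hyA : y ∉ A := Finset.disjoint_right.1 hAB hy
  refine (gnp_real_le_prod hp (A ∪ B)ᶜ (fun v => A.image fun u => s(v, u))
    (fun v => {s(v, y)}) ?_ ?_ _ ?_).trans ?_
  · intro v hv
    rw [Finset.disjoint_singleton_right, Finset.mem_image]
    rintro ⟨u, hu, h⟩
    exact hyA (Sym2.congr_right.1 h ▸ hu)
  · intro v hv v' hv' hne
    rw [Finset.mem_compl, Finset.mem_union, not_or] at hv hv'
    have key : ∀ v, ∀ e ∈ (A.image fun u => s(v, u)) ∪ {s(v, y)}, ∃ u ∈ A ∪ B, e = s(v, u) := by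
      intro v e he
      rcases Finset.mem_union.1 he with he | he
      · obtain ⟨u, hu, rfl⟩ := Finset.mem_image.1 he
        exact ⟨u, Finset.mem_union_left _ hu, rfl⟩
      · exact ⟨y, Finset.mem_union_right _ hy, Finset.mem_singleton.1 he⟩
    rw [Finset.disjoint_left]
    intro e he he'
    obtain ⟨u, hu, rfl⟩ := key v e he
    obtain ⟨u', hu', h⟩ := key v' _ he'
    rcases Sym2.eq_iff.1 h with ⟨rfl, -⟩ | ⟨rfl, -⟩
    · exact hne rfl
    · rcases Finset.mem_union.1 hu' with h' | h'
      exacts [hv.1 h', hv.2 h']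
  · intro ω hω v hv hcyl
    rw [Finset.mem_compl, Finset.mem_union, not_or] at hv
    refine hω v hv.1 hv.2 (fun u hu hadj => ?_) ?_
    · rw [ofMarking_adj] at hadj
      have := hcyl.1 s(v, u) (Finset.mem_image_of_mem _ hu)
      simp [this] at hadj
    · rw [ofMarking_adj]
      exact ⟨hcyl.2 _ (by simp), fun h => hv.2 (h ▸ hy)⟩
  · simp only [card_image_star, Finset.card_singleton, pow_one, Finset.prod_const,
      Finset.card_compl, Finset.card_union_of_disjoint hAB, Fintype.card_fin, le_refl]

lemma gnp_real_specialTuple_le {n : ℕ} {p : ℝ} (hp : p ∈ Set.Ioo (0 : ℝ) 1)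
    (X₁ X₂ X₃ : Finset (Fin n)) (x₁ x₂ x₃ : Fin n) (h₁₂ : Disjoint X₁ X₂) (h₁₃ : Disjoint X₁ X₃)
    (h₂₃ : Disjoint X₂ X₃) :
    (gnp n p).real {G | SpecialTuple G X₁ X₂ X₃ x₁ x₂ x₃} ≤
      (1 - p) ^ (X₁.card * X₂.card + X₁.card * X₃.card + X₂.card * X₃.card - 3) *
        ((1 - (1 - p) ^ X₁.card) * (1 - (1 - p) ^ X₂.card) * (1 - (1 - p) ^ X₃.card)) ^
          (n - (X₁.card + X₂.card + X₃.card)) := by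
  classical
  have hq : 0 ≤ 1 - p := by linarith [hp.2]
  set F : Finset (Fin n × Fin n) := (X₁ ×ˢ X₂ ∪ X₁ ×ˢ X₃ ∪ X₂ ×ˢ X₃) \
    {(x₁, x₂), (x₁, x₃), (x₂, x₃)} with hF
  set out : Finset (Fin n) := (X₁ ∪ X₂ ∪ X₃)ᶜ with hout
  have h12 : ∀ v, v ∈ X₁ → v ∉ X₂ := fun _ => (Finset.disjoint_left.1 h₁₂ ·)
  have h13 : ∀ v, v ∈ X₁ → v ∉ X₃ := fun _ => (Finset.disjoint_left.1 h₁₃ ·)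
  have h23 : ∀ v, v ∈ X₂ → v ∉ X₃ := fun _ => (Finset.disjoint_left.1 h₂₃ ·)
  set X : Fin 3 → Finset (Fin n) := ![X₁, X₂, X₃] with hXdef
  have hX : ∀ i v, v ∈ X i → v ∈ X₁ ∪ X₂ ∪ X₃ := by
    intro i v
    fin_cases i <;> simp [X] <;> tauto
  have hXne : ∀ i j v, v ∈ X i → v ∈ X j → i = j := by
    intro i j v
    fin_cases i <;> fin_cases j <;> simp [X] <;> grind
  have hFmem : ∀ u v, (u, v) ∈ F → u ∈ X₁ ∪ X₂ ∪ X₃ ∧ v ∈ X₁ ∪ X₂ ∪ X₃ ∧ u ≠ v ∧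
      (v, u) ∉ F := by
    intro u v h
    simp only [hF, Finset.mem_sdiff, Finset.mem_union, Finset.mem_product] at h ⊢
    grind
  refine (gnp_real_le_prod hp (F.disjSum (out ×ˢ Finset.univ))
    (Sum.elim (fun _ => ∅) (fun x : Fin n × Fin 3 => (X x.2).image fun u => s(x.1, u)))
    (Sum.elim (fun x => {s(x.1, x.2)}) (fun _ => ∅)) ?_ ?_ _ ?_).trans ?_
  · rintro (x | x) _ <;> simp
  · have key : ∀ x ∈ F, ∀ y ∈ out ×ˢ (Finset.univ : Finset (Fin 3)),
        s(x.1, x.2) ∉ (X y.2).image fun u => s(y.1, u) := by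
      rintro ⟨u, v⟩ hx ⟨w, j⟩ hy hmem
      obtain ⟨t, -, h⟩ := Finset.mem_image.1 hmem
      have hw : w ∉ X₁ ∪ X₂ ∪ X₃ := Finset.mem_compl.1 (Finset.mem_product.1 hy).1
      rcases Sym2.eq_iff.1 h with ⟨rfl, -⟩ | ⟨rfl, -⟩
      · exact hw (hFmem _ _ hx).1
      · exact hw (hFmem _ _ hx).2.1
    rintro (⟨u, v⟩ | x) hx (⟨u', v'⟩ | y) hy hne
    · rw [Finset.inl_mem_disjSum] at hx hy
      simp only [Sum.elim_inl, Finset.empty_union, Finset.disjoint_singleton, ne_eq, Sym2.eq_iff]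
      rintro (⟨rfl, rfl⟩ | ⟨rfl, rfl⟩)
      · exact hne rfl
      · exact (hFmem _ _ hx).2.2.2 hy
    · rw [Finset.inl_mem_disjSum] at hx
      rw [Finset.inr_mem_disjSum] at hy
      simpa using key _ hx _ hy
    · rw [Finset.inr_mem_disjSum] at hx
      rw [Finset.inl_mem_disjSum] at hy
      simpa using key _ hy _ hx
    · rw [Finset.inr_mem_disjSum] at hx hy
      simp only [Sum.elim_inr, Finset.union_empty]
      rw [Finset.disjoint_left]
      intro e he he'
      obtain ⟨u, hu, rfl⟩ := Finset.mem_image.1 he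
      obtain ⟨u', hu', h⟩ := Finset.mem_image.1 he'
      have hw : x.1 ∉ X₁ ∪ X₂ ∪ X₃ := Finset.mem_compl.1 (Finset.mem_product.1 hx).1
      rcases Sym2.eq_iff.1 h with ⟨h1, rfl⟩ | ⟨-, rfl⟩
      · exact hne (congrArg Sum.inr (Prod.ext h1.symm (hXne _ _ _ hu hu')))
      · exact hw (hX _ _ hu')
  · rintro ω ⟨-, -, -, -, -, -, hdom, e12, e13, e23⟩ (⟨u, v⟩ | ⟨v, j⟩) hx hcyl
    · rw [Finset.inl_mem_disjSum] at hx
      have hadj : (ofMarking ω).Adj u v := by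
        rw [ofMarking_adj]
        exact ⟨hcyl.2 _ (by simp), (hFmem _ _ hx).2.2.1⟩
      simp only [hF, Finset.mem_sdiff, Finset.mem_union, Finset.mem_product, Finset.mem_insert,
        Finset.mem_singleton, Prod.mk.injEq] at hx
      obtain ⟨(h | h) | h, hn⟩ := hx
      · have := (e12 u h.1 v h.2).1 hadj
        tauto
      · have := (e13 u h.1 v h.2).1 hadj
        tauto
      · have := (e23 u h.1 v h.2).1 hadj
        tauto
    · rw [Finset.inr_mem_disjSum] at hx
      have hv := Finset.mem_compl.1 (Finset.mem_product.1 hx).1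
      simp only [Finset.mem_union, not_or] at hv
      obtain ⟨d1, d2, d3⟩ := hdom v hv.1.1 hv.1.2 hv.2
      have hex : ∃ u ∈ X j, (ofMarking ω).Adj v u := by
        fin_cases j
        exacts [d1, d2, d3]
      obtain ⟨u, hu, hadj⟩ := hex
      have := hcyl.1 s(v, u) (Finset.mem_image_of_mem _ hu)
      simp [ofMarking_adj, this] at hadj
  · have hcardF : X₁.card * X₂.card + X₁.card * X₃.card + X₂.card * X₃.card - 3 ≤ F.card := by
      have hU : (X₁ ×ˢ X₂ ∪ X₁ ×ˢ X₃ ∪ X₂ ×ˢ X₃).card =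
          X₁.card * X₂.card + X₁.card * X₃.card + X₂.card * X₃.card := by
        rw [Finset.card_union_of_disjoint, Finset.card_union_of_disjoint, Finset.card_product,
          Finset.card_product, Finset.card_product]
        · rw [Finset.disjoint_product]
          exact Or.inr h₂₃
        · rw [Finset.disjoint_union_left, Finset.disjoint_product, Finset.disjoint_product]
          exact ⟨Or.inl h₁₂, Or.inl h₁₂⟩
      rw [← hU]
      exact (Nat.sub_le_sub_left Finset.card_le_three _).trans (Finset.le_card_sdiff _ _)
    have hcardO : out.card = n - (X₁.card + X₂.card + X₃.card) := by
      rw [hout, Finset.card_compl, Finset.card_union_of_disjoint, Finset.card_union_of_disjoint h₁₂,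
        Fintype.card_fin]
      exact Finset.disjoint_union_left.2 ⟨h₁₃, h₂₃⟩
    rw [Finset.prod_disjSum, Finset.prod_product]
    simp only [Sum.elim_inl, Sum.elim_inr, card_image_star, Fin.prod_univ_three,
      Finset.prod_const, Finset.card_empty, Finset.card_singleton, pow_zero, pow_one, one_mul,
      mul_one, hcardO]
    refine mul_le_mul_of_nonneg_right (pow_le_pow_of_le_one hq (by linarith [hp.1]) hcardF) ?_
    have h1 : ∀ k : ℕ, 0 ≤ 1 - (1 - p) ^ k := fun k =>
      sub_nonneg.2 (pow_le_one₀ hq (by linarith [hp.1]))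
    exact pow_nonneg (mul_nonneg (mul_nonneg (h1 _) (h1 _)) (h1 _)) _

/-- There are two disjoint vertex sets of size `s` with no edge between them. -/
def HasEmptyPair {n : ℕ} (s : ℕ) (G : SimpleGraph (Fin n)) : Prop :=
  ∃ A B : Finset (Fin n), Disjoint A B ∧ A.card = s ∧ B.card = s ∧
    ∀ u ∈ A, ∀ v ∈ B, ¬ G.Adj u v

/-- There are disjoint sets `A`, `B` with `|A| ≤ K`, `|B| ≤ s`, and `y ∈ B` such that every
neighbor of `y` outside `A ∪ B` has a neighbor in `A`. -/
def HasDominatedStar {n : ℕ} (K s : ℕ) (G : SimpleGraph (Fin n)) : Prop :=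
  ∃ (A B : Finset (Fin n)) (y : Fin n), Disjoint A B ∧ y ∈ B ∧ A.card ≤ K ∧ B.card ≤ s ∧
    ∀ v, v ∉ A → v ∉ B → (∀ u ∈ A, ¬ G.Adj v u) → ¬ G.Adj v y

/-- There is a special tuple all of whose sets have more than `K` vertices. -/
def HasLargeSpecialTuple {n : ℕ} (K : ℕ) (G : SimpleGraph (Fin n)) : Prop :=
  ∃ (X₁ X₂ X₃ : Finset (Fin n)) (x₁ x₂ x₃ : Fin n),
    (K < X₁.card ∧ K < X₂.card ∧ K < X₃.card) ∧ SpecialTuple G X₁ X₂ X₃ x₁ x₂ x₃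

lemma SpecialTuple.swap {n : ℕ} {G : SimpleGraph (Fin n)} {X₁ X₂ X₃ : Finset (Fin n)}
    {x₁ x₂ x₃ : Fin n} (h : SpecialTuple G X₁ X₂ X₃ x₁ x₂ x₃) :
    SpecialTuple G X₁ X₃ X₂ x₁ x₃ x₂ := by
  obtain ⟨h12, h13, h23, m1, m2, m3, hdom, e12, e13, e23⟩ := h
  refine ⟨h13, h12, h23.symm, m1, m3, m2, fun v a b c => ?_, e13, e12, fun u hu v hv => ?_⟩
  · obtain ⟨d1, d2, d3⟩ := hdom v a c b
    exact ⟨d1, d3, d2⟩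
  · rw [G.adj_comm, e23 v hv u hu, and_comm]

lemma SpecialTuple.rotate {n : ℕ} {G : SimpleGraph (Fin n)} {X₁ X₂ X₃ : Finset (Fin n)}
    {x₁ x₂ x₃ : Fin n} (h : SpecialTuple G X₁ X₂ X₃ x₁ x₂ x₃) :
    SpecialTuple G X₂ X₃ X₁ x₂ x₃ x₁ := by
  obtain ⟨h12, h13, h23, m1, m2, m3, hdom, e12, e13, e23⟩ := h
  refine ⟨h23, h12.symm, h13.symm, m2, m3, m1, fun v a b c => ?_, e23, fun u hu v hv => ?_,
    fun u hu v hv => ?_⟩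
  · obtain ⟨d1, d2, d3⟩ := hdom v c a b
    exact ⟨d2, d3, d1⟩
  · rw [G.adj_comm, e12 v hv u hu, and_comm]
  · rw [G.adj_comm, e13 v hv u hu, and_comm]

lemma SpecialTuple.hasDominatedStar {n : ℕ} {G : SimpleGraph (Fin n)} {X₁ X₂ X₃ : Finset (Fin n)}
    {x₁ x₂ x₃ : Fin n} (h : SpecialTuple G X₁ X₂ X₃ x₁ x₂ x₃) {K s : ℕ} (h₁ : X₁.card ≤ K)
    (h₂ : X₂.card ≤ s) : HasDominatedStar K s G := by
  obtain ⟨h12, h13, h23, m1, m2, m3, hdom, e12, e13, e23⟩ := h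
  refine ⟨X₁, X₂, x₂, h12, m2, h₁, h₂, fun v v1 v2 hv hadj => ?_⟩
  by_cases v3 : v ∈ X₃
  · obtain ⟨-, rfl⟩ := (e23 x₂ m2 v v3).1 hadj.symm
    exact hv x₁ m1 ((e13 x₁ m1 v v3).2 ⟨rfl, rfl⟩).symm
  · obtain ⟨⟨u, hu, huv⟩, -⟩ := hdom v v1 v2 v3
    exact hv u hu huv

lemma SpecialTuple.hasEmptyPair {n : ℕ} {G : SimpleGraph (Fin n)} {X₁ X₂ X₃ : Finset (Fin n)}
    {x₁ x₂ x₃ : Fin n} (h : SpecialTuple G X₁ X₂ X₃ x₁ x₂ x₃) {s : ℕ}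
    (h₂ : s < X₂.card) (h₃ : s < X₃.card) : HasEmptyPair s G := by
  classical
  obtain ⟨h12, h13, h23, m1, m2, m3, hdom, e12, e13, e23⟩ := h
  obtain ⟨A, hA, hAc⟩ := Finset.exists_subset_card_eq (s := X₂.erase x₂) (n := s)
    (by rw [Finset.card_erase_of_mem m2]; omega)
  obtain ⟨B, hB, hBc⟩ := Finset.exists_subset_card_eq (s := X₃) (n := s) h₃.le
  refine ⟨A, B, h23.mono (hA.trans (Finset.erase_subset _ _)) hB, hAc, hBc,
      fun u hu v hv hadj => ?_⟩
  have hu' := Finset.mem_erase.1 (hA hu)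
  exact hu'.1 ((e23 u hu'.2 v (hB hv)).1 hadj).1

lemma SpecialTuple.of_card_le {n : ℕ} {G : SimpleGraph (Fin n)} {X₁ X₂ X₃ : Finset (Fin n)}
    {x₁ x₂ x₃ : Fin n} (h : SpecialTuple G X₁ X₂ X₃ x₁ x₂ x₃) {K : ℕ} (s : ℕ)
    (h₁ : X₁.card ≤ K) : HasEmptyPair s G ∨ HasDominatedStar K s G := by
  by_cases h₂ : X₂.card ≤ s
  · exact Or.inr (h.hasDominatedStar h₁ h₂)
  by_cases h₃ : X₃.card ≤ s
  · exact Or.inr (h.swap.hasDominatedStar h₁ h₃)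
  · exact Or.inl (h.hasEmptyPair (not_le.1 h₂) (not_le.1 h₃))

lemma SpecialTuple.trichotomy {n : ℕ} {G : SimpleGraph (Fin n)} {X₁ X₂ X₃ : Finset (Fin n)}
    {x₁ x₂ x₃ : Fin n} (h : SpecialTuple G X₁ X₂ X₃ x₁ x₂ x₃) (K s : ℕ) :
    (HasEmptyPair s G ∨ HasDominatedStar K s G) ∨ HasLargeSpecialTuple K G := by
  by_cases h₁ : X₁.card ≤ K
  · exact Or.inl (h.of_card_le s h₁)
  by_cases h₂ : X₂.card ≤ K
  · exact Or.inl (h.rotate.of_card_le s h₂)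
  by_cases h₃ : X₃.card ≤ K
  · exact Or.inl (h.rotate.rotate.of_card_le s h₃)
  · exact Or.inr ⟨X₁, X₂, X₃, x₁, x₂, x₃, ⟨not_le.1 h₁, not_le.1 h₂, not_le.1 h₃⟩, h⟩

lemma exists_specialTuple_of_countX_pos {n : ℕ} {G : SimpleGraph (Fin n)} {k l m : ℕ}
    (h : 0 < countX G k l m) :
    ∃ (X₁ X₂ X₃ : Finset (Fin n)) (x₁ x₂ x₃ : Fin n), SpecialTuple G X₁ X₂ X₃ x₁ x₂ x₃ := by
  obtain ⟨⟨t, -, -, -, ht⟩⟩ := (Nat.card_pos_iff.1 h).1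
  exact ⟨_, _, _, _, _, _, ht⟩

lemma card_filter_card_le (n s : ℕ) :
    ((Finset.univ : Finset (Finset (Fin n))).filter fun A => A.card ≤ s).card ≤ (n + 1) ^ s := by
  classical
  have h : ((Finset.univ : Finset (Finset (Fin n))).filter fun A => A.card ≤ s) ⊆
      (Finset.univ : Finset (Fin s → Option (Fin n))).image
        fun f => Finset.univ.filter fun v => ∃ j, f j = some v := by
    intro A hA
    rw [Finset.mem_filter] at hA
    refine Finset.mem_image.2
      ⟨fun j => if h : (j : ℕ) < A.card then some (A.equivFin.symm ⟨j, h⟩ : Fin n) else none,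
        Finset.mem_univ _, ?_⟩
    ext v
    simp only [Finset.mem_filter, Finset.mem_univ, true_and]
    constructor
    · rintro ⟨j, hj⟩
      split_ifs at hj with h
      rw [← Option.some.inj hj]
      exact (A.equivFin.symm ⟨j, h⟩).2
    · intro hv
      refine ⟨⟨A.equivFin ⟨v, hv⟩, (A.equivFin ⟨v, hv⟩).2.trans_le hA.2⟩, ?_⟩
      simp
  refine (Finset.card_le_card h).trans (Finset.card_image_le.trans ?_)
  simp

lemma gnp_real_hasEmptyPair_le {n : ℕ} {p : ℝ} (hp : p ∈ Set.Ioo (0 : ℝ) 1) (s : ℕ) :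
    (gnp n p).real {G | HasEmptyPair s G} ≤ ((n : ℝ) ^ 2 * (1 - p) ^ s) ^ s := by
  classical
  have := isProbabilityMeasure_gnp hp n
  have hq : 0 ≤ 1 - p := by linarith [hp.2]
  set P := Finset.powersetCard s (Finset.univ : Finset (Fin n)) with hP
  set I := (P ×ˢ P).filter fun x => Disjoint x.1 x.2 with hI
  have hsub : {G : SimpleGraph (Fin n) | HasEmptyPair s G} ⊆
      ⋃ x ∈ I, {G | ∀ u ∈ x.1, ∀ v ∈ x.2, ¬ G.Adj u v} := by
    rintro G ⟨A, B, hAB, hA, hB, h⟩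
    simp only [Set.mem_iUnion]
    exact ⟨(A, B), by simp [hI, hP, hA, hB, hAB], h⟩
  have hcard : (I.card : ℝ) ≤ (n : ℝ) ^ s * (n : ℝ) ^ s := by
    have h1 : I.card ≤ n ^ s * n ^ s := by
      refine (Finset.card_filter_le _ _).trans ?_
      rw [Finset.card_product, hP, Finset.card_powersetCard, Finset.card_univ, Fintype.card_fin]
      exact Nat.mul_le_mul (Nat.choose_le_pow _ _) (Nat.choose_le_pow _ _)
    exact_mod_cast h1
  calc (gnp n p).real {G | HasEmptyPair s G}
      ≤ ∑ x ∈ I, (gnp n p).real {G | ∀ u ∈ x.1, ∀ v ∈ x.2, ¬ G.Adj u v} :=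
        (measureReal_mono hsub (measure_ne_top _ _)).trans (measureReal_biUnion_finset_le _ _)
    _ ≤ ∑ x ∈ I, (1 - p) ^ (s * s) := by
        refine Finset.sum_le_sum fun x hx => ?_
        simp only [hI, hP, Finset.mem_filter, Finset.mem_product, Finset.mem_powersetCard] at hx
        have := gnp_real_no_edges_le hp hx.2
        rwa [hx.1.1.2, hx.1.2.2] at this
    _ = I.card * (1 - p) ^ (s * s) := by rw [Finset.sum_const, nsmul_eq_mul]
    _ ≤ (n : ℝ) ^ s * (n : ℝ) ^ s * (1 - p) ^ (s * s) :=
        mul_le_mul_of_nonneg_right hcard (pow_nonneg hq _)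
    _ = ((n : ℝ) ^ 2 * (1 - p) ^ s) ^ s := by
        rw [mul_pow, ← pow_mul, ← pow_mul, two_mul, pow_add]

lemma gnp_real_hasDominatedStar_le {n : ℕ} {p : ℝ} (hp : p ∈ Set.Ioo (0 : ℝ) 1) (K s : ℕ) :
    (gnp n p).real {G | HasDominatedStar K s G} ≤
      ((n : ℝ) + 1) ^ (K + s + 1) * (1 - (1 - p) ^ K * p) ^ (n - (K + s)) := by
  classical
  have := isProbabilityMeasure_gnp hp n
  have hq : 0 ≤ 1 - p := by linarith [hp.2]
  have hq1 : 1 - p ≤ 1 := by linarith [hp.1]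
  have hb : ∀ k : ℕ, 0 ≤ 1 - (1 - p) ^ k * p := fun k =>
    sub_nonneg.2 (mul_le_one₀ (pow_le_one₀ hq hq1) hp.1.le hp.2.le)
  set P : ℕ → Finset (Finset (Fin n)) := fun t => Finset.univ.filter fun A => A.card ≤ t with hP
  set I := (P K ×ˢ P s ×ˢ (Finset.univ : Finset (Fin n))).filter
    fun x => Disjoint x.1 x.2.1 ∧ x.2.2 ∈ x.2.1 with hI
  have hsub : {G : SimpleGraph (Fin n) | HasDominatedStar K s G} ⊆
      ⋃ x ∈ I, {G | ∀ v, v ∉ x.1 → v ∉ x.2.1 → (∀ u ∈ x.1, ¬ G.Adj v u) → ¬ G.Adj v x.2.2} := by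
    rintro G ⟨A, B, y, hAB, hy, hA, hB, h⟩
    simp only [Set.mem_iUnion]
    exact ⟨(A, B, y), by simp [hI, hP, hA, hB, hAB, hy], h⟩
  have hcard : (I.card : ℝ) ≤ ((n : ℝ) + 1) ^ (K + s + 1) := by
    have h1 : I.card ≤ (n + 1) ^ (K + s + 1) := by
      refine (Finset.card_filter_le _ _).trans ?_
      rw [Finset.card_product, Finset.card_product, Finset.card_univ, Fintype.card_fin,
        add_assoc, pow_add, pow_succ]
      exact Nat.mul_le_mul (card_filter_card_le n K)
        (Nat.mul_le_mul (card_filter_card_le n s) (Nat.le_succ n))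
    exact_mod_cast h1
  calc (gnp n p).real {G | HasDominatedStar K s G}
      ≤ ∑ x ∈ I, (gnp n p).real
          {G | ∀ v, v ∉ x.1 → v ∉ x.2.1 → (∀ u ∈ x.1, ¬ G.Adj v u) → ¬ G.Adj v x.2.2} :=
        (measureReal_mono hsub (measure_ne_top _ _)).trans (measureReal_biUnion_finset_le _ _)
    _ ≤ ∑ x ∈ I, (1 - (1 - p) ^ K * p) ^ (n - (K + s)) := by
        refine Finset.sum_le_sum fun x hx => ?_
        simp only [hI, hP, Finset.mem_filter, Finset.mem_product, Finset.mem_univ, true_and,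
          and_true] at hx
        refine (gnp_real_undominated_le hp hx.2.1 hx.2.2).trans ?_
        refine (pow_le_pow_of_le_one (hb _) ?_
          (Nat.sub_le_sub_left (Nat.add_le_add hx.1.1 hx.1.2) n)).trans
            (pow_le_pow_left₀ (hb _) ?_ _)
        · exact sub_le_self _ (mul_nonneg (pow_nonneg hq _) hp.1.le)
        · have := pow_le_pow_of_le_one hq hq1 hx.1.1
          nlinarith [hp.1]
    _ = I.card * (1 - (1 - p) ^ K * p) ^ (n - (K + s)) := by rw [Finset.sum_const, nsmul_eq_mul]
    _ ≤ _ := mul_le_mul_of_nonneg_right hcard (pow_nonneg (hb _) _)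

lemma gnp_real_hasLargeSpecialTuple_le {n : ℕ} {p : ℝ} (hp : p ∈ Set.Ioo (0 : ℝ) 1) (K : ℕ)
    (f : ℕ → ℝ) (hf : ∀ k, 0 ≤ f k)
    (h : ∀ k l m : ℕ, K < k → K < l → K < m → k + l + m ≤ n →
      (1 - p) ^ (k * l + k * m + l * m - 3) *
        ((1 - (1 - p) ^ k) * (1 - (1 - p) ^ l) * (1 - (1 - p) ^ m)) ^ (n - (k + l + m)) ≤
      f k * f l * f m) :
    (gnp n p).real {G | HasLargeSpecialTuple K G} ≤
      (∑ k ∈ Finset.range (n + 1), (n.choose k : ℝ) * (k * f k)) ^ 3 := by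
  classical
  have := isProbabilityMeasure_gnp hp n
  set I : Finset (Finset (Fin n) × Fin n) := Finset.univ.filter fun x => x.2 ∈ x.1 with hI
  have hsub : {G : SimpleGraph (Fin n) | HasLargeSpecialTuple K G} ⊆
      ⋃ x ∈ I ×ˢ I ×ˢ I, {G | (K < x.1.1.card ∧ K < x.2.1.1.card ∧ K < x.2.2.1.card) ∧
        SpecialTuple G x.1.1 x.2.1.1 x.2.2.1 x.1.2 x.2.1.2 x.2.2.2} := by
    rintro G ⟨X₁, X₂, X₃, x₁, x₂, x₃, hK, hG⟩
    simp only [Set.mem_iUnion]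
    refine ⟨((X₁, x₁), (X₂, x₂), (X₃, x₃)), ?_, hK, hG⟩
    simp [hI, hG.2.2.2.1, hG.2.2.2.2.1, hG.2.2.2.2.2.1]
  have hsum : ∑ x ∈ I, f x.1.card =
      ∑ k ∈ Finset.range (n + 1), (n.choose k : ℝ) * (k * f k) := by
    have h1 := Finset.sum_powerset_apply_card (fun k => (k : ℝ) * f k)
      (x := (Finset.univ : Finset (Fin n)))
    simp only [Finset.powerset_univ, Finset.card_univ, Fintype.card_fin, nsmul_eq_mul] at h1
    rw [← h1, hI, Finset.sum_filter, ← Finset.univ_product_univ, Finset.sum_product]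
    refine Finset.sum_congr rfl fun X _ => ?_
    simp only
    rw [← Finset.sum_filter, Finset.sum_const, nsmul_eq_mul]
    simp
  calc (gnp n p).real {G | HasLargeSpecialTuple K G}
      ≤ ∑ x ∈ I ×ˢ I ×ˢ I, (gnp n p).real
          {G | (K < x.1.1.card ∧ K < x.2.1.1.card ∧ K < x.2.2.1.card) ∧
            SpecialTuple G x.1.1 x.2.1.1 x.2.2.1 x.1.2 x.2.1.2 x.2.2.2} :=
        (measureReal_mono hsub (measure_ne_top _ _)).trans (measureReal_biUnion_finset_le _ _)
    _ ≤ ∑ x ∈ I ×ˢ I ×ˢ I, f x.1.1.card * (f x.2.1.1.card * f x.2.2.1.card) := by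
        refine Finset.sum_le_sum fun x _ => ?_
        obtain ⟨⟨X₁, x₁⟩, ⟨X₂, x₂⟩, X₃, x₃⟩ := x
        simp only
        by_cases hne : (K < X₁.card ∧ K < X₂.card ∧ K < X₃.card) ∧
            Disjoint X₁ X₂ ∧ Disjoint X₁ X₃ ∧ Disjoint X₂ X₃
        · obtain ⟨⟨k1, k2, k3⟩, d12, d13, d23⟩ := hne
          have hcard : X₁.card + X₂.card + X₃.card ≤ n := by
            rw [← Finset.card_union_of_disjoint d12,
              ← Finset.card_union_of_disjoint (Finset.disjoint_union_left.2 ⟨d13, d23⟩)]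
            simpa using Finset.card_le_univ (X₁ ∪ X₂ ∪ X₃)
          rw [← mul_assoc]
          exact (measureReal_mono fun G hG => hG.2).trans
            ((gnp_real_specialTuple_le hp X₁ X₂ X₃ x₁ x₂ x₃ d12 d13 d23).trans
              (h _ _ _ k1 k2 k3 hcard))
        · have hempty : {G : SimpleGraph (Fin n) | (K < X₁.card ∧ K < X₂.card ∧ K < X₃.card) ∧
              SpecialTuple G X₁ X₂ X₃ x₁ x₂ x₃} = ∅ := by
            ext G
            simp only [Set.mem_ofPred_eq, Set.mem_empty_iff_false, iff_false]
            exact fun hG => hne ⟨hG.1, hG.2.1, hG.2.2.1, hG.2.2.2.1⟩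
          rw [hempty, measureReal_empty]
          exact mul_nonneg (hf _) (mul_nonneg (hf _) (hf _))
    _ = (∑ x ∈ I, f x.1.card) ^ 3 := by
        simp only [Finset.sum_product, ← Finset.mul_sum, ← Finset.sum_mul]
        ring
    _ = _ := by rw [hsum]

lemma exists_linear_gap {L : ℝ} (hL : 0 < L) :
    ∃ δ : ℝ, 0 < δ ∧ ∀ u : ℝ, L / 2 ≤ |u| → 1 + u + δ * |u| ≤ exp u := by
  set v := L / 2 with hv
  have hv0 : 0 < v := by positivity
  have hgap : 0 < v - 1 + exp (-v) := by
    have := add_one_lt_exp (x := -v) (by linarith)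
    linarith
  refine ⟨min (v / 2) ((v - 1 + exp (-v)) / v), lt_min (by positivity) (by positivity),
    fun u hu => ?_⟩
  rcases le_or_gt 0 u with h | h
  · rw [abs_of_nonneg h] at hu ⊢
    have h1 := quadratic_le_exp_of_nonneg h
    have h2 : min (v / 2) ((v - 1 + exp (-v)) / v) * u ≤ v / 2 * u :=
      mul_le_mul_of_nonneg_right (min_le_left _ _) h
    nlinarith
  · rw [abs_of_neg h] at hu ⊢
    have h2 : min (v / 2) ((v - 1 + exp (-v)) / v) * -u ≤ (v - 1 + exp (-v)) / v * -u :=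
      mul_le_mul_of_nonneg_right (min_le_right _ _) (by linarith)
    have h3 : exp (-v) * (1 + (u + v)) ≤ exp u := by
      have h4 := add_one_le_exp (u + v)
      calc exp (-v) * (1 + (u + v)) ≤ exp (-v) * exp (u + v) :=
            mul_le_mul_of_nonneg_left (by linarith) (exp_pos _).le
        _ = exp u := by rw [← exp_add]; ring_nf
    have h5 : 1 - exp (-v) * (1 + v) ≥ 0 := by
      have h4 := add_one_le_exp v
      have : exp (-v) * exp v = 1 := by rw [← exp_add]; simp
      nlinarith [exp_pos (-v)]
    have h6 : (v - 1 + exp (-v)) / v * -u =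
        (1 - exp (-v)) * -u - (-u / v) * (1 - exp (-v) * (1 + v)) := by
      field_simp
      ring
    have h7 : 1 ≤ -u / v := by rwa [le_div_iff₀ hv0, one_mul]
    nlinarith

lemma exists_gap_of_int {L : ℝ} (hL : 0 < L) :
    ∃ δ : ℝ, 0 < δ ∧ ∀ x : ℤ,
      1 + L * (1 / 2 - x) + δ * (1 + |(x : ℝ)|) ≤ exp (L * (1 / 2 - x)) := by
  obtain ⟨δ, hδ, h⟩ := exists_linear_gap hL
  refine ⟨δ * L / 4, by positivity, fun x => ?_⟩
  have habs : 1 / 2 ≤ |(1 / 2 - x : ℝ)| ∧ 1 + |(x : ℝ)| ≤ 4 * |(1 / 2 - x : ℝ)| := by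
    rcases le_or_gt x 0 with hx | hx
    · have hx' : (x : ℝ) ≤ 0 := by exact_mod_cast hx
      rw [abs_of_nonpos hx', abs_of_nonneg (by linarith)]
      constructor <;> linarith
    · have hx' : (1 : ℝ) ≤ x := by exact_mod_cast hx
      rw [abs_of_nonneg (by linarith : (0 : ℝ) ≤ x), abs_of_nonpos (by linarith)]
      constructor <;> linarith
  have hu : |L * (1 / 2 - (x : ℝ))| = L * |(1 / 2 - x : ℝ)| := by rw [abs_mul, abs_of_pos hL]
  have h1 := h (L * (1 / 2 - x)) (by rw [hu]; nlinarith [habs.1])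
  rw [hu] at h1
  have h2 : δ * L / 4 * (1 + |(x : ℝ)|) ≤ δ * L / 4 * (4 * |(1 / 2 - x : ℝ)|) :=
    mul_le_mul_of_nonneg_left habs.2 (by positivity)
  linarith

lemma neg_mul_le_of_neg_le {x y t : ℝ} (hx : -t ≤ x) (hy : -t ≤ y) (ht : 0 ≤ t) :
    -(x * y) ≤ t * (|x| + |y|) := by
  rcases le_total 0 x with h1 | h1 <;> rcases le_total 0 y with h2 | h2 <;>
    simp only [abs_of_nonneg, abs_of_nonpos, h1, h2] <;> nlinarith

/-- Comparison of exponents: with `k = i + x`, `l = i + y`, `m = i + z`, the term `a` stands for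
`(1 - p) ^ k` and `A` for the normalised `n (1 - p) ^ k / i`. -/
lemma exponent_bound {L δ η ε i x y z a b c A B C : ℝ} (hL : 0 < L) (hη : 0 ≤ η)
    (hi : 1 ≤ i) (hηδ : 2 * η * L ≤ δ / 4) (hεδ : 6 * ε ≤ δ / 4) (hiδ : L / 2 ≤ i * (δ / 4))
    (hx : -(η * i) ≤ x) (hy : -(η * i) ≤ y) (hz : -(η * i) ≤ z) (hS : 0 ≤ 3 * i + (x + y + z))
    (ha : a ≤ ε) (hb : b ≤ ε) (hc : c ≤ ε) (hε : 0 ≤ ε)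
    (hA : 1 + L * (1 / 2 - x) + δ * (1 + |x|) ≤ A)
    (hB : 1 + L * (1 / 2 - y) + δ * (1 + |y|) ≤ B)
    (hC : 1 + L * (1 / 2 - z) + δ * (1 + |z|) ≤ C) :
    -(L * ((i + x) * (i + y) + (i + x) * (i + z) + (i + y) * (i + z))) - i * (A + B + C) +
        (a + b + c) * (1 + (3 * i + (x + y + z))) ≤
      (-(L * (i + 1 / 2) * (i + x)) - i - δ / 4 * (i * (1 + |x|))) +
      (-(L * (i + 1 / 2) * (i + y)) - i - δ / 4 * (i * (1 + |y|))) +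
      (-(L * (i + 1 / 2) * (i + z)) - i - δ / 4 * (i * (1 + |z|))) := by
  have hi0 : 0 ≤ i := by linarith
  have ht : 0 ≤ η * i := by positivity
  set Y := 3 + |x| + |y| + |z| with hY
  have hY3 : 3 ≤ Y := by linarith [abs_nonneg x, abs_nonneg y, abs_nonneg z]
  have hSY : x + y + z ≤ Y - 3 := by linarith [le_abs_self x, le_abs_self y, le_abs_self z]
  have hQ : -(x * y + x * z + y * z) ≤ 2 * (η * i) * Y := by
    have h1 := neg_mul_le_of_neg_le hx hy ht
    have h2 := neg_mul_le_of_neg_le hx hz ht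
    have h3 := neg_mul_le_of_neg_le hy hz ht
    rw [hY]
    linarith
  have hLQ : -(L * (x * y + x * z + y * z)) ≤ δ / 4 * (i * Y) := by
    have h1 : L * -(x * y + x * z + y * z) ≤ L * (2 * (η * i) * Y) :=
      mul_le_mul_of_nonneg_left hQ hL.le
    have h2 : 2 * η * L * (i * Y) ≤ δ / 4 * (i * Y) :=
      mul_le_mul_of_nonneg_right hηδ (by positivity)
    linarith
  have hLS : L / 2 * (x + y + z) ≤ δ / 4 * (i * Y) := by
    have h1 : L / 2 * (x + y + z) ≤
        L / 2 * Y := mul_le_mul_of_nonneg_left (by linarith) (by linarith)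
    have h2 : L / 2 * Y ≤ i * (δ / 4) * Y := mul_le_mul_of_nonneg_right hiδ (by linarith)
    linarith
  have hloss : (a + b + c) * (1 + (3 * i + (x + y + z))) ≤ δ / 4 * (i * Y) := by
    have h1 : (a + b + c) * (1 + (3 * i + (x + y + z))) ≤
        3 * ε * (1 + (3 * i + (x + y + z))) :=
      mul_le_mul_of_nonneg_right (by linarith) (by linarith)
    have h2 : 1 + (3 * i + (x + y + z)) ≤ 2 * (i * Y) := by nlinarith
    have h3 : 3 * ε * (1 + (3 * i + (x + y + z))) ≤ 3 * ε * (2 * (i * Y)) :=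
      mul_le_mul_of_nonneg_left h2 (by linarith)
    have h4 : 6 * ε * (i * Y) ≤ δ / 4 * (i * Y) := mul_le_mul_of_nonneg_right hεδ (by positivity)
    linarith
  have hABC : i * ((1 + L * (1 / 2 - x) + δ * (1 + |x|)) + (1 + L * (1 / 2 - y) + δ * (1 + |y|)) +
      (1 + L * (1 / 2 - z) + δ * (1 + |z|))) ≤ i * (A + B + C) :=
    mul_le_mul_of_nonneg_left (by linarith) hi0
  have hexp : δ * (i * Y) = i * (δ * (1 + |x|)) + i * (δ * (1 + |y|)) + i * (δ * (1 + |z|)) := by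
    rw [hY]; ring
  nlinarith

section Sequence

variable {p : ℝ}

/-- `L = log (1 / (1 - p))`. -/
noncomputable def logInv (p : ℝ) : ℝ := -log (1 - p)

lemma logInv_pos (hp : p ∈ Set.Ioo (0 : ℝ) 1) : 0 < logInv p :=
  neg_pos.2 (log_neg (by linarith [hp.2]) (by linarith [hp.1]))

lemma one_sub_pow_eq_exp (hp : p ∈ Set.Ioo (0 : ℝ) 1) (k : ℕ) :
    (1 - p) ^ k = exp (-(logInv p * k)) := by
  rw [logInv, neg_mul, neg_neg, mul_comm, exp_nat_mul, exp_log (by linarith [hp.2])]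

lemma nseq1_eq_floor (hp : p ∈ Set.Ioo (0 : ℝ) 1) (i : ℕ) :
    nseq1 p i = ⌊exp (logInv p * (i + 1 / 2)) * i⌋₊ := by
  have hq : 0 < 1 - p := by linarith [hp.2]
  rw [nseq1, rpow_def_of_pos (by positivity), logInv, one_div, log_inv]

lemma nseq1_le (hp : p ∈ Set.Ioo (0 : ℝ) 1) (i : ℕ) :
    (nseq1 p i : ℝ) ≤ exp (logInv p * (i + 1 / 2)) * i := by
  rw [nseq1_eq_floor hp]
  exact Nat.floor_le (by positivity)

lemma le_nseq1_add_one (hp : p ∈ Set.Ioo (0 : ℝ) 1) (i : ℕ) :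
    exp (logInv p * (i + 1 / 2)) * i ≤ nseq1 p i + 1 := by
  rw [nseq1_eq_floor hp]
  exact (Nat.lt_floor_add_one _).le

lemma tendsto_sq_mul_exp_neg {c : ℝ} (hc : 0 < c) :
    Tendsto (fun i : ℕ => (i : ℝ) ^ 2 * exp (-(c * i))) atTop (nhds 0) := by
  have h := (tendsto_pow_mul_exp_neg_atTop_nhds_zero 2).comp
    (tendsto_natCast_atTop_atTop (R := ℝ) |>.const_mul_atTop hc)
  have h2 := h.const_mul (1 / c ^ 2)
  rw [mul_zero] at h2
  refine h2.congr fun i => ?_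
  simp only [Function.comp]
  field_simp

lemma tendsto_gnp_hasEmptyPair (hp : p ∈ Set.Ioo (0 : ℝ) 1) :
    Tendsto (fun i : ℕ => (gnp (nseq1 p i) p).real {G | HasEmptyPair (3 * i) G})
      atTop (nhds 0) := by
  have hL := logInv_pos hp
  have hsmall : ∀ᶠ i : ℕ in atTop, exp (logInv p) * ((i : ℝ) ^ 2 * exp (-(logInv p * i))) <
      1 / 2 := by
    have h := (tendsto_sq_mul_exp_neg hL).const_mul (exp (logInv p))
    rw [mul_zero] at h
    exact h.eventually_lt_const (by norm_num)
  refine squeeze_zero' (Eventually.of_forall fun i => measureReal_nonneg) ?_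
    (tendsto_pow_atTop_nhds_zero_of_lt_one (r := (1 / 2 : ℝ)) (by norm_num) (by norm_num))
  filter_upwards [hsmall] with i hi
  refine (gnp_real_hasEmptyPair_le hp _).trans ?_
  have hbase : ((nseq1 p i : ℝ)) ^ 2 * (1 - p) ^ (3 * i) ≤ 1 / 2 := by
    refine le_trans ?_ hi.le
    rw [one_sub_pow_eq_exp hp]
    refine (mul_le_mul_of_nonneg_right (pow_le_pow_left₀ (Nat.cast_nonneg _) (nseq1_le hp i) 2)
      (exp_pos _).le).trans (le_of_eq ?_)
    rw [mul_pow, ← exp_nat_mul, mul_right_comm, ← exp_add,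
      mul_left_comm (exp (logInv p)), ← exp_add, mul_comm]
    congr 2
    push_cast
    ring
  have h0 : 0 ≤ ((nseq1 p i : ℝ)) ^ 2 * (1 - p) ^ (3 * i) := by
    rw [one_sub_pow_eq_exp hp]
    positivity
  calc _ ≤ (1 / 2 : ℝ) ^ (3 * i) := pow_le_pow_left₀ h0 hbase _
    _ ≤ (1 / 2 : ℝ) ^ i := pow_le_pow_of_le_one (by norm_num) (by norm_num) (by omega)

lemma tendsto_exp_neg_mul_natCast {c : ℝ} (hc : 0 < c) :
    Tendsto (fun i : ℕ => exp (-(c * i))) atTop (nhds 0) :=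
  tendsto_exp_neg_atTop_nhds_zero.comp
    ((tendsto_natCast_atTop_atTop (R := ℝ)).const_mul_atTop hc)

lemma nseq1_add_one_le (hp : p ∈ Set.Ioo (0 : ℝ) 1) {i : ℕ} (hi : 1 ≤ i) :
    (nseq1 p i : ℝ) + 1 ≤ exp ((2 * logInv p + 1) * i) := by
  have hL := logInv_pos hp
  have hi' : (1 : ℝ) ≤ i := by exact_mod_cast hi
  have h1 : (1 : ℝ) ≤ exp (logInv p * (i + 1 / 2)) := one_le_exp (by positivity)
  calc (nseq1 p i : ℝ) + 1
      ≤ exp (logInv p * (i + 1 / 2)) * i + exp (logInv p * (i + 1 / 2)) :=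
        add_le_add (nseq1_le hp i) h1
    _ = exp (logInv p * (i + 1 / 2)) * (i + 1) := by ring
    _ ≤ exp (logInv p * (i + 1 / 2)) * exp i :=
        mul_le_mul_of_nonneg_left (add_one_le_exp _) (exp_pos _).le
    _ = exp (logInv p * (i + 1 / 2) + i) := by rw [exp_add]
    _ ≤ exp ((2 * logInv p + 1) * i) := exp_le_exp.2 (by nlinarith)

lemma tendsto_gnp_hasDominatedStar (hp : p ∈ Set.Ioo (0 : ℝ) 1) {η : ℝ} (hη : 0 < η)
    (hη1 : η ≤ 1) :
    Tendsto (fun i : ℕ =>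
      (gnp (nseq1 p i) p).real {G | HasDominatedStar ⌊(1 - η) * i⌋₊ (3 * i) G})
      atTop (nhds 0) := by
  have hL := logInv_pos hp
  set L := logInv p with hLdef
  set D := 5 * (2 * L + 1) + 1 with hD
  have hD0 : 0 < D := by positivity
  have hsmall : ∀ᶠ i : ℕ in atTop, (i : ℝ) ^ 2 * exp (-(L * η * i)) < p / D :=
    (tendsto_sq_mul_exp_neg (mul_pos hL hη)).eventually_lt_const (div_pos hp.1 hD0)
  have hnine : ∀ᶠ i : ℕ in atTop, exp (-(L * i)) < 1 / 9 :=
    (tendsto_exp_neg_mul_natCast hL).eventually_lt_const (by norm_num)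
  refine squeeze_zero' (Eventually.of_forall fun i => measureReal_nonneg) ?_
    (tendsto_exp_neg_mul_natCast one_pos)
  filter_upwards [hsmall, hnine, eventually_ge_atTop 2] with i hi hi9 hi2
  have hi2' : (2 : ℝ) ≤ i := by exact_mod_cast hi2
  refine (gnp_real_hasDominatedStar_le hp _ _).trans ?_
  set K := ⌊(1 - η) * (i : ℝ)⌋₊ with hK
  have hKi : K ≤ i := by
    rw [hK]
    refine (Nat.floor_le_floor (b := (i : ℝ)) ?_).trans (Nat.floor_natCast i).le
    nlinarith
  have hKη : L * K ≤ L * i - L * η * i := by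
    have := mul_le_mul_of_nonneg_left
      (Nat.floor_le (mul_nonneg (sub_nonneg.2 hη1) (Nat.cast_nonneg (α := ℝ) i))) hL.le
    linarith
  set n := nseq1 p i with hn
  have hexp9 : 9 ≤ exp (L * i) := by
    rw [exp_neg, one_div] at hi9
    exact ((inv_lt_inv₀ (exp_pos _) (by norm_num)).1 hi9).le
  have hsub : exp (L * i) ≤ ((n - (K + 3 * i) : ℕ) : ℝ) := by
    have h1 := le_nseq1_add_one hp i
    have h2 : exp (L * i) ≤ exp (L * (i + 1 / 2)) := exp_le_exp.2 (by nlinarith)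
    have h3 : (n : ℝ) ≤ ((n - (K + 3 * i) : ℕ) : ℝ) + (K + 3 * i) := by
      have : n ≤ (n - (K + 3 * i)) + (K + 3 * i) := by omega
      exact_mod_cast this
    have h4 : (K : ℝ) ≤ i := by exact_mod_cast hKi
    nlinarith
  have hq : p * exp (L * η * i) ≤ (1 - p) ^ K * p * ((n - (K + 3 * i) : ℕ) : ℝ) := by
    have h1 : exp (L * η * i) ≤ exp (-(L * K)) * exp (L * i) := by
      rw [← exp_add]
      exact exp_le_exp.2 (by linarith)
    rw [one_sub_pow_eq_exp hp, mul_comm (exp (-(logInv p * K))) p, mul_assoc p (exp _)]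
    exact mul_le_mul_of_nonneg_left
      (h1.trans (mul_le_mul_of_nonneg_left hsub (exp_pos _).le)) hp.1.le
  have hmain : D * (i : ℝ) ^ 2 ≤ p * exp (L * η * i) := by
    rw [lt_div_iff₀ hD0, exp_neg, ← div_eq_mul_inv, div_mul_eq_mul_div,
      div_lt_iff₀ (exp_pos _)] at hi
    linarith
  have hb : 0 ≤ 1 - (1 - p) ^ K * p := sub_nonneg.2
    (mul_le_one₀ (pow_le_one₀ (by linarith [hp.2]) (by linarith [hp.1])) hp.1.le hp.2.le)
  calc ((n : ℝ) + 1) ^ (K + 3 * i + 1) * (1 - (1 - p) ^ K * p) ^ (n - (K + 3 * i))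
      ≤ exp ((2 * L + 1) * i) ^ (5 * i) * exp (-((1 - p) ^ K * p)) ^ (n - (K + 3 * i)) := by
        refine mul_le_mul ?_ (pow_le_pow_left₀ hb (one_sub_le_exp_neg _) _) (pow_nonneg hb _)
          (by positivity)
        exact (pow_le_pow_right₀ (by linarith [(Nat.cast_nonneg n : (0 : ℝ) ≤ n)])
          (by omega)).trans (pow_le_pow_left₀ (by positivity)
            (nseq1_add_one_le hp (by omega)) _)
    _ = exp (5 * (2 * L + 1) * (i : ℝ) ^ 2 -
          (1 - p) ^ K * p * ((n - (K + 3 * i) : ℕ) : ℝ)) := by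
        rw [← exp_nat_mul, ← exp_nat_mul, ← exp_add]
        congr 1
        rw [Nat.cast_mul]
        push_cast
        ring
    _ ≤ exp (-(1 * i)) := by
        refine exp_le_exp.2 ?_
        have : (i : ℝ) ≤ (i : ℝ) ^ 2 := by nlinarith
        rw [hD] at hmain
        linarith

lemma specialTuple_term_le (hp : p ∈ Set.Ioo (0 : ℝ) 1) {δ η ε : ℝ}
    (hδ : ∀ x : ℤ, 1 + logInv p * (1 / 2 - x) + δ * (1 + |(x : ℝ)|) ≤
      exp (logInv p * (1 / 2 - x)))
    (hη : 0 ≤ η) (hη2 : η ≤ 1 / 2) (hηδ : 2 * η * logInv p ≤ δ / 4) (hε : 0 ≤ ε)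
    (hεδ : 6 * ε ≤ δ / 4) {i : ℕ} (hi : 1 ≤ i) (hiδ : logInv p / 2 ≤ i * (δ / 4))
    (hiε : exp (-(logInv p / 2 * i)) ≤ ε) {k l m : ℕ} (hk : ⌊(1 - η) * (i : ℝ)⌋₊ < k)
    (hl : ⌊(1 - η) * (i : ℝ)⌋₊ < l) (hm : ⌊(1 - η) * (i : ℝ)⌋₊ < m)
    (hn : k + l + m ≤ nseq1 p i) {f : ℕ → ℝ}
    (hf : ∀ k, f k = exp (logInv p) * exp (-(logInv p * (i + 1 / 2) * k) - i -
      δ / 4 * (i * (1 + |(k : ℝ) - i|)))) :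
    (1 - p) ^ (k * l + k * m + l * m - 3) *
        ((1 - (1 - p) ^ k) * (1 - (1 - p) ^ l) * (1 - (1 - p) ^ m)) ^ (nseq1 p i - (k + l + m)) ≤
      f k * f l * f m := by
  have hL := logInv_pos hp
  set L := logInv p with hLdef
  set n := nseq1 p i with hndef
  have hq : 0 ≤ 1 - p := by linarith [hp.2]
  have hq1 : 1 - p ≤ 1 := by linarith [hp.1]
  have hi' : (1 : ℝ) ≤ i := by exact_mod_cast hi
  have hb : ∀ k : ℕ, 0 ≤ 1 - (1 - p) ^ k := fun k => sub_nonneg.2 (pow_le_one₀ hq hq1)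
  have hlow : ∀ {k : ℕ}, ⌊(1 - η) * (i : ℝ)⌋₊ < k → -(η * i) ≤ (k : ℝ) - i := by
    intro k hk
    have := Nat.lt_of_floor_lt hk
    linarith
  have hsmall : ∀ {k : ℕ}, ⌊(1 - η) * (i : ℝ)⌋₊ < k → (1 - p) ^ k ≤ ε := by
    intro k hk
    have := hlow hk
    rw [one_sub_pow_eq_exp hp]
    refine (exp_le_exp.2 ?_).trans hiε
    have h2 : (i : ℝ) / 2 ≤ k := by nlinarith
    have h3 := mul_le_mul_of_nonneg_left h2 hL.le
    linarith
  have hgap : ∀ k : ℕ, 1 + L * (1 / 2 - ((k : ℝ) - i)) + δ * (1 + |(k : ℝ) - i|) ≤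
      exp (L * (1 / 2 - ((k : ℝ) - i))) := by
    intro k
    have := hδ ((k : ℤ) - i)
    push_cast at this
    exact this
  have hNq : ∀ k : ℕ, exp (L * (i + 1 / 2)) * i * (1 - p) ^ k =
      i * exp (L * (1 / 2 - ((k : ℝ) - i))) := by
    intro k
    rw [one_sub_pow_eq_exp hp, mul_right_comm, ← exp_add, mul_comm]
    congr 2
    ring
  have hpow : (1 - p) ^ (k * l + k * m + l * m - 3) ≤
      exp (3 * L) * exp (-(L * ((k : ℝ) * l + k * m + l * m))) := by
    rw [one_sub_pow_eq_exp hp, ← exp_add]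
    refine exp_le_exp.2 ?_
    have h1 : k * l + k * m + l * m ≤ (k * l + k * m + l * m - 3) + 3 := by omega
    have h2 : (k : ℝ) * l + k * m + l * m ≤ ((k * l + k * m + l * m - 3 : ℕ) : ℝ) + 3 := by
      exact_mod_cast h1
    have h3 := mul_le_mul_of_nonneg_left h2 hL.le
    linarith
  have hprod : ((1 - (1 - p) ^ k) * (1 - (1 - p) ^ l) * (1 - (1 - p) ^ m)) ^ (n - (k + l + m)) ≤
      exp (-(((1 - p) ^ k + (1 - p) ^ l + (1 - p) ^ m) *
        (exp (L * (i + 1 / 2)) * i - (1 + (k + l + m))))) := by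
    have h1 : (1 - (1 - p) ^ k) * (1 - (1 - p) ^ l) * (1 - (1 - p) ^ m) ≤
        exp (-((1 - p) ^ k + (1 - p) ^ l + (1 - p) ^ m)) := by
      rw [neg_add, neg_add, exp_add, exp_add]
      exact mul_le_mul (mul_le_mul (one_sub_le_exp_neg _) (one_sub_le_exp_neg _) (hb _)
        (exp_pos _).le) (one_sub_le_exp_neg _) (hb _) (by positivity)
    refine (pow_le_pow_left₀ (mul_nonneg (mul_nonneg (hb _) (hb _)) (hb _)) h1 _).trans ?_
    rw [← exp_nat_mul]
    refine exp_le_exp.2 ?_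
    have h2 := le_nseq1_add_one hp i
    have h3 : exp (L * (i + 1 / 2)) * i - (1 + (k + l + m)) ≤ ((n - (k + l + m) : ℕ) : ℝ) := by
      rw [Nat.cast_sub hn]
      push_cast
      linarith
    have h4 : 0 ≤ (1 - p) ^ k + (1 - p) ^ l + (1 - p) ^ m :=
      add_nonneg (add_nonneg (pow_nonneg hq _) (pow_nonneg hq _)) (pow_nonneg hq _)
    have h5 := mul_le_mul_of_nonneg_left h3 h4
    linarith
  have hbound := exponent_bound (i := (i : ℝ)) (x := (k : ℝ) - i) (y := (l : ℝ) - i)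
    (z := (m : ℝ) - i) hL hη hi' hηδ hεδ hiδ (hlow hk) (hlow hl) (hlow hm)
    (by linarith [(Nat.cast_nonneg k : (0 : ℝ) ≤ k), (Nat.cast_nonneg l : (0 : ℝ) ≤ l),
      (Nat.cast_nonneg m : (0 : ℝ) ≤ m)])
    (hsmall hk) (hsmall hl) (hsmall hm) hε (hgap k) (hgap l) (hgap m)
  simp only [add_sub_cancel] at hbound
  calc _ ≤ exp (3 * L) * exp (-(L * ((k : ℝ) * l + k * m + l * m))) *
        exp (-(((1 - p) ^ k + (1 - p) ^ l + (1 - p) ^ m) *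
          (exp (L * (i + 1 / 2)) * i - (1 + (k + l + m))))) :=
        mul_le_mul hpow hprod (pow_nonneg (mul_nonneg (mul_nonneg (hb _) (hb _)) (hb _)) _)
          (by positivity)
    _ ≤ f k * f l * f m := by
        rw [hf, hf, hf]
        simp only [← exp_add]
        refine exp_le_exp.2 ?_
        have h1 := hNq k
        have h2 := hNq l
        have h3 := hNq m
        linarith

lemma sum_exp_neg_abs_sub_le {c : ℝ} (hc : 0 < c) :
    ∃ M : ℝ, ∀ (s : Finset ℕ) (i : ℕ), ∑ k ∈ s, exp (-(c * |(k : ℝ) - i|)) ≤ M := by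
  have hgeom : Summable fun j : ℕ => exp (-(c * j)) := by
    have := Real.summable_exp_nat_mul_iff.2 (neg_lt_zero.2 hc)
    refine this.congr fun j => ?_
    congr 1
    ring
  have hsum : Summable fun j : ℤ => exp (-(c * |(j : ℝ)|)) := by
    refine Summable.of_nat_of_neg ?_ ?_ <;> simpa using hgeom
  refine ⟨∑' j : ℤ, exp (-(c * |(j : ℝ)|)), fun s i => ?_⟩
  have hinj : Function.Injective fun k : ℕ => (k : ℤ) - i := fun a b h => by
    simpa using h
  have := hsum.sum_le_tsum (s.map ⟨_, hinj⟩) fun j _ => (exp_pos _).le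
  rw [Finset.sum_map] at this
  simpa using this

lemma choose_nseq1_le (hp : p ∈ Set.Ioo (0 : ℝ) 1) (i k : ℕ) :
    ((nseq1 p i).choose k : ℝ) ≤ exp (logInv p * (i + 1 / 2) * k + i) := by
  calc ((nseq1 p i).choose k : ℝ) ≤ (nseq1 p i : ℝ) ^ k / k.factorial :=
        Nat.choose_le_pow_div k (nseq1 p i)
    _ ≤ (exp (logInv p * (i + 1 / 2)) * i) ^ k / k.factorial := by
        gcongr
        exact nseq1_le hp i
    _ = exp (logInv p * (i + 1 / 2) * k) * ((i : ℝ) ^ k / k.factorial) := by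
        rw [mul_pow, ← exp_nat_mul, mul_div_assoc]
        congr 2
        ring
    _ ≤ exp (logInv p * (i + 1 / 2) * k) * exp i :=
        mul_le_mul_of_nonneg_left (pow_div_factorial_le_exp _ (Nat.cast_nonneg i) k) (exp_pos _).le
    _ = _ := by rw [exp_add]

lemma sum_choose_mul_le (hp : p ∈ Set.Ioo (0 : ℝ) 1) {c : ℝ} (hc : 0 < c) :
    ∃ M : ℝ, ∀ i : ℕ, 1 ≤ i →
      ∑ k ∈ Finset.range (nseq1 p i + 1), ((nseq1 p i).choose k : ℝ) * (k * (exp (logInv p) *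
        exp (-(logInv p * (i + 1 / 2) * k) - i - c * (i * (1 + |(k : ℝ) - i|))))) ≤
      M * exp (-(c / 2 * i)) := by
  obtain ⟨M, hM⟩ := sum_exp_neg_abs_sub_le (half_pos hc)
  refine ⟨exp (logInv p) * (2 / c) * M, fun i hi => ?_⟩
  have hi' : (1 : ℝ) ≤ i := by exact_mod_cast hi
  have hterm : ∀ k : ℕ, ((nseq1 p i).choose k : ℝ) * (k * (exp (logInv p) *
      exp (-(logInv p * (i + 1 / 2) * k) - i - c * (i * (1 + |(k : ℝ) - i|))))) ≤
      exp (logInv p) * (2 / c) * exp (-(c / 2 * i)) * exp (-(c / 2 * |(k : ℝ) - i|)) := by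
    intro k
    set a := |(k : ℝ) - i| with ha
    have ha0 : 0 ≤ a := abs_nonneg _
    have hk : (k : ℝ) ≤ i * (1 + a) := by
      have := le_abs_self ((k : ℝ) - i)
      nlinarith
    have hk2 : (k : ℝ) ≤ 2 / c * exp (c / 2 * (i * (1 + a))) := by
      have h1 := add_one_le_exp (c / 2 * (i * (1 + a)))
      have h2 : i * (1 + a) = 2 / c * (c / 2 * (i * (1 + a))) := by field_simp
      rw [h2] at hk
      refine hk.trans (mul_le_mul_of_nonneg_left (by linarith) (by positivity))
    calc _ ≤ exp (logInv p * (i + 1 / 2) * k + i) *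
          (2 / c * exp (c / 2 * (i * (1 + a))) * (exp (logInv p) *
            exp (-(logInv p * (i + 1 / 2) * k) - i - c * (i * (1 + a))))) := by
          refine mul_le_mul (choose_nseq1_le hp i k)
            (mul_le_mul_of_nonneg_right hk2 (by positivity)) (by positivity) (by positivity)
      _ = exp (logInv p) * (2 / c) * exp (-(c / 2 * (i * (1 + a)))) := by
          have hexp : exp (-(c / 2 * (i * (1 + a)))) = exp (logInv p * (i + 1 / 2) * k + i) *
              exp (c / 2 * (i * (1 + a))) *
              exp (-(logInv p * (i + 1 / 2) * k) - i - c * (i * (1 + a))) := by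
            rw [← exp_add, ← exp_add]
            congr 1
            ring
          rw [hexp]
          ring
      _ ≤ exp (logInv p) * (2 / c) * (exp (-(c / 2 * i)) * exp (-(c / 2 * a))) := by
          rw [← exp_add]
          refine mul_le_mul_of_nonneg_left (exp_le_exp.2 ?_) (by positivity)
          have : c / 2 * a ≤ c / 2 * (i * a) :=
            mul_le_mul_of_nonneg_left (by nlinarith) (by positivity)
          linarith
      _ = _ := by ring
  calc _ ≤ ∑ k ∈ Finset.range (nseq1 p i + 1),
        exp (logInv p) * (2 / c) * exp (-(c / 2 * i)) * exp (-(c / 2 * |(k : ℝ) - i|)) :=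
        Finset.sum_le_sum fun k _ => hterm k
    _ = exp (logInv p) * (2 / c) * exp (-(c / 2 * i)) *
        ∑ k ∈ Finset.range (nseq1 p i + 1), exp (-(c / 2 * |(k : ℝ) - i|)) := by
        rw [Finset.mul_sum]
    _ ≤ exp (logInv p) * (2 / c) * exp (-(c / 2 * i)) * M :=
        mul_le_mul_of_nonneg_left (hM _ i) (by positivity)
    _ = _ := by ring

lemma exists_tendsto_gnp_hasLargeSpecialTuple (hp : p ∈ Set.Ioo (0 : ℝ) 1) :
    ∃ η : ℝ, 0 < η ∧ η ≤ 1 / 2 ∧ Tendsto (fun i : ℕ =>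
      (gnp (nseq1 p i) p).real {G | HasLargeSpecialTuple ⌊(1 - η) * i⌋₊ G})
      atTop (nhds 0) := by
  have hL := logInv_pos hp
  obtain ⟨δ, hδ0, hδ⟩ := exists_gap_of_int hL
  have hηpos : 0 < min (1 / 2) (δ / (8 * logInv p)) := lt_min (by norm_num) (by positivity)
  refine ⟨min (1 / 2) (δ / (8 * logInv p)), hηpos, min_le_left _ _, ?_⟩
  set η := min (1 / 2) (δ / (8 * logInv p)) with hη
  have hηδ : 2 * η * logInv p ≤ δ / 4 := by
    have h1 : η * (8 * logInv p) ≤ δ :=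
      (le_div_iff₀ (by positivity)).1 (min_le_right _ _)
    linarith
  obtain ⟨M, hM⟩ := sum_choose_mul_le hp (c := δ / 4) (by positivity)
  have hlarge : ∀ᶠ i : ℕ in atTop, logInv p / 2 ≤ i * (δ / 4) :=
    ((tendsto_natCast_atTop_atTop (R := ℝ)).atTop_mul_const
      (by positivity)).eventually_ge_atTop _
  have hsmall : ∀ᶠ i : ℕ in atTop, exp (-(logInv p / 2 * i)) < δ / 24 :=
    (tendsto_exp_neg_mul_natCast (half_pos hL)).eventually_lt_const (by positivity)
  have hlim := ((tendsto_exp_neg_mul_natCast (c := δ / 4 / 2) (by positivity)).const_mul M).pow 3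
  rw [mul_zero, zero_pow three_ne_zero] at hlim
  refine squeeze_zero' (Eventually.of_forall fun i => measureReal_nonneg) ?_ hlim
  filter_upwards [hlarge, hsmall, eventually_ge_atTop 1] with i hi1 hi2 hi3
  refine (gnp_real_hasLargeSpecialTuple_le hp _ (fun k => exp (logInv p) *
    exp (-(logInv p * (i + 1 / 2) * k) - i - δ / 4 * (i * (1 + |(k : ℝ) - i|))))
    (fun k => by positivity) fun k l m hk hl hm hn => ?_).trans
      (pow_le_pow_left₀ (Finset.sum_nonneg fun k _ => by positivity) (hM i hi3) 3)
  exact specialTuple_term_le hp hδ hηpos.le (min_le_left _ _) hηδ (ε := δ / 24) (by positivity)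
    (by linarith) hi3 hi1 hi2.le hk hl hm hn fun _ => rfl

end Sequence

theorem stmt8 {p : ℝ} (hp : p ∈ Set.Ioo (0 : ℝ) 1) :
    Tendsto (fun i : ℕ =>
      ((gnp (nseq1 p i) p) {G : SimpleGraph (Fin (nseq1 p i)) |
        ∃ k l m : ℕ, 0 < k ∧ 0 < l ∧ 0 < m ∧ k + l + m ≤ nseq1 p i ∧
          0 < countX G k l m}).toReal)
      atTop (nhds 0) := by
  obtain ⟨η, hη, hη2, h3⟩ := exists_tendsto_gnp_hasLargeSpecialTuple hp
  have h := ((tendsto_gnp_hasEmptyPair hp).add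
    (tendsto_gnp_hasDominatedStar hp hη (by linarith))).add h3
  simp only [add_zero] at h
  refine squeeze_zero (fun i => ENNReal.toReal_nonneg) (fun i => ?_) h
  have := isProbabilityMeasure_gnp hp (nseq1 p i)
  change (gnp (nseq1 p i) p).real _ ≤ _
  refine (measureReal_mono (s₂ := ({G | HasEmptyPair (3 * i) G} ∪
    {G | HasDominatedStar ⌊(1 - η) * i⌋₊ (3 * i) G}) ∪
      {G | HasLargeSpecialTuple ⌊(1 - η) * i⌋₊ G}) ?_ (measure_ne_top _ _)).trans
    ((measureReal_union_le _ _).trans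
      (add_le_add (measureReal_union_le _ _) le_rfl))
  rintro G ⟨k, l, m, -, -, -, -, hG⟩
  obtain ⟨X₁, X₂, X₃, x₁, x₂, x₃, ht⟩ := exists_specialTuple_of_countX_pos hG
  exact ht.trichotomy _ _
end

section
/- Fix p ∈ (0,1) and for each k ∈ ℕ set n = n_k = ⌊(1/(1−p))^k · k⌋. Then the expectation of X(k,k,k) under G(n_k, p) satisfies E X(k,k,k) = (p/(1−p))³ · k^{3/2} / (2π)^{3/2} · (1 + o(1)) as k → ∞; in particular E X(k,k,k) → ∞. -/
open MeasureTheory Filter Real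

/-- The sequence `n_k = ⌊(1/(1-p))^k · k⌋`. -/
noncomputable def nseq2 (p : ℝ) (k : ℕ) : ℕ :=
  Nat.floor ((1 / (1 - p)) ^ k * (k : ℝ))

open Finset in
theorem sum_weight_subset_disjoint {α : Type*} [DecidableEq α] {E A B : Finset α}
    (hA : A ⊆ E) (hB : B ⊆ E) (hAB : Disjoint A B) (p : ℝ) :
    ∑ S ∈ E.powerset with (A ⊆ S ∧ Disjoint B S), p ^ #S * (1 - p) ^ (#E - #S) =
      p ^ #A * (1 - p) ^ #B := by
  have h := prod_add (fun e => if e ∈ B then 0 else p) (fun e => if e ∈ A then 0 else 1 - p) E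
  have hprod : ∏ e ∈ E, ((if e ∈ B then 0 else p) + (if e ∈ A then 0 else 1 - p)) =
      p ^ #A * (1 - p) ^ #B := by
    calc _ = ∏ e ∈ E, ((if e ∈ A then p else 1) * (if e ∈ B then 1 - p else 1)) := by
          refine prod_congr rfl fun e _ => ?_
          have : e ∈ A → e ∉ B := fun h => Finset.disjoint_left.1 hAB h
          by_cases h1 : e ∈ A <;> by_cases h2 : e ∈ B <;> simp_all
      _ = _ := by
          rw [prod_mul_distrib, prod_ite_mem, prod_ite_mem, inter_eq_right.2 hA,
            inter_eq_right.2 hB, prod_const, prod_const]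
  rw [← hprod, h, sum_filter]
  refine sum_congr rfl fun S hS => ?_
  have hSE := mem_powerset.1 hS
  split_ifs with hc
  · rw [← card_sdiff_of_subset hSE, ← prod_const, ← prod_const]
    congr 1
    · exact prod_congr rfl fun e he => (if_neg fun h' => Finset.disjoint_left.1 hc.2 h' he).symm
    · exact prod_congr rfl fun e he => (if_neg fun h' => (mem_sdiff.1 he).2 (hc.1 h')).symm
  · symm
    rw [not_and_or] at hc
    rcases hc with hc | hc
    · obtain ⟨e, he, heS⟩ := not_subset.1 hc
      refine mul_eq_zero_of_right _ ?_
      exact prod_eq_zero (mem_sdiff.2 ⟨hA he, heS⟩) (if_pos he)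
    · obtain ⟨e, he, heS⟩ := Finset.not_disjoint_iff.1 hc
      refine mul_eq_zero_of_left ?_ _
      exact prod_eq_zero heS (if_pos he)

open Finset in
theorem sum_weight_subset_disjoint_hitting {α ι : Type*} [DecidableEq α] [DecidableEq ι]
    {E A : Finset α} (hA : A ⊆ E) (p : ℝ) (C : ι → Finset α) (J : Finset ι)
    (hCE : ∀ j ∈ J, C j ⊆ E) (hAC : ∀ j ∈ J, Disjoint A (C j))
    (hC : (J : Set ι).PairwiseDisjoint C) {B : Finset α}
    (hB : B ⊆ E) (hAB : Disjoint A B) (hBC : ∀ j ∈ J, Disjoint B (C j)) :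
    ∑ S ∈ E.powerset with (A ⊆ S ∧ Disjoint B S ∧ ∀ j ∈ J, ¬ Disjoint (C j) S),
      p ^ #S * (1 - p) ^ (#E - #S) =
      p ^ #A * (1 - p) ^ #B * ∏ j ∈ J, (1 - (1 - p) ^ #(C j)) := by
  induction J using Finset.induction_on generalizing B with
  | empty => simpa using sum_weight_subset_disjoint hA hB hAB p
  | insert i J hi ih =>
    simp only [forall_mem_insert] at hCE hAC hBC
    rw [coe_insert, Set.pairwiseDisjoint_insert] at hC
    have h1 := ih hCE.2 hAC.2 hC.1 hB hAB hBC.2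
    have h2 := ih hCE.2 hAC.2 hC.1 (union_subset hB hCE.1)
      (Finset.disjoint_union_right.2 ⟨hAB, hAC.1⟩) fun j hj => Finset.disjoint_union_left.2
        ⟨hBC.2 j hj, hC.2 j hj (by rintro rfl; exact hi hj)⟩
    rw [card_union_of_disjoint hBC.1, pow_add] at h2
    rw [prod_insert hi]
    have h3 : p ^ #A * (1 - p) ^ #B * ((1 - (1 - p) ^ #(C i)) * ∏ j ∈ J, (1 - (1 - p) ^ #(C j))) =
        p ^ #A * (1 - p) ^ #B * ∏ j ∈ J, (1 - (1 - p) ^ #(C j)) -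
        p ^ #A * ((1 - p) ^ #B * (1 - p) ^ #(C i)) * ∏ j ∈ J, (1 - (1 - p) ^ #(C j)) := by ring
    rw [h3, ← h1, ← h2, eq_sub_iff_add_eq, sum_filter, sum_filter, sum_filter, ← sum_add_distrib]
    refine sum_congr rfl fun S _ => ?_
    simp only [forall_mem_insert, Finset.disjoint_union_left]
    by_cases hd : Disjoint (C i) S <;> simp [hd]

open Finset in
theorem expX_eq_sum (n : ℕ) {p : ℝ} (h0 : 0 ≤ p) (h1 : p ≤ 1) (k l m : ℕ) :
    expX n p k l m = ∑ G : SimpleGraph (Fin n), p ^ Nat.card G.edgeSet *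
      (1 - p) ^ (n * (n - 1) / 2 - Nat.card G.edgeSet) * (countX G k l m : ℝ) := by
  have : MeasurableSingletonClass (SimpleGraph (Fin n)) := ⟨fun _ => trivial⟩
  rw [expX, gnp, Measure.sum_fintype, integral_finsetSum_measure]
  · refine sum_congr rfl fun G _ => ?_
    rw [integral_smul_measure, integral_dirac, ENNReal.toReal_ofReal, smul_eq_mul]
    have : 0 ≤ 1 - p := by linarith
    positivity
  · intro G _
    exact (integrable_dirac (by simp)).smul_measure ENNReal.ofReal_ne_top

open Finset in
theorem sum_graph_weight_eq (n : ℕ) (p : ℝ) {P : SimpleGraph (Fin n) → Prop} [DecidablePred P]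
    {Q : Finset (Sym2 (Fin n)) → Prop} {_ : DecidablePred Q}
    (hPQ : ∀ (G : SimpleGraph (Fin n)) [Fintype G.edgeSet], P G ↔ Q G.edgeFinset) :
    ∑ G : SimpleGraph (Fin n), (if P G then p ^ Nat.card G.edgeSet *
      (1 - p) ^ (n * (n - 1) / 2 - Nat.card G.edgeSet) else 0) =
    ∑ S ∈ (⊤ : SimpleGraph (Fin n)).edgeFinset.powerset with Q S,
      p ^ #S * (1 - p) ^ (#(⊤ : SimpleGraph (Fin n)).edgeFinset - #S) := by
  classical
  rw [sum_filter]
  refine sum_bij' (fun G _ => G.edgeFinset)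
    (fun S _ => SimpleGraph.fromEdgeSet (S : Set (Sym2 (Fin n)))) ?_ ?_ ?_ ?_ ?_
  · intro G _
    exact mem_powerset.2 (SimpleGraph.edgeFinset_mono le_top)
  · simp
  · intro G _
    simp
  · intro S hS
    have hS := mem_powerset.1 hS
    ext e
    have := @hS e
    simp only [SimpleGraph.mem_edgeFinset, SimpleGraph.edgeSet_fromEdgeSet] at *
    simp only [Set.mem_sdiff, mem_coe]
    constructor
    · exact fun h => h.1
    · exact fun h => ⟨h, SimpleGraph.not_isDiag_of_mem_edgeSet _ (this h)⟩
  · intro G _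
    have hE : #(⊤ : SimpleGraph (Fin n)).edgeFinset = n * (n - 1) / 2 := by
      rw [SimpleGraph.card_edgeFinset_top_eq_card_choose_two, Fintype.card_fin,
        Nat.choose_two_right]
    rw [hE, Nat.card_eq_fintype_card, SimpleGraph.edgeFinset_card]
    exact if_congr (hPQ G) rfl rfl

open Finset in
theorem Sym2.mk_injOn_union_product {α : Type*} [DecidableEq α] {X₁ X₂ X₃ : Finset α}
    (h12 : Disjoint X₁ X₂) (h13 : Disjoint X₁ X₃) (h23 : Disjoint X₂ X₃) :
    Set.InjOn (fun e : α × α => s(e.1, e.2))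
      (X₁ ×ˢ X₂ ∪ X₁ ×ˢ X₃ ∪ X₂ ×ˢ X₃ : Finset (α × α)) := by
  rintro ⟨a, b⟩ hab ⟨c, d⟩ hcd h
  rw [Finset.disjoint_left] at h12 h13 h23
  simp only [coe_union, coe_product, Set.mem_union, Set.mem_prod, mem_coe] at hab hcd
  simp only [Sym2.eq_iff] at h
  rcases h with ⟨rfl, rfl⟩ | ⟨rfl, rfl⟩
  · rfl
  · grind

open Finset in
theorem specialTuple_iff_edgeFinset {n : ℕ} {X₁ X₂ X₃ : Finset (Fin n)} {x₁ x₂ x₃ : Fin n}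
    (h12 : Disjoint X₁ X₂) (h13 : Disjoint X₁ X₃) (h23 : Disjoint X₂ X₃)
    (h1 : x₁ ∈ X₁) (h2 : x₂ ∈ X₂) (h3 : x₃ ∈ X₃)
    (G : SimpleGraph (Fin n)) [Fintype G.edgeSet] :
    SpecialTuple G X₁ X₂ X₃ x₁ x₂ x₃ ↔
      ({(x₁, x₂), (x₁, x₃), (x₂, x₃)} : Finset (Fin n × Fin n)).image
        (fun e => s(e.1, e.2)) ⊆ G.edgeFinset ∧
      Disjoint (((X₁ ×ˢ X₂ ∪ X₁ ×ˢ X₃ ∪ X₂ ×ˢ X₃) \ {(x₁, x₂), (x₁, x₃), (x₂, x₃)}).image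
        (fun e => s(e.1, e.2))) G.edgeFinset ∧
      ∀ j ∈ (X₁ ∪ X₂ ∪ X₃)ᶜ ×ˢ (univ : Finset (Fin 3)),
        ¬ Disjoint ((![X₁, X₂, X₃] j.2).image fun u => s(j.1, u)) G.edgeFinset := by
  have hN : (∀ j ∈ (X₁ ∪ X₂ ∪ X₃)ᶜ ×ˢ (univ : Finset (Fin 3)),
        ¬ Disjoint ((![X₁, X₂, X₃] j.2).image fun u => s(j.1, u)) G.edgeFinset) ↔
      ∀ v : Fin n, v ∉ X₁ → v ∉ X₂ → v ∉ X₃ →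
        (∃ u ∈ X₁, G.Adj v u) ∧ (∃ u ∈ X₂, G.Adj v u) ∧ (∃ u ∈ X₃, G.Adj v u) := by
    simp only [Prod.forall, mem_product, mem_univ, and_true, mem_compl, mem_union, not_or,
      Finset.not_disjoint_iff, mem_image, SimpleGraph.mem_edgeFinset, exists_exists_and_eq_and,
      SimpleGraph.mem_edgeSet, Fin.forall_fin_succ, Fin.forall_fin_zero, and_imp]
    simp
    grind
  rw [hN, SpecialTuple, and_iff_right h12, and_iff_right h13, and_iff_right h23, and_iff_right h1,
    and_iff_right h2, and_iff_right h3, and_comm, ← and_assoc (b := Disjoint _ _)]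
  refine and_congr_left fun _ => ?_
  have hA : ({(x₁, x₂), (x₁, x₃), (x₂, x₃)} : Finset (Fin n × Fin n)).image
        (fun e => s(e.1, e.2)) ⊆ G.edgeFinset ↔ G.Adj x₁ x₂ ∧ G.Adj x₁ x₃ ∧ G.Adj x₂ x₃ := by
    simp [Finset.insert_subset_iff]
  have hB : Disjoint (((X₁ ×ˢ X₂ ∪ X₁ ×ˢ X₃ ∪ X₂ ×ˢ X₃) \
        {(x₁, x₂), (x₁, x₃), (x₂, x₃)}).image (fun e => s(e.1, e.2))) G.edgeFinset ↔
      ∀ u v, ((u ∈ X₁ ∧ v ∈ X₂) ∨ (u ∈ X₁ ∧ v ∈ X₃)) ∨ (u ∈ X₂ ∧ v ∈ X₃) →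
        ¬ ((u = x₁ ∧ v = x₂) ∨ (u = x₁ ∧ v = x₃) ∨ (u = x₂ ∧ v = x₃)) → ¬ G.Adj u v := by
    simp only [Finset.disjoint_left, forall_mem_image, Prod.forall, Finset.mem_sdiff, mem_union,
      mem_product, mem_insert, mem_singleton, Prod.mk.injEq, SimpleGraph.mem_edgeFinset,
      SimpleGraph.mem_edgeSet, and_imp]
  rw [hA, hB]
  rw [Finset.disjoint_left] at h12 h13 h23
  grind

open Finset in
theorem sum_weight_specialTuple {n : ℕ} (p : ℝ) {X₁ X₂ X₃ : Finset (Fin n)} {x₁ x₂ x₃ : Fin n}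
    [DecidablePred fun G : SimpleGraph (Fin n) => SpecialTuple G X₁ X₂ X₃ x₁ x₂ x₃]
    (h12 : Disjoint X₁ X₂) (h13 : Disjoint X₁ X₃) (h23 : Disjoint X₂ X₃)
    (h1 : x₁ ∈ X₁) (h2 : x₂ ∈ X₂) (h3 : x₃ ∈ X₃) :
    ∑ G : SimpleGraph (Fin n), (if SpecialTuple G X₁ X₂ X₃ x₁ x₂ x₃ then
      p ^ Nat.card G.edgeSet * (1 - p) ^ (n * (n - 1) / 2 - Nat.card G.edgeSet) else 0) =
    p ^ 3 * (1 - p) ^ (#X₁ * #X₂ + #X₁ * #X₃ + #X₂ * #X₃ - 3) *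
      ((1 - (1 - p) ^ #X₁) * (1 - (1 - p) ^ #X₂) * (1 - (1 - p) ^ #X₃)) ^
        (n - (#X₁ + #X₂ + #X₃)) := by
  have d12 := Finset.disjoint_left.1 h12
  have d13 := Finset.disjoint_left.1 h13
  have d23 := Finset.disjoint_left.1 h23
  set T := X₁ ×ˢ X₂ ∪ X₁ ×ˢ X₃ ∪ X₂ ×ˢ X₃ with hT
  set A : Finset (Fin n × Fin n) := {(x₁, x₂), (x₁, x₃), (x₂, x₃)} with hA
  set C : Fin n × Fin 3 → Finset (Sym2 (Fin n)) :=
    fun j => (![X₁, X₂, X₃] j.2).image fun u => s(j.1, u) with hC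
  have hinj : Set.InjOn (fun e : Fin n × Fin n => s(e.1, e.2)) T :=
    Sym2.mk_injOn_union_product h12 h13 h23
  have hAT : A ⊆ T := by
    simp [hA, hT, insert_subset_iff, h1, h2, h3]
  have hTcard : #T = #X₁ * #X₂ + #X₁ * #X₃ + #X₂ * #X₃ := by
    rw [hT, card_union_of_disjoint, card_union_of_disjoint, card_product, card_product,
      card_product]
    · exact disjoint_product.2 (Or.inr h23)
    · exact Finset.disjoint_union_left.2
        ⟨disjoint_product.2 (Or.inl h12), disjoint_product.2 (Or.inl h12)⟩
  have hAcard : #A = 3 := by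
    rw [hA, card_eq_three]
    refine ⟨_, _, _, ?_, ?_, ?_, rfl⟩ <;> simp <;> grind
  have hTE : T.image (fun e => s(e.1, e.2)) ⊆ (⊤ : SimpleGraph (Fin n)).edgeFinset := by
    simp only [image_subset_iff, Prod.forall, hT, mem_union, mem_product,
      SimpleGraph.mem_edgeFinset, SimpleGraph.mem_edgeSet, SimpleGraph.top_adj]
    grind
  have hX : ∀ i, ![X₁, X₂, X₃] i ⊆ X₁ ∪ X₂ ∪ X₃ := by
    simp [Fin.forall_fin_succ, subset_iff]
    grind
  have hTX : ∀ e ∈ T, e.1 ∈ X₁ ∪ X₂ ∪ X₃ ∧ e.2 ∈ X₁ ∪ X₂ ∪ X₃ := by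
    simp only [hT, mem_union, mem_product]
    grind
  have hTC : ∀ j ∈ (X₁ ∪ X₂ ∪ X₃)ᶜ ×ˢ (univ : Finset (Fin 3)),
      Disjoint (T.image fun e => s(e.1, e.2)) (C j) := by
    rintro ⟨v, i⟩ hj
    have hv : v ∉ X₁ ∪ X₂ ∪ X₃ := by simpa using hj
    rw [Finset.disjoint_left]
    intro x hx hx'
    obtain ⟨e, he, rfl⟩ := mem_image.1 hx
    obtain ⟨u, -, h⟩ := mem_image.1 hx'
    have := hTX e he
    grind [Sym2.eq_iff]
  have hsd : (T \ A).image (fun e => s(e.1, e.2)) ⊆ T.image fun e => s(e.1, e.2) :=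
    image_subset_image sdiff_subset
  have key := sum_weight_subset_disjoint_hitting ((image_subset_image hAT).trans hTE) p C
    ((X₁ ∪ X₂ ∪ X₃)ᶜ ×ˢ (univ : Finset (Fin 3)))
    (B := (T \ A).image (fun e => s(e.1, e.2))) ?_
    (fun j hj => (hTC j hj).mono_left (image_subset_image hAT)) ?_ (hsd.trans hTE) ?_
    (fun j hj => (hTC j hj).mono_left hsd)
  · refine (sum_graph_weight_eq n p fun G _ =>
      specialTuple_iff_edgeFinset h12 h13 h23 h1 h2 h3 G).trans (key.trans ?_)
    rw [card_image_of_injOn (hinj.mono (coe_subset.2 hAT)),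
      card_image_of_injOn (hinj.mono (coe_subset.2 sdiff_subset)), card_sdiff_of_subset hAT,
      hAcard, hTcard, prod_product]
    have hCcard : ∀ v i, #(C (v, i)) = #(![X₁, X₂, X₃] i) := fun v i =>
      card_image_of_injective _ fun a b h => Sym2.congr_right.1 h
    simp only [hCcard, Fin.prod_univ_three, prod_const]
    rw [card_compl, Fintype.card_fin, card_union_of_disjoint, card_union_of_disjoint h12]
    · rfl
    · exact Finset.disjoint_union_left.2 ⟨h13, h23⟩
  · rintro ⟨v, i⟩ hj
    have hv : v ∉ X₁ ∪ X₂ ∪ X₃ := by simpa using hj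
    simp only [hC, image_subset_iff, SimpleGraph.mem_edgeFinset, SimpleGraph.mem_edgeSet,
      SimpleGraph.top_adj]
    rintro u hu rfl
    exact hv (hX i hu)
  · rintro ⟨v, i⟩ hj ⟨w, j⟩ - hne
    have hv : v ∉ X₁ ∪ X₂ ∪ X₃ := by simpa using hj
    have hij : i ≠ j → Disjoint (![X₁, X₂, X₃] i) (![X₁, X₂, X₃] j) := by
      fin_cases i <;> fin_cases j <;> simp [h12, h13, h23, h12.symm, h13.symm, h23.symm]
    rw [Function.onFun, Finset.disjoint_left]
    intro x hx hx'
    obtain ⟨u, hu, rfl⟩ := mem_image.1 hx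
    obtain ⟨u', hu', h⟩ := mem_image.1 hx'
    rcases Sym2.eq_iff.1 h with ⟨rfl, rfl⟩ | ⟨rfl, rfl⟩
    · exact Finset.disjoint_left.1 (hij fun h => hne (by rw [h])) hu hu'
    · exact hv (hX j hu')
  · rw [Finset.disjoint_left]
    intro e he he'
    obtain ⟨a, ha, rfl⟩ := mem_image.1 he
    obtain ⟨b, hb, hab⟩ := mem_image.1 he'
    obtain ⟨hbT, hbA⟩ := mem_sdiff.1 hb
    exact hbA (hinj hbT (hAT ha) hab ▸ ha)

open Finset in
theorem expX_eq (n : ℕ) {p : ℝ} (h0 : 0 ≤ p) (h1 : p ≤ 1) (k l m : ℕ) :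
    expX n p k l m = n.choose k * (n - k).choose l * (n - k - l).choose m * (k * l * m) *
      (p ^ 3 * (1 - p) ^ (k * l + k * m + l * m - 3) *
        ((1 - (1 - p) ^ k) * (1 - (1 - p) ^ l) * (1 - (1 - p) ^ m)) ^ (n - (k + l + m))) := by
  classical
  set c := p ^ 3 * (1 - p) ^ (k * l + k * m + l * m - 3) *
    ((1 - (1 - p) ^ k) * (1 - (1 - p) ^ l) * (1 - (1 - p) ^ m)) ^ (n - (k + l + m)) with hc
  have hcount : ∀ G : SimpleGraph (Fin n), (countX G k l m : ℝ) =
      ∑ X₁ ∈ powersetCard k univ, ∑ X₂ ∈ powersetCard l X₁ᶜ, ∑ X₃ ∈ powersetCard m (X₁ᶜ \ X₂),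
        ∑ x₁ ∈ X₁, ∑ x₂ ∈ X₂, ∑ x₃ ∈ X₃,
          if SpecialTuple G X₁ X₂ X₃ x₁ x₂ x₃ then (1 : ℝ) else 0 := by
    intro G
    rw [countX, Nat.card_eq_fintype_card, Fintype.card_subtype, card_filter]
    push_cast
    simp only [Fintype.sum_prod_type]
    rw [← sum_subset (subset_univ (powersetCard k univ))]
    · refine sum_congr rfl fun X₁ hX₁ => ?_
      rw [mem_powersetCard] at hX₁
      rw [← sum_subset (subset_univ (powersetCard l X₁ᶜ))]
      · refine sum_congr rfl fun X₂ hX₂ => ?_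
        rw [mem_powersetCard] at hX₂
        rw [← sum_subset (subset_univ (powersetCard m (X₁ᶜ \ X₂)))]
        · refine sum_congr rfl fun X₃ hX₃ => ?_
          rw [mem_powersetCard] at hX₃
          simp only [hX₁.2, hX₂.2, hX₃.2, true_and]
          rw [← sum_subset (subset_univ X₁)]
          · refine sum_congr rfl fun x₁ _ => ?_
            rw [← sum_subset (subset_univ X₂)]
            · refine sum_congr rfl fun x₂ _ => ?_
              rw [← sum_subset (subset_univ X₃)]
              exact fun x₃ _ h => if_neg fun h' => h h'.2.2.2.2.2.1
            · exact fun x₂ _ h => sum_eq_zero fun _ _ => if_neg fun h' => h h'.2.2.2.2.1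
          · exact fun x₁ _ h => sum_eq_zero fun _ _ => sum_eq_zero fun _ _ =>
              if_neg fun h' => h h'.2.2.2.1
        · refine fun X₃ _ h => sum_eq_zero fun _ _ => sum_eq_zero fun _ _ => sum_eq_zero fun _ _ =>
            if_neg fun ⟨_, _, h3, _, h13, h23, _⟩ => h (mem_powersetCard.2 ⟨?_, h3⟩)
          exact subset_sdiff.2 ⟨subset_compl_iff_disjoint_left.2 h13, h23.symm⟩
      · exact fun X₂ _ h => sum_eq_zero fun _ _ => sum_eq_zero fun _ _ => sum_eq_zero fun _ _ =>
          sum_eq_zero fun _ _ => if_neg fun ⟨_, h2, _, h12, _⟩ =>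
            h (mem_powersetCard.2 ⟨subset_compl_iff_disjoint_left.2 h12, h2⟩)
    · exact fun X₁ _ h => sum_eq_zero fun _ _ => sum_eq_zero fun _ _ => sum_eq_zero fun _ _ =>
          sum_eq_zero fun _ _ => sum_eq_zero fun _ _ => if_neg fun ⟨h1, _⟩ =>
            h (mem_powersetCard.2 ⟨subset_univ _, h1⟩)
  have hprob : ∀ X₁ ∈ powersetCard k (univ : Finset (Fin n)), ∀ X₂ ∈ powersetCard l X₁ᶜ,
      ∀ X₃ ∈ powersetCard m (X₁ᶜ \ X₂), ∀ x₁ ∈ X₁, ∀ x₂ ∈ X₂, ∀ x₃ ∈ X₃,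
      ∑ G : SimpleGraph (Fin n), p ^ Nat.card G.edgeSet *
        (1 - p) ^ (n * (n - 1) / 2 - Nat.card G.edgeSet) *
        (if SpecialTuple G X₁ X₂ X₃ x₁ x₂ x₃ then (1 : ℝ) else 0) = c := by
    intro X₁ hX₁ X₂ hX₂ X₃ hX₃ x₁ hx₁ x₂ hx₂ x₃ hx₃
    rw [mem_powersetCard] at hX₁ hX₂ hX₃
    obtain ⟨h13, h23⟩ := subset_sdiff.1 hX₃.1
    simp only [mul_ite, mul_one, mul_zero]
    rw [sum_weight_specialTuple p (subset_compl_iff_disjoint_left.1 hX₂.1)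
      (subset_compl_iff_disjoint_left.1 h13) h23.symm hx₁ hx₂ hx₃, hX₁.2, hX₂.2, hX₃.2]
  rw [expX_eq_sum n h0 h1]
  simp only [hcount, mul_sum]
  rw [sum_comm]
  have hX₁sum : ∀ X₁ ∈ powersetCard k (univ : Finset (Fin n)),
      ∑ G : SimpleGraph (Fin n), ∑ X₂ ∈ powersetCard l X₁ᶜ, ∑ X₃ ∈ powersetCard m (X₁ᶜ \ X₂),
        ∑ x₁ ∈ X₁, ∑ x₂ ∈ X₂, ∑ x₃ ∈ X₃, p ^ Nat.card G.edgeSet *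
        (1 - p) ^ (n * (n - 1) / 2 - Nat.card G.edgeSet) *
        (if SpecialTuple G X₁ X₂ X₃ x₁ x₂ x₃ then (1 : ℝ) else 0) =
      (n - k).choose l * (n - k - l).choose m * (k * l * m) * c := by
    intro X₁ hX₁
    have hX₁' := mem_powersetCard.1 hX₁
    have hc1 : #X₁ᶜ = n - k := by rw [card_compl, Fintype.card_fin, hX₁'.2]
    rw [sum_comm]
    trans ∑ X₂ ∈ powersetCard l X₁ᶜ, ((n - k - l).choose m * (k * l * m) * c : ℝ)
    · refine sum_congr rfl fun X₂ hX₂ => ?_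
      have hX₂' := mem_powersetCard.1 hX₂
      have hc2 : #(X₁ᶜ \ X₂) = n - k - l := by
        rw [card_sdiff_of_subset hX₂'.1, hc1, hX₂'.2]
      rw [sum_comm]
      trans ∑ X₃ ∈ powersetCard m (X₁ᶜ \ X₂), ((k * l * m) * c : ℝ)
      · refine sum_congr rfl fun X₃ hX₃ => ?_
        have hX₃' := mem_powersetCard.1 hX₃
        rw [sum_comm]
        trans ∑ x₁ ∈ X₁, ∑ x₂ ∈ X₂, ∑ x₃ ∈ X₃, c
        · refine sum_congr rfl fun x₁ hx₁ => ?_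
          rw [sum_comm]
          refine sum_congr rfl fun x₂ hx₂ => ?_
          rw [sum_comm]
          exact sum_congr rfl fun x₃ hx₃ => hprob X₁ hX₁ X₂ hX₂ X₃ hX₃ x₁ hx₁ x₂ hx₂ x₃ hx₃
        · simp only [sum_const, nsmul_eq_mul, hX₁'.2, hX₂'.2, hX₃'.2]
          ring
      · rw [sum_const, card_powersetCard, hc2, nsmul_eq_mul]
        ring
    · rw [sum_const, card_powersetCard, hc1, nsmul_eq_mul]
      ring
  rw [sum_congr rfl hX₁sum, sum_const, card_powersetCard, card_univ, Fintype.card_fin, nsmul_eq_mul]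
  ring

theorem tendsto_descFactorial_nseq2_div_pow {p : ℝ} (hp : p ∈ Set.Ioo (0 : ℝ) 1) (j : ℕ) :
    Tendsto (fun k : ℕ => ((nseq2 p k - j * k).descFactorial k : ℝ) /
      ((1 / (1 - p)) ^ k * (k : ℝ)) ^ k) atTop (nhds 1) := by
  obtain ⟨h0, h1⟩ := hp
  have hq : 0 < 1 - p := by linarith
  have hlim : Tendsto (fun k : ℕ => 1 + (k : ℝ) * (-((j + 1 : ℝ) * (1 - p) ^ k)))
      atTop (nhds 1) := by
    have := ((tendsto_self_mul_const_pow_of_lt_one hq.le (by linarith)).const_mul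
      (-(j + 1 : ℝ))).const_add 1
    simp only [mul_zero, add_zero] at this
    exact this.congr fun k => by ring
  have hx : Tendsto (fun k : ℕ => (j + 1 : ℝ) * (1 - p) ^ k) atTop (nhds 0) := by
    simpa using (tendsto_pow_atTop_nhds_zero_of_lt_one hq.le (by linarith)).const_mul (j + 1 : ℝ)
  refine tendsto_of_tendsto_of_tendsto_of_le_of_le' hlim tendsto_const_nhds ?_ ?_
  · filter_upwards [eventually_ge_atTop 1, hx.eventually_lt_const one_pos] with k hk hxk
    have hkpos : (0 : ℝ) < k := by exact_mod_cast hk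
    set N := (1 / (1 - p)) ^ k * (k : ℝ) with hN
    have hNpos : 0 < N := by positivity
    have hNk : N * (1 - p) ^ k = k := by
      rw [hN, one_div, inv_pow]
      field_simp
    have hfloor : N < nseq2 p k + 1 := Nat.lt_floor_add_one N
    rw [le_div_iff₀ (by positivity)]
    have hbase : N * (1 + -((j + 1 : ℝ) * (1 - p) ^ k)) ≤
        ((nseq2 p k - j * k + 1 - k : ℕ) : ℝ) := by
      have : nseq2 p k + 1 ≤ (nseq2 p k - j * k + 1 - k) + (j + 1) * k := by
        rw [add_one_mul]
        omega
      have : (nseq2 p k + 1 : ℝ) ≤ (nseq2 p k - j * k + 1 - k : ℕ) + (j + 1) * k := by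
        exact_mod_cast this
      nlinarith
    calc (1 + (k : ℝ) * (-((j + 1 : ℝ) * (1 - p) ^ k))) * N ^ k
        ≤ (1 + -((j + 1 : ℝ) * (1 - p) ^ k)) ^ k * N ^ k := by
          gcongr
          exact one_add_mul_le_pow (by linarith) k
      _ = (N * (1 + -((j + 1 : ℝ) * (1 - p) ^ k))) ^ k := by
          rw [mul_pow N, mul_comm]
      _ ≤ ((nseq2 p k - j * k + 1 - k : ℕ) : ℝ) ^ k :=
          pow_le_pow_left₀ (mul_nonneg hNpos.le (by linarith)) hbase k
      _ ≤ _ := by exact_mod_cast Nat.pow_sub_le_descFactorial _ k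
  · refine Eventually.of_forall fun k => div_le_one_of_le₀ ?_ (by positivity)
    calc ((nseq2 p k - j * k).descFactorial k : ℝ) ≤ ((nseq2 p k - j * k : ℕ) : ℝ) ^ k := by
          exact_mod_cast Nat.descFactorial_le_pow _ k
      _ ≤ (nseq2 p k : ℝ) ^ k := by
          gcongr
          exact Nat.sub_le _ _
      _ ≤ _ := by
          gcongr
          exact Nat.floor_le (by positivity)

theorem tendsto_one_sub_pow_nseq2_mul_exp {p : ℝ} (hp : p ∈ Set.Ioo (0 : ℝ) 1) (c : ℕ) :
    Tendsto (fun k : ℕ => (1 - (1 - p) ^ k) ^ (nseq2 p k - c * k) * exp k) atTop (nhds 1) := by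
  obtain ⟨h0, h1⟩ := hp
  have hq : 0 < 1 - p := by linarith
  have hx := tendsto_pow_atTop_nhds_zero_of_lt_one hq.le (by linarith)
  have hkx := tendsto_self_mul_const_pow_of_lt_one hq.le (by linarith)
  have hlow : Tendsto (fun k : ℕ => exp (-((k : ℝ) * (1 - p) ^ k / (1 - (1 - p) ^ k))))
      atTop (nhds 1) := by
    have := ((hkx.div (hx.const_sub 1) (by norm_num)).neg).rexp
    simpa using this
  have hup : Tendsto (fun k : ℕ => exp ((1 - p) ^ k + c * ((k : ℝ) * (1 - p) ^ k)))
      atTop (nhds 1) := by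
    have := (hx.add (hkx.const_mul (c : ℝ))).rexp
    simpa using this
  refine tendsto_of_tendsto_of_tendsto_of_le_of_le' hlow hup ?_ ?_
  all_goals
    filter_upwards [eventually_ge_atTop 1] with k hk
    have hkpos : (0 : ℝ) < k := by exact_mod_cast hk
    set N := (1 / (1 - p)) ^ k * (k : ℝ) with hN
    have hNpos : 0 < N := by positivity
    have hNk : N * (1 - p) ^ k = k := by
      rw [hN, one_div, inv_pow]
      field_simp
    have hxpos : 0 < (1 - p) ^ k := by positivity
    have hx1 : (1 - p) ^ k < 1 := pow_lt_one₀ hq.le (by linarith) (by omega)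
    set x := (1 - p) ^ k
    have hx1' : 0 < 1 - x := by linarith
  · have hfloor : (nseq2 p k : ℝ) ≤ N := Nat.floor_le hNpos.le
    have hbase : exp (-(x / (1 - x))) ≤ 1 - x := by
      rw [exp_neg]
      refine inv_le_of_inv_le₀ hx1' ?_
      calc (1 - x)⁻¹ = x / (1 - x) + 1 := by field_simp; ring
        _ ≤ _ := add_one_le_exp _
    calc exp (-(k * x / (1 - x))) = exp (N * -(x / (1 - x))) * exp k := by
          rw [← exp_add]
          congr 1
          rw [← hNk]
          field_simp
          ring
      _ ≤ exp (nseq2 p k * -(x / (1 - x))) * exp k := by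
          have : 0 ≤ x / (1 - x) := by positivity
          gcongr ?_ * _
          exact exp_le_exp.2 (by nlinarith)
      _ = exp (-(x / (1 - x))) ^ nseq2 p k * exp k := by rw [exp_nat_mul]
      _ ≤ (1 - x) ^ nseq2 p k * exp k := by gcongr
      _ ≤ _ := by
          gcongr ?_ * _
          exact pow_le_pow_of_le_one hx1'.le (by linarith) (Nat.sub_le _ _)
  · have hfloor : N < nseq2 p k + 1 := Nat.lt_floor_add_one N
    have hsub : N - 1 - c * k ≤ (nseq2 p k - c * k : ℕ) := by
      have : nseq2 p k ≤ (nseq2 p k - c * k) + c * k := by omega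
      have : (nseq2 p k : ℝ) ≤ (nseq2 p k - c * k : ℕ) + c * k := by exact_mod_cast this
      linarith
    calc (1 - x) ^ (nseq2 p k - c * k) * exp k ≤ exp (-x) ^ (nseq2 p k - c * k) * exp k := by
          gcongr
          linarith [add_one_le_exp (-x)]
      _ = exp ((nseq2 p k - c * k : ℕ) * -x + k) := by rw [← exp_nat_mul, ← exp_add]
      _ ≤ _ := exp_le_exp.2 (by nlinarith)

theorem choose_mul_eq_sqrt_mul {p : ℝ} (hp : p ∈ Set.Ioo (0 : ℝ) 1) {k : ℕ} (hk : 1 ≤ k)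
    (a b : ℕ) :
    (a.choose k : ℝ) * k * (p * ((1 - p) ^ (k * k) / (1 - p))) * (1 - (1 - p) ^ k) ^ b =
      p / (1 - p) * √k / √(2 * π) *
      ((a.descFactorial k : ℝ) / ((1 / (1 - p)) ^ k * (k : ℝ)) ^ k *
        ((1 - (1 - p) ^ k) ^ b * exp k) * (√π / Stirling.stirlingSeq k)) := by
  obtain ⟨h0, h1⟩ := hp
  have hq : 0 < 1 - p := by linarith
  have hkpos : (0 : ℝ) < k := by exact_mod_cast hk
  have hfac : (0 : ℝ) < k.factorial := by exact_mod_cast k.factorial_pos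
  have hs : √(k : ℝ) * √k = k := mul_self_sqrt hkpos.le
  have hexp : exp 1 ^ k = exp k := by rw [← exp_nat_mul, mul_one]
  rw [Nat.descFactorial_eq_factorial_mul_choose, Stirling.stirlingSeq, sqrt_mul zero_le_two,
    sqrt_mul zero_le_two, one_div, inv_pow, mul_pow, inv_pow, ← pow_mul, div_pow, hexp]
  push_cast
  have : √(k : ℝ) ≠ 0 := by positivity
  field_simp
  rw [sq, hs]
  ring

theorem tendsto_expX_nseq2_div {p : ℝ} (hp : p ∈ Set.Ioo (0 : ℝ) 1) :
    Tendsto (fun k : ℕ => expX (nseq2 p k) p k k k /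
        ((p / (1 - p)) ^ 3 * (k : ℝ) ^ ((3 : ℝ) / 2) / (2 * π) ^ ((3 : ℝ) / 2)))
      atTop (nhds 1) := by
  have hq : 0 < 1 - p := by linarith [hp.2]
  have hp0 := hp.1
  have hW := tendsto_one_sub_pow_nseq2_mul_exp hp 3
  have hS : Tendsto (fun k => √π / Stirling.stirlingSeq k) atTop (nhds 1) := by
    have hπ : √π ≠ 0 := by positivity
    exact div_self hπ ▸
      (tendsto_const_nhds (x := √π)).div Stirling.tendsto_stirlingSeq_sqrt_pi hπ
  have hF := fun j => ((tendsto_descFactorial_nseq2_div_pow hp j).mul hW).mul hS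
  have hlim := ((hF 0).mul (hF 1)).mul (hF 2)
  simp only [mul_one] at hlim
  refine hlim.congr' ?_
  filter_upwards [eventually_ge_atTop 1] with k hk
  have hkpos : (0 : ℝ) < k := by exact_mod_cast hk
  have hrpow : ∀ x : ℝ, 0 ≤ x → x ^ ((3 : ℝ) / 2) = √x ^ 3 := fun x hx => by
    rw [sqrt_eq_rpow, ← rpow_natCast, ← rpow_mul hx]
    norm_num
  rw [hrpow _ hkpos.le, hrpow _ (by positivity), eq_div_iff (by positivity),
    expX_eq _ hp.1.le hp.2.le]
  have hpow : (1 - p) ^ (k * k + k * k + k * k - 3) = ((1 - p) ^ (k * k) / (1 - p)) ^ 3 := by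
    have : 3 ≤ k * k + k * k + k * k := by nlinarith
    rw [pow_sub₀ _ hq.ne' this, div_pow, ← pow_mul, div_eq_mul_inv]
    ring_nf
  have h0 := choose_mul_eq_sqrt_mul hp hk (nseq2 p k - 0 * k) (nseq2 p k - 3 * k)
  have h1 := choose_mul_eq_sqrt_mul hp hk (nseq2 p k - 1 * k) (nseq2 p k - 3 * k)
  have h2 := choose_mul_eq_sqrt_mul hp hk (nseq2 p k - 2 * k) (nseq2 p k - 3 * k)
  have e3 : k + k + k = 3 * k := by ring
  have e2 : nseq2 p k - k - k = nseq2 p k - 2 * k := by omega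
  rw [hpow, e3, e2]
  have h := congrArg₂ (· * ·) (congrArg₂ (· * ·) h0 h1) h2
  simp only [zero_mul, one_mul, Nat.sub_zero] at h ⊢
  refine Eq.trans ?_ (h.symm.trans ?_)
  · ring
  · rw [mul_pow _ _ (nseq2 p k - 3 * k), mul_pow _ _ (nseq2 p k - 3 * k)]
    ring

theorem stmt9 {p : ℝ} (hp : p ∈ Set.Ioo (0 : ℝ) 1) :
    Tendsto (fun k : ℕ => expX (nseq2 p k) p k k k /
        ((p / (1 - p)) ^ 3 * (k : ℝ) ^ ((3 : ℝ) / 2) / (2 * Real.pi) ^ ((3 : ℝ) / 2)))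
      atTop (nhds 1) ∧
    Tendsto (fun k : ℕ => expX (nseq2 p k) p k k k) atTop atTop := by
  have hlim := tendsto_expX_nseq2_div hp
  refine ⟨hlim, ?_⟩
  have hq : 0 < 1 - p := by linarith [hp.2]
  have hp0 := hp.1
  have hmain : Tendsto (fun k : ℕ => (p / (1 - p)) ^ 3 * (k : ℝ) ^ ((3 : ℝ) / 2) /
      (2 * Real.pi) ^ ((3 : ℝ) / 2)) atTop atTop :=
    (((tendsto_rpow_atTop (by norm_num)).comp tendsto_natCast_atTop_atTop).const_mul_atTop
      (by positivity)).atTop_div_const (by positivity)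
  refine (hlim.pos_mul_atTop one_pos hmain).congr' ?_
  filter_upwards [eventually_ge_atTop 1] with k hk
  have hkpos : (0 : ℝ) < k := by exact_mod_cast hk
  exact div_mul_cancel₀ _ (by positivity)
end

section
/- Let 𝒳 = (X₁,x₁,X₂,x₂,X₃,x₃) and 𝒴 = (Y₁,y₁,Y₂,y₂,Y₃,y₃) be two k-tuples on {1,…,n}, and set r = |(X₁∪X₂∪X₃) ∩ (Y₁∪Y₂∪Y₃)|. Then under G(n,p), the conditional probability P(N_𝒴 | N_𝒳) is at most (1−p)^{3k² − r²/3 − 3}. -/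
open MeasureTheory Filter Real

/-- `(X, x)` is a `k`-tuple: `X 0, X 1, X 2` are pairwise disjoint sets of size `k`
and `x i ∈ X i` for each `i`. -/
def IsKTuple {n : ℕ} (k : ℕ) (X : Fin 3 → Finset (Fin n)) (x : Fin 3 → Fin n) : Prop :=
  (∀ i, (X i).card = k) ∧ (∀ i j, i ≠ j → Disjoint (X i) (X j)) ∧ ∀ i, x i ∈ X i

/-- The event `N_𝒳`: there are no edges between distinct sets `X i` and `X j` except
possibly edges joining the distinguished vertices `x 0, x 1, x 2`. -/
def NoEdgesExcept {n : ℕ} (G : SimpleGraph (Fin n)) (X : Fin 3 → Finset (Fin n))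
    (x : Fin 3 → Fin n) : Prop :=
  ∀ i j, i ≠ j → ∀ u ∈ X i, ∀ v ∈ X j, G.Adj u v → (∃ a, u = x a) ∧ (∃ b, v = x b)

theorem measurableSet_simpleGraph {n : ℕ} (s : Set (SimpleGraph (Fin n))) : MeasurableSet s :=
  MeasurableSpace.measurableSet_top

/-- The probability that `G(n,p)` avoids a given set `S` of pairs of distinct vertices
is `(1 - p) ^ |S|`. -/
theorem gnp_setOf_disjoint_edgeSet {p : ℝ} (hp : p ∈ Set.Ioo (0 : ℝ) 1) {n : ℕ}
    (S : Finset (Sym2 (Fin n))) (hS : ∀ e ∈ S, ¬ e.IsDiag) :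
    gnp n p {G : SimpleGraph (Fin n) | Disjoint G.edgeSet (S : Set (Sym2 (Fin n)))} =
      ENNReal.ofReal ((1 - p) ^ S.card) := by
  classical
  obtain ⟨hp0, hp1⟩ := hp
  have hq : 0 ≤ 1 - p := by linarith
  set D : Finset (Sym2 (Fin n)) := Finset.univ.filter fun e => ¬ e.IsDiag with hD
  have hDcard : D.card = n * (n - 1) / 2 := by
    have h := Sym2.card_subtype_not_diag (α := Fin n)
    rw [Fintype.card_subtype, Fintype.card_fin, Nat.choose_two_right] at h
    exact h
  have hSD : S ⊆ D := fun e he => by simpa [hD] using hS e he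
  have hmem (G : SimpleGraph (Fin n)) (e : Sym2 (Fin n)) : e ∈ G.edgeFinset ↔ e ∈ G.edgeSet :=
    SimpleGraph.mem_edgeFinset
  have hsub : (D \ S).card + S.card = D.card := Finset.card_sdiff_add_card_eq_card hSD
  unfold gnp
  rw [Measure.sum_apply _ (measurableSet_simpleGraph _), tsum_fintype]
  simp only [Measure.smul_apply, smul_eq_mul, Measure.dirac_apply' _ (measurableSet_simpleGraph _),
    Set.indicator_apply, Set.mem_ofPred_eq, Pi.one_apply, mul_ite, mul_one, mul_zero]
  rw [← Finset.sum_filter, ← ENNReal.ofReal_sum_of_nonneg (fun G _ => by positivity)]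
  congr 1
  calc _ = ∑ E ∈ (D \ S).powerset,
        (1 - p) ^ S.card * (p ^ E.card * (1 - p) ^ ((D \ S).card - E.card)) := by
        refine Finset.sum_nbij' (fun G => G.edgeFinset)
          (fun E => SimpleGraph.fromEdgeSet (E : Set (Sym2 (Fin n)))) ?_ ?_ ?_ ?_ ?_
        · intro G hG
          simp only [Finset.mem_filter, Finset.mem_univ, true_and] at hG
          rw [Finset.mem_powerset]
          intro e he
          rw [hmem] at he
          simp only [hD, Finset.mem_sdiff, Finset.mem_filter, Finset.mem_univ, true_and]
          exact ⟨G.not_isDiag_of_mem_edgeSet he, fun h => Set.disjoint_left.1 hG he h⟩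
        · intro E hE
          rw [Finset.mem_powerset] at hE
          simp only [Finset.mem_filter, Finset.mem_univ, true_and, SimpleGraph.edgeSet_fromEdgeSet]
          exact Set.disjoint_left.2 fun e he h => (Finset.mem_sdiff.1 (hE he.1)).2 h
        · intro G _
          simp
        · intro E hE
          rw [Finset.mem_powerset] at hE
          ext e
          rw [hmem, SimpleGraph.edgeSet_fromEdgeSet]
          refine ⟨fun h => h.1, fun h => ⟨h, ?_⟩⟩
          have := (Finset.mem_sdiff.1 (hE h)).1
          simpa [hD] using this
        · intro G hG
          simp only [Finset.mem_filter, Finset.mem_univ, true_and] at hG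
          have hc : Nat.card G.edgeSet = G.edgeFinset.card := by
            rw [Nat.card_eq_fintype_card, SimpleGraph.edgeFinset_card]
          have hle : G.edgeFinset.card ≤ (D \ S).card := by
            refine Finset.card_le_card fun e he => ?_
            rw [hmem] at he
            simp only [hD, Finset.mem_sdiff, Finset.mem_filter, Finset.mem_univ, true_and]
            exact ⟨G.not_isDiag_of_mem_edgeSet he, fun h => Set.disjoint_left.1 hG he h⟩
          have hexp : n * (n - 1) / 2 - G.edgeFinset.card =
              S.card + ((D \ S).card - G.edgeFinset.card) := by omega
          rw [hc, hexp, pow_add]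
          ring
    _ = (1 - p) ^ S.card := by
        rw [← Finset.mul_sum, Finset.sum_pow_mul_eq_add_pow]
        simp

/-- The pairs of vertices with endpoints in two different sets among `A`, `B`, `C`. -/
def crossPairs {α : Type*} [DecidableEq α] (A B C : Finset α) : Finset (Sym2 α) :=
  (A ×ˢ B ∪ A ×ˢ C ∪ B ×ˢ C).image Sym2.mk.uncurry

theorem card_crossPairs_le {α : Type*} [DecidableEq α] (A B C : Finset α) :
    (crossPairs A B C).card ≤ A.card * B.card + A.card * C.card + B.card * C.card := by
  refine Finset.card_image_le.trans ((Finset.card_union_le _ _).trans ?_)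
  have := Finset.card_union_le (A ×ˢ B) (A ×ˢ C)
  simp only [Finset.card_product] at this ⊢
  omega

theorem card_crossPairs {α : Type*} [DecidableEq α] {A B C : Finset α}
    (hAB : Disjoint A B) (hAC : Disjoint A C) (hBC : Disjoint B C) :
    (crossPairs A B C).card = A.card * B.card + A.card * C.card + B.card * C.card := by
  rw [Finset.disjoint_left] at hAB hAC hBC
  unfold crossPairs
  rw [Finset.card_image_of_injOn, Finset.card_union_of_disjoint, Finset.card_union_of_disjoint]
  · simp only [Finset.card_product]
  · rw [Finset.disjoint_left]
    rintro ⟨u, v⟩ h h'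
    simp only [Finset.mem_product] at h h'
    grind
  · rw [Finset.disjoint_left]
    rintro ⟨u, v⟩ h h'
    simp only [Finset.mem_product, Finset.mem_union] at h h'
    grind
  · rintro ⟨u, v⟩ h ⟨u', v'⟩ h' he
    simp only [Finset.coe_union, Set.mem_union, Finset.mem_coe, Finset.mem_product] at h h'
    simp only [Function.uncurry, Sym2.eq_iff] at he
    rcases he with ⟨rfl, rfl⟩ | ⟨rfl, rfl⟩
    · rfl
    · grind

theorem mem_crossPairs_of_ne {α : Type*} [DecidableEq α] {A : Fin 3 → Finset α} {i j : Fin 3}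
    (hij : i ≠ j) {u v : α} (hu : u ∈ A i) (hv : v ∈ A j) :
    s(u, v) ∈ crossPairs (A 0) (A 1) (A 2) := by
  simp only [crossPairs, Finset.mem_image, Finset.mem_union, Finset.mem_product, Prod.exists,
    Function.uncurry]
  fin_cases i <;> fin_cases j <;> first
    | exact absurd rfl hij
    | (refine ⟨u, v, ?_, rfl⟩; simp_all; done)
    | (refine ⟨v, u, ?_, Sym2.eq_swap⟩; simp_all)

theorem exists_of_mem_crossPairs {α : Type*} [DecidableEq α] {A : Fin 3 → Finset α} {e : Sym2 α}
    (he : e ∈ crossPairs (A 0) (A 1) (A 2)) :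
    ∃ i j, i < j ∧ ∃ u ∈ A i, ∃ v ∈ A j, e = s(u, v) := by
  simp only [crossPairs, Finset.mem_image, Finset.mem_union, Finset.mem_product, Prod.exists,
    Function.uncurry] at he
  obtain ⟨u, v, (⟨hu, hv⟩ | ⟨hu, hv⟩) | ⟨hu, hv⟩, rfl⟩ := he
  · exact ⟨0, 1, by decide, u, hu, v, hv, rfl⟩
  · exact ⟨0, 2, by decide, u, hu, v, hv, rfl⟩
  · exact ⟨1, 2, by decide, u, hu, v, hv, rfl⟩

open Classical in
/-- The pairs of vertices that the event `N_𝒳` forbids as edges. -/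
noncomputable def forbiddenPairs {n : ℕ} (X : Fin 3 → Finset (Fin n)) (x : Fin 3 → Fin n) :
    Finset (Sym2 (Fin n)) :=
  Finset.univ.filter fun e => ∃ i j, i ≠ j ∧ ∃ u ∈ X i, ∃ v ∈ X j,
    e = s(u, v) ∧ ¬ ((∃ a, u = x a) ∧ ∃ b, v = x b)

theorem mem_forbiddenPairs {n : ℕ} {X : Fin 3 → Finset (Fin n)} {x : Fin 3 → Fin n}
    {e : Sym2 (Fin n)} :
    e ∈ forbiddenPairs X x ↔ ∃ i j, i ≠ j ∧ ∃ u ∈ X i, ∃ v ∈ X j,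
      e = s(u, v) ∧ ¬ ((∃ a, u = x a) ∧ ∃ b, v = x b) := by
  simp [forbiddenPairs]

theorem noEdgesExcept_iff_disjoint {n : ℕ} {G : SimpleGraph (Fin n)}
    {X : Fin 3 → Finset (Fin n)} {x : Fin 3 → Fin n} :
    NoEdgesExcept G X x ↔ Disjoint G.edgeSet (forbiddenPairs X x : Set (Sym2 (Fin n))) := by
  rw [Set.disjoint_left]
  constructor
  · intro h e he hf
    obtain ⟨i, j, hij, u, hu, v, hv, rfl, hn⟩ := mem_forbiddenPairs.1 hf
    exact hn (h i j hij u hu v hv he)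
  · intro h i j hij u hu v hv huv
    by_contra hn
    exact h (a := s(u, v)) huv (mem_forbiddenPairs.2 ⟨i, j, hij, u, hu, v, hv, rfl, hn⟩)

theorem IsKTuple.not_isDiag_of_mem_forbiddenPairs {n k : ℕ} {X : Fin 3 → Finset (Fin n)}
    {x : Fin 3 → Fin n} (hX : IsKTuple k X x) {e : Sym2 (Fin n)} (he : e ∈ forbiddenPairs X x) :
    ¬ e.IsDiag := by
  obtain ⟨i, j, hij, u, hu, v, hv, rfl, -⟩ := mem_forbiddenPairs.1 he
  rw [Sym2.mk_isDiag_iff]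
  rintro rfl
  exact Finset.disjoint_left.1 (hX.2.1 i j hij) hu hv

theorem IsKTuple.le_card_forbiddenPairs {n k : ℕ} {X : Fin 3 → Finset (Fin n)}
    {x : Fin 3 → Fin n} (hX : IsKTuple k X x) :
    3 * k ^ 2 ≤ (forbiddenPairs X x).card + 3 := by
  classical
  obtain ⟨hcard, hdisj, hmem⟩ := hX
  have hx : ∀ i a, x a ∈ X i → a = i := fun i a h => by
    by_contra hne
    exact Finset.disjoint_left.1 (hdisj a i hne) (hmem a) h
  have hsub : crossPairs (X 0) (X 1) (X 2) ⊆
      forbiddenPairs X x ∪ {s(x 0, x 1), s(x 0, x 2), s(x 1, x 2)} := by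
    intro e he
    obtain ⟨i, j, hij, u, hu, v, hv, rfl⟩ := exists_of_mem_crossPairs he
    by_cases hn : (∃ a, u = x a) ∧ ∃ b, v = x b
    · obtain ⟨⟨a, rfl⟩, b, rfl⟩ := hn
      obtain rfl := hx i a hu
      obtain rfl := hx j b hv
      refine Finset.mem_union_right _ ?_
      clear hu hv he
      fin_cases a <;> fin_cases b <;> first
        | exact absurd hij (by decide)
        | simp
    · exact Finset.mem_union_left _ (mem_forbiddenPairs.2 ⟨i, j, hij.ne, u, hu, v, hv, rfl, hn⟩)
  have h := (Finset.card_le_card hsub).trans (Finset.card_union_le _ _)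
  rw [card_crossPairs (hdisj 0 1 (by decide)) (hdisj 0 2 (by decide)) (hdisj 1 2 (by decide)),
    hcard, hcard, hcard] at h
  have h3 : ({s(x 0, x 1), s(x 0, x 2), s(x 1, x 2)} : Finset (Sym2 (Fin n))).card ≤ 3 :=
    Finset.card_le_three
  nlinarith

theorem IsKTuple.three_mul_card_forbiddenPairs_inter_le {n k : ℕ} {X : Fin 3 → Finset (Fin n)}
    {x : Fin 3 → Fin n} (hX : IsKTuple k X x) (Y : Fin 3 → Finset (Fin n)) (y : Fin 3 → Fin n) :
    3 * (forbiddenPairs X x ∩ forbiddenPairs Y y).card ≤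
      ((X 0 ∪ X 1 ∪ X 2) ∩ (Y 0 ∪ Y 1 ∪ Y 2)).card ^ 2 := by
  set U := Y 0 ∪ Y 1 ∪ Y 2 with hU
  have hYU : ∀ i, Y i ⊆ U := by
    intro i w hw
    simp only [hU, Finset.mem_union]
    fin_cases i <;> simp_all
  have hsub : forbiddenPairs X x ∩ forbiddenPairs Y y ⊆
      crossPairs (X 0 ∩ U) (X 1 ∩ U) (X 2 ∩ U) := by
    intro e he
    rw [Finset.mem_inter] at he
    obtain ⟨i, j, hij, u, hu, v, hv, rfl, -⟩ := mem_forbiddenPairs.1 he.1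
    obtain ⟨i', j', -, u', hu', v', hv', he', -⟩ := mem_forbiddenPairs.1 he.2
    have huv : u ∈ U ∧ v ∈ U := by
      rcases Sym2.eq_iff.1 he' with ⟨rfl, rfl⟩ | ⟨rfl, rfl⟩
      · exact ⟨hYU _ hu', hYU _ hv'⟩
      · exact ⟨hYU _ hv', hYU _ hu'⟩
    exact mem_crossPairs_of_ne (A := fun i => X i ∩ U) hij
      (Finset.mem_inter.2 ⟨hu, huv.1⟩) (Finset.mem_inter.2 ⟨hv, huv.2⟩)
  have hle := (Finset.card_le_card hsub).trans (card_crossPairs_le _ _ _)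
  have hd : ∀ i j, i ≠ j → Disjoint (X i ∩ U) (X j ∩ U) := fun i j hij =>
    (hX.2.1 i j hij).mono Finset.inter_subset_left Finset.inter_subset_left
  have hr : ((X 0 ∪ X 1 ∪ X 2) ∩ U).card =
      (X 0 ∩ U).card + (X 1 ∩ U).card + (X 2 ∩ U).card := by
    rw [Finset.union_inter_distrib_right, Finset.union_inter_distrib_right,
      Finset.card_union_of_disjoint, Finset.card_union_of_disjoint (hd 0 1 (by decide))]
    exact Finset.disjoint_union_left.2 ⟨hd 0 2 (by decide), hd 1 2 (by decide)⟩
  rw [hr]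
  zify at hle ⊢
  nlinarith [sq_nonneg (((X 0 ∩ U).card : ℤ) - (X 1 ∩ U).card),
    sq_nonneg (((X 0 ∩ U).card : ℤ) - (X 2 ∩ U).card),
    sq_nonneg (((X 1 ∩ U).card : ℤ) - (X 2 ∩ U).card)]

theorem stmt10 {p : ℝ} (hp : p ∈ Set.Ioo (0 : ℝ) 1) {n k : ℕ}
    (X Y : Fin 3 → Finset (Fin n)) (x y : Fin 3 → Fin n)
    (hX : IsKTuple k X x) (hY : IsKTuple k Y y) :
    ProbabilityTheory.cond (gnp n p)
        {G : SimpleGraph (Fin n) | NoEdgesExcept G X x}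
        {G : SimpleGraph (Fin n) | NoEdgesExcept G Y y} ≤
      ENNReal.ofReal ((1 - p) ^
        (3 * (k : ℝ) ^ 2 -
          ((((X 0 ∪ X 1 ∪ X 2) ∩ (Y 0 ∪ Y 1 ∪ Y 2)).card : ℝ)) ^ 2 / 3 - 3)) := by
  have hq : 0 < 1 - p := by linarith [hp.2]
  have hinter : {G : SimpleGraph (Fin n) | NoEdgesExcept G X x} ∩ {G | NoEdgesExcept G Y y} =
      {G | Disjoint G.edgeSet
        ((forbiddenPairs X x ∪ forbiddenPairs Y y : Finset (Sym2 (Fin n))) :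
          Set (Sym2 (Fin n)))} := by
    ext G
    simp only [Set.mem_inter_iff, Set.mem_ofPred_eq, noEdgesExcept_iff_disjoint, Finset.coe_union,
      Set.disjoint_union_right]
  have hunion : (forbiddenPairs X x ∪ forbiddenPairs Y y).card =
      (forbiddenPairs X x).card + (forbiddenPairs Y y \ forbiddenPairs X x).card := by
    rw [← Finset.union_sdiff_self_eq_union, Finset.card_union_of_disjoint Finset.disjoint_sdiff]
  rw [ProbabilityTheory.cond_apply (measurableSet_simpleGraph _), hinter, gnp_setOf_disjoint_edgeSet hp _ ?_]
  · simp only [noEdgesExcept_iff_disjoint]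
    rw [gnp_setOf_disjoint_edgeSet hp _ fun e => hX.not_isDiag_of_mem_forbiddenPairs,
      ← ENNReal.ofReal_inv_of_pos (by positivity), ← ENNReal.ofReal_mul (by positivity), hunion,
      pow_add, inv_mul_cancel_left₀ (by positivity), ← Real.rpow_natCast]
    refine ENNReal.ofReal_le_ofReal
      (Real.rpow_le_rpow_of_exponent_ge hq (by linarith [hp.1]) ?_)
    have h1 := hY.le_card_forbiddenPairs
    have h2 := hX.three_mul_card_forbiddenPairs_inter_le Y y
    have h3 := Finset.card_sdiff_add_card_inter (forbiddenPairs Y y) (forbiddenPairs X x)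
    rw [Finset.inter_comm] at h3
    rify at h1 h2 h3
    linarith
  · intro e he
    rcases Finset.mem_union.1 he with h | h
    · exact hX.not_isDiag_of_mem_forbiddenPairs h
    · exact hY.not_isDiag_of_mem_forbiddenPairs h
end

section
/- Let X₁, X₂, X₃ ⊆ {1,…,n} be pairwise disjoint sets of size k, let Y₁, Y₂, Y₃ ⊆ {1,…,n} be pairwise disjoint sets of size k, and set r = |(X₁∪X₂∪X₃) ∩ (Y₁∪Y₂∪Y₃)|. Then the number of unordered pairs {u,v} such that u ∈ Yᵢ and v ∈ Yⱼ for some distinct i, j ∈ {1,2,3}, but there do not exist distinct ĩ, j̃ ∈ {1,2,3} with u ∈ X_ĩ and v ∈ X_j̃, is at least 3k² − r²/3. -/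
/-- The Motzkin–Straus bound for the tensor product of two triangles: three times the weight of the
pairs of cells of a nonnegative `3 × 3` array lying in different rows and columns is at most the
square of the total weight. -/
theorem three_mul_sum_offDiag_le (a : Fin 3 → Fin 3 → ℝ) (ha : ∀ i j, 0 ≤ a i j) :
    3 * ∑ q ∈ Finset.univ.filter (fun q : Fin 3 × Fin 3 => q.1 < q.2),
        ∑ p ∈ (Finset.univ : Finset (Fin 3)).offDiag, a p.1 q.1 * a p.2 q.2 ≤
      (∑ i, ∑ j, a i j) ^ 2 := by
  have hcol : ∀ j, a 0 j ^ 2 + a 1 j ^ 2 + a 2 j ^ 2 ≤ (a 0 j + a 1 j + a 2 j) ^ 2 := fun j => by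
    nlinarith [mul_nonneg (ha 0 j) (ha 1 j), mul_nonneg (ha 0 j) (ha 2 j),
      mul_nonneg (ha 1 j) (ha 2 j)]
  have hrow : ∀ x y z : ℝ, (x + y + z) ^ 2 ≤ 3 * (x ^ 2 + y ^ 2 + z ^ 2) := fun x y z => by
    nlinarith [sq_nonneg (x - y), sq_nonneg (x - z), sq_nonneg (y - z)]
  have hq : Finset.univ.filter (fun q : Fin 3 × Fin 3 => q.1 < q.2) =
      {(0, 1), (0, 2), (1, 2)} := by decide
  have hp : (Finset.univ : Finset (Fin 3)).offDiag =
      {(0, 1), (0, 2), (1, 0), (1, 2), (2, 0), (2, 1)} := by decide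
  rw [hq, hp]
  simp [Finset.sum_insert, Fin.sum_univ_three]
  linarith [hcol 0, hcol 1, hcol 2, hrow (a 0 0 + a 0 1 + a 0 2) (a 1 0 + a 1 1 + a 1 2)
    (a 2 0 + a 2 1 + a 2 2)]

/-- The intersection of two unions of pairwise disjoint families is counted cell by cell. -/
theorem card_biUnion_inter_biUnion {α ι κ : Type*} [DecidableEq α] [Fintype ι] [Fintype κ]
    (X : ι → Finset α) (Y : κ → Finset α)
    (hX : ∀ i j, i ≠ j → Disjoint (X i) (X j)) (hY : ∀ i j, i ≠ j → Disjoint (Y i) (Y j)) :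
    (Finset.univ.biUnion X ∩ Finset.univ.biUnion Y).card = ∑ i, ∑ j, (X i ∩ Y j).card := by
  rw [Finset.biUnion_inter, Finset.card_biUnion]
  · refine Finset.sum_congr rfl fun i _ => ?_
    rw [Finset.inter_biUnion, Finset.card_biUnion]
    exact fun j _ l _ h => (hY j l h).mono Finset.inter_subset_right Finset.inter_subset_right
  · exact fun i _ j _ h => (hX i j h).mono Finset.inter_subset_left Finset.inter_subset_left

/-- Pairs in `A × B` that do not cross the family `X`, together with the crossing ones counted
cell by cell, exhaust the product. -/
theorem card_mul_card_le_noncrossing_add {α ι : Type*} [DecidableEq α] [Fintype ι] [DecidableEq ι]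
    (X : ι → Finset α) (A B : Finset α)
    [DecidablePred fun w : α × α => ∃ i j, i ≠ j ∧ w.1 ∈ X i ∧ w.2 ∈ X j] :
    A.card * B.card ≤
      ((A ×ˢ B).filter fun w => ¬ ∃ i j, i ≠ j ∧ w.1 ∈ X i ∧ w.2 ∈ X j).card +
        ∑ p ∈ (Finset.univ : Finset ι).offDiag, (X p.1 ∩ A).card * (X p.2 ∩ B).card := by
  rw [← Finset.card_product, add_comm,
    ← Finset.card_filter_add_card_filter_not (s := A ×ˢ B)
      fun w => ∃ i j, i ≠ j ∧ w.1 ∈ X i ∧ w.2 ∈ X j]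
  gcongr
  simp_rw [← Finset.card_product]
  refine (Finset.card_le_card ?_).trans Finset.card_biUnion_le
  rintro ⟨u, v⟩ h
  simp only [Finset.mem_filter, Finset.mem_product] at h
  obtain ⟨⟨hu, hv⟩, i, j, hij, hi, hj⟩ := h
  simp only [Finset.mem_biUnion, Finset.mem_offDiag, Finset.mem_product, Finset.mem_inter]
  exact ⟨(i, j), by simpa using hij, ⟨hi, hu⟩, hj, hv⟩

/-- Unordered pairs crossing `Y` but not `X` are at least as many as the ordered ones whose first
entry lies in the part of `Y` with the smaller index. -/
theorem sum_card_noncrossing_le_card_sym2 {α ι : Type*} [Finite α] [DecidableEq α] [Fintype ι]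
    [LinearOrder ι] (X Y : ι → Finset α) (hY : ∀ i j, i ≠ j → Disjoint (Y i) (Y j))
    [DecidablePred fun w : α × α => ∃ i j, i ≠ j ∧ w.1 ∈ X i ∧ w.2 ∈ X j] :
    ∑ q ∈ Finset.univ.filter (fun q : ι × ι => q.1 < q.2),
        ((Y q.1 ×ˢ Y q.2).filter fun w => ¬ ∃ i j, i ≠ j ∧ w.1 ∈ X i ∧ w.2 ∈ X j).card ≤
      Nat.card {s : Sym2 α | ∃ u v : α, s = s(u, v) ∧
        (∃ i j, i ≠ j ∧ u ∈ Y i ∧ v ∈ Y j) ∧ ¬ ∃ i j, i ≠ j ∧ u ∈ X i ∧ v ∈ X j} := by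
  have hunique : ∀ {i j u}, u ∈ Y i → u ∈ Y j → i = j := fun {i j u} hi hj => by
    by_contra h
    exact Finset.disjoint_left.1 (hY i j h) hi hj
  rw [← Finset.card_biUnion, Nat.card_coe_set_eq, ← Set.ncard_coe_finset]
  · refine Set.ncard_le_ncard_of_injOn (fun w => s(w.1, w.2)) ?_ ?_ (Set.toFinite _)
    · rintro ⟨u, v⟩ h
      simp only [Finset.coe_biUnion, Set.mem_iUnion, Finset.mem_coe, Finset.mem_filter,
        Finset.mem_product, Finset.mem_univ, true_and] at h
      obtain ⟨⟨i, j⟩, hij, ⟨hu, hv⟩, hX⟩ := h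
      exact ⟨u, v, rfl, ⟨i, j, hij.ne, hu, hv⟩, hX⟩
    · rintro ⟨u, v⟩ h ⟨u', v'⟩ h' heq
      simp only [Finset.coe_biUnion, Set.mem_iUnion, Finset.mem_coe, Finset.mem_filter,
        Finset.mem_product, Finset.mem_univ, true_and] at h h'
      obtain ⟨⟨i, j⟩, hij, ⟨hu, hv⟩, -⟩ := h
      obtain ⟨⟨i', j'⟩, hij', ⟨hu', hv'⟩, -⟩ := h'
      rcases Sym2.eq_iff.1 heq with ⟨rfl, rfl⟩ | ⟨rfl, rfl⟩
      · rfl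
      · have h₁ := hunique hu hv'
        have h₂ := hunique hv hu'
        simp only at hij hij' h₁ h₂
        subst h₁ h₂
        exact absurd hij hij'.asymm
  · rintro ⟨i, j⟩ - ⟨i', j'⟩ - hne
    refine Finset.disjoint_left.2 ?_
    rintro ⟨u, v⟩ h h'
    simp only [Finset.mem_filter, Finset.mem_product] at h h'
    exact hne (Prod.ext (hunique h.1.1 h'.1.1) (hunique h.1.2 h'.1.2))

theorem stmt11 {n k : ℕ} (hk : 0 < k) (h3k : 3 * k ≤ n)
    (X Y : Fin 3 → Finset (Fin n))
    (hXcard : ∀ i, (X i).card = k) (hXdisj : ∀ i j, i ≠ j → Disjoint (X i) (X j))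
    (hYcard : ∀ i, (Y i).card = k) (hYdisj : ∀ i j, i ≠ j → Disjoint (Y i) (Y j)) :
    3 * (k : ℝ) ^ 2 -
        ((((X 0 ∪ X 1 ∪ X 2) ∩ (Y 0 ∪ Y 1 ∪ Y 2)).card : ℝ)) ^ 2 / 3 ≤
      (Nat.card {s : Sym2 (Fin n) | ∃ u v : Fin n, s = s(u, v) ∧
        (∃ i j : Fin 3, i ≠ j ∧ u ∈ Y i ∧ v ∈ Y j) ∧
        ¬ ∃ i j : Fin 3, i ≠ j ∧ u ∈ X i ∧ v ∈ X j} : ℝ) := by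
  classical
  have hunion : ∀ Z : Fin 3 → Finset (Fin n), Z 0 ∪ Z 1 ∪ Z 2 = Finset.univ.biUnion Z := by
    intro Z
    ext x
    simp [Fin.exists_fin_succ]
  have hpairs : (Finset.univ.filter fun q : Fin 3 × Fin 3 => q.1 < q.2).card = 3 := by decide
  have hcross := Finset.sum_le_sum fun (q : Fin 3 × Fin 3)
    (_ : q ∈ Finset.univ.filter fun q : Fin 3 × Fin 3 => q.1 < q.2) =>
      card_mul_card_le_noncrossing_add X (Y q.1) (Y q.2)
  have hcount := sum_card_noncrossing_le_card_sym2 X Y hYdisj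
  have hmotzkin := three_mul_sum_offDiag_le (fun i j => ((X i ∩ Y j).card : ℝ))
    fun _ _ => Nat.cast_nonneg _
  simp only [hYcard, Finset.sum_const, hpairs, smul_eq_mul, Finset.sum_add_distrib] at hcross
  have hbound := hcross.trans (Nat.add_le_add_right hcount _)
  rw [← Nat.cast_le (α := ℝ)] at hbound
  push_cast at hbound
  rw [hunion, hunion, card_biUnion_inter_biUnion X Y hXdisj hYdisj]
  push_cast
  linarith
end

section
/- Let r₀ be a positive integer, let 𝒳 = (X₁,x₁,X₂,x₂,X₃,x₃) and 𝒴 = (Y₁,y₁,Y₂,y₂,Y₃,y₃) be two k-tuples on {1,…,n} with r₀ < k/30, set r = |(X₁∪X₂∪X₃) ∩ (Y₁∪Y₂∪Y₃)|, r_s = |Y_s ∩ (X₁∪X₂∪X₃)| and r_{s,j} = |Y_s ∩ X_j|, and suppose there exists s ∈ {1,2,3} with r_s > k − r₀ and r_{s,j} < k − 6r₀ for all j ∈ {1,2,3}. Then under G(n,p), the conditional probability P(N_𝒴 | N_𝒳) is at most (1−p)^{3k² − r²/3 − 3 + 4k·r₀}. -/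
open MeasureTheory Filter Real

open Finset in
/-- The total weight of the graphs avoiding the edges of `H` is `(1 - p) ^ e(H)`. -/
theorem sum_weight_disjoint {V : Type*} [Fintype V] [DecidableEq V] (p : ℝ)
    (H : SimpleGraph V) [Fintype H.edgeSet] [DecidablePred fun G : SimpleGraph V => Disjoint G H] :
    ∑ G : SimpleGraph V with Disjoint G H,
      p ^ Nat.card G.edgeSet * (1 - p) ^ ((Fintype.card V).choose 2 - Nat.card G.edgeSet) =
      (1 - p) ^ #H.edgeFinset := by
  classical
  set E := (⊤ : SimpleGraph V).edgeFinset with hE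
  have hHE : H.edgeFinset ⊆ E := SimpleGraph.edgeFinset_mono le_top
  have hcard : #(E \ H.edgeFinset) + #H.edgeFinset = (Fintype.card V).choose 2 := by
    rw [card_sdiff_add_card_eq_card hHE, hE, SimpleGraph.card_edgeFinset_top_eq_card_choose_two]
  have key := sum_pow_mul_eq_add_pow p (1 - p) (E \ H.edgeFinset)
  rw [add_sub_cancel, one_pow] at key
  refine Eq.trans ?_ ((congrArg ((1 - p) ^ #H.edgeFinset * ·) key).trans (mul_one _))
  simp only [mul_sum]
  refine sum_nbij' (fun G => G.edgeFinset) (fun t => SimpleGraph.fromEdgeSet (t : Set (Sym2 V)))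
    ?_ ?_ ?_ ?_ ?_
  · intro G hG
    simp only [mem_filter, mem_univ, true_and] at hG
    rw [mem_powerset, subset_sdiff]
    exact ⟨SimpleGraph.edgeFinset_mono le_top, SimpleGraph.disjoint_edgeFinset.2 hG⟩
  · intro t ht
    rw [mem_powerset, subset_sdiff] at ht
    simp only [mem_filter, mem_univ, true_and]
    rw [← SimpleGraph.disjoint_edgeSet, SimpleGraph.edgeSet_fromEdgeSet]
    refine Disjoint.mono_left Set.sdiff_subset ?_
    rw [← SimpleGraph.coe_edgeFinset H]
    exact_mod_cast ht.2
  · intro G _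
    simp
  · intro t ht
    rw [mem_powerset, subset_sdiff] at ht
    ext e
    have := @ht.1 e
    simp only [hE, SimpleGraph.mem_edgeFinset, SimpleGraph.edgeSet_top] at this
    simpa using this
  · intro G hG
    simp only [mem_filter, mem_univ, true_and] at hG
    have hsub : G.edgeFinset ⊆ E \ H.edgeFinset := by
      rw [subset_sdiff]
      exact ⟨SimpleGraph.edgeFinset_mono le_top, SimpleGraph.disjoint_edgeFinset.2 hG⟩
    have hle := card_le_card hsub
    rw [Nat.card_eq_fintype_card, ← SimpleGraph.edgeFinset_card,
      mul_left_comm, ← pow_add]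
    congr 2
    omega

open Finset in
theorem gnp_disjoint {p : ℝ} (hp : p ∈ Set.Ioo (0 : ℝ) 1) {n : ℕ} (H : SimpleGraph (Fin n))
    [Fintype H.edgeSet] :
    gnp n p {G | Disjoint G H} = ENNReal.ofReal ((1 - p) ^ #H.edgeFinset) := by
  classical
  have h0 : 0 ≤ 1 - p := sub_nonneg.2 hp.2.le
  rw [← sum_weight_disjoint, ENNReal.ofReal_sum_of_nonneg, gnp,
    Measure.sum_apply _ MeasurableSpace.measurableSet_top, tsum_fintype, sum_filter]
  · refine sum_congr rfl fun G _ => ?_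
    rw [Measure.smul_apply, Measure.dirac_apply' _ MeasurableSpace.measurableSet_top,
      Fintype.card_fin, Nat.choose_two_right]
    by_cases h : Disjoint G H <;> simp [h]
  · intro G _
    have := hp.1.le
    positivity

open Finset in
theorem gnp_cond_disjoint {p : ℝ} (hp : p ∈ Set.Ioo (0 : ℝ) 1) {n : ℕ}
    (H K : SimpleGraph (Fin n)) [DecidableRel H.Adj] [DecidableRel K.Adj] :
    ProbabilityTheory.cond (gnp n p) {G | Disjoint G H} {G | Disjoint G K} =
      ENNReal.ofReal ((1 - p) ^ #(K.edgeFinset \ H.edgeFinset)) := by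
  classical
  have h0 : 0 < 1 - p := sub_pos.2 hp.2
  have hinter : {G : SimpleGraph (Fin n) | Disjoint G H} ∩ {G | Disjoint G K} =
      {G | Disjoint G (H ⊔ K)} := by
    ext G
    simp [disjoint_sup_right]
  rw [ProbabilityTheory.cond_apply MeasurableSpace.measurableSet_top, hinter, gnp_disjoint hp,
    gnp_disjoint hp, SimpleGraph.edgeFinset_sup, ← union_sdiff_self_eq_union,
    card_union_of_disjoint disjoint_sdiff, pow_add, ENNReal.ofReal_mul (by positivity),
    ← mul_assoc, ENNReal.inv_mul_cancel, one_mul]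
  · simpa using pow_pos h0 _
  · exact ENNReal.ofReal_ne_top

open Finset in
theorem SimpleGraph.card_adj_pairs {V : Type*} [Fintype V] [DecidableEq V] (H : SimpleGraph V)
    [DecidableRel H.Adj] [Fintype H.edgeSet] :
    #{e : V × V | H.Adj e.1 e.2} = 2 * #H.edgeFinset := by
  convert H.two_mul_card_edgeFinset.symm

/-- The graph of pairs forbidden to be edges by `NoEdgesExcept`. -/
def forbiddenGraph {n : ℕ} (X : Fin 3 → Finset (Fin n)) (x : Fin 3 → Fin n) :
    SimpleGraph (Fin n) where
  Adj u v := u ≠ v ∧ (∃ i j, i ≠ j ∧ u ∈ X i ∧ v ∈ X j) ∧ ¬((∃ a, u = x a) ∧ ∃ b, v = x b)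
  symm := ⟨fun _ _ ⟨h, ⟨i, j, hij, hu, hv⟩, hx⟩ =>
    ⟨h.symm, ⟨j, i, hij.symm, hv, hu⟩, fun h' => hx h'.symm⟩⟩
  loopless := ⟨fun _ h => h.1 rfl⟩

theorem noEdgesExcept_iff {n : ℕ} (G : SimpleGraph (Fin n)) (X : Fin 3 → Finset (Fin n))
    (x : Fin 3 → Fin n) : NoEdgesExcept G X x ↔ Disjoint G (forbiddenGraph X x) := by
  rw [SimpleGraph.disjoint_left]
  constructor
  · rintro h u v huv ⟨-, ⟨i, j, hij, hu, hv⟩, hx⟩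
    exact hx (h i j hij u hu v hv huv)
  · intro h i j hij u hu v hv huv
    by_contra hx
    exact h u v huv ⟨huv.ne, ⟨i, j, hij, hu, hv⟩, hx⟩

theorem IsKTuple.eq_of_mem {n k : ℕ} {X : Fin 3 → Finset (Fin n)} {x : Fin 3 → Fin n}
    (h : IsKTuple k X x) {i j : Fin 3} {u : Fin n} (hi : u ∈ X i) (hj : u ∈ X j) : i = j := by
  by_contra hij
  exact Finset.disjoint_left.1 (h.2.1 i j hij) hi hj

open Finset in
theorem IsKTuple.three_mul_sq_le {n k : ℕ} {X : Fin 3 → Finset (Fin n)} {x : Fin 3 → Fin n}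
    (h : IsKTuple k X x) [DecidableRel (forbiddenGraph X x).Adj] :
    3 * k ^ 2 ≤ #(forbiddenGraph X x).edgeFinset + 3 := by
  have h1 : #((univ : Finset (Fin 3)).offDiag.biUnion fun a => X a.1 ×ˢ X a.2) = 6 * k ^ 2 := by
    rw [card_biUnion]
    · simp only [card_product, h.1, sum_const, smul_eq_mul, sq]
      rfl
    · rintro ⟨i, j⟩ - ⟨i', j'⟩ - hne
      rw [Function.onFun, disjoint_left]
      rintro ⟨u, v⟩ huv huv'
      simp only [mem_product] at huv huv'
      exact hne (Prod.ext (h.eq_of_mem huv.1 huv'.1) (h.eq_of_mem huv.2 huv'.2))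
  have h2 : #((univ : Finset (Fin 3)).offDiag.image fun a => (x a.1, x a.2)) ≤ 6 :=
    card_image_le
  have h3 : ((univ : Finset (Fin 3)).offDiag.biUnion fun a => X a.1 ×ˢ X a.2) ⊆
      ({e : Fin n × Fin n | (forbiddenGraph X x).Adj e.1 e.2} : Finset _) ∪
        (univ : Finset (Fin 3)).offDiag.image fun a => (x a.1, x a.2) := by
    rintro ⟨u, v⟩ huv
    simp only [mem_biUnion, mem_offDiag, mem_univ, true_and, mem_product] at huv
    obtain ⟨⟨i, j⟩, hij, hu, hv⟩ := huv
    have huv : u ≠ v := fun e => hij (h.eq_of_mem hu (e ▸ hv))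
    rw [mem_union, or_iff_not_imp_left]
    intro hadj
    have hx : (∃ a, u = x a) ∧ ∃ b, v = x b := by
      by_contra hx
      exact hadj (mem_filter.2 ⟨mem_univ _, huv, ⟨i, j, hij, hu, hv⟩, hx⟩)
    obtain ⟨⟨a, rfl⟩, b, rfl⟩ := hx
    refine mem_image.2 ⟨(a, b), ?_, rfl⟩
    simp only [mem_offDiag, mem_univ, true_and]
    rintro rfl
    exact huv rfl
  have h4 := (card_le_card h3).trans (card_union_le _ _)
  rw [SimpleGraph.card_adj_pairs] at h4
  omega

open Finset in
theorem two_mul_card_inter_le {n : ℕ} (X Y : Fin 3 → Finset (Fin n)) (x y : Fin 3 → Fin n)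
    [DecidableRel (forbiddenGraph X x).Adj] [DecidableRel (forbiddenGraph Y y).Adj] :
    2 * #((forbiddenGraph Y y).edgeFinset ∩ (forbiddenGraph X x).edgeFinset) ≤
      ∑ a ∈ (univ : Finset (Fin 3)).offDiag, ∑ b ∈ (univ : Finset (Fin 3)).offDiag,
        #(Y a.1 ∩ X b.1) * #(Y a.2 ∩ X b.2) := by
  classical
  have hinf : (forbiddenGraph Y y ⊓ forbiddenGraph X x).edgeFinset =
      (forbiddenGraph Y y).edgeFinset ∩ (forbiddenGraph X x).edgeFinset := by
    ext e
    simp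
  rw [← hinf, ← SimpleGraph.card_adj_pairs, ← sum_product']
  calc _ ≤ #(((univ : Finset (Fin 3)).offDiag ×ˢ (univ : Finset (Fin 3)).offDiag).biUnion
        fun c => (Y c.1.1 ∩ X c.2.1) ×ˢ (Y c.1.2 ∩ X c.2.2)) := by
        refine card_le_card ?_
        rintro ⟨u, v⟩ huv
        obtain ⟨⟨-, ⟨i, j, hij, hu, hv⟩, -⟩, -, ⟨i', j', hij', hu', hv'⟩, -⟩ :=
          (mem_filter.1 huv).2
        exact mem_biUnion.2 ⟨((i, j), (i', j')), by simp [hij, hij'], by simp [*]⟩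
    _ ≤ _ := card_biUnion_le.trans (by simp only [card_product]; rfl)

open Finset in
theorem IsKTuple.card_inter_union {n k : ℕ} {X : Fin 3 → Finset (Fin n)} {x : Fin 3 → Fin n}
    (h : IsKTuple k X x) (A : Finset (Fin n)) :
    #(A ∩ (X 0 ∪ X 1 ∪ X 2)) = #(A ∩ X 0) + #(A ∩ X 1) + #(A ∩ X 2) := by
  have h01 := h.2.1 0 1 (by decide)
  have h02 := h.2.1 0 2 (by decide)
  have h12 := h.2.1 1 2 (by decide)
  rw [inter_union_distrib_left, inter_union_distrib_left, card_union_of_disjoint,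
    card_union_of_disjoint]
  · exact h01.mono inter_subset_right inter_subset_right
  · rw [disjoint_union_left]
    exact ⟨h02.mono inter_subset_right inter_subset_right,
      h12.mono inter_subset_right inter_subset_right⟩

theorem four_mul_le_of_spread {k r a b c : ℝ} (hr : 0 < r) (hk : 30 * r < k)
    (hb0 : 0 ≤ b) (hc0 : 0 ≤ c) (hR : k - r < a + b + c) (ha : a < k - 6 * r)
    (hba : b ≤ a) (hca : c ≤ a) : 4 * k * r ≤ a * b + b * c + c * a := by
  have h1 : 0 ≤ (k - 6 * r - a) * (a - 5 * r) := mul_nonneg (by linarith) (by linarith)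
  have h2 : 0 ≤ a * (a + b + c - (k - r)) := mul_nonneg (by linarith) (by linarith)
  have h3 : 0 ≤ r * (k - 30 * r) := mul_nonneg hr.le (by linarith)
  have h4 : 0 ≤ b * c := mul_nonneg hb0 hc0
  linarith

theorem four_mul_le_sum_mul_of_spread {k r : ℝ} (hr : 0 < r) (hk : 30 * r < k) (a : Fin 3 → ℝ)
    (h0 : ∀ j, 0 ≤ a j) (hR : k - r < a 0 + a 1 + a 2) (ha : ∀ j, a j < k - 6 * r) :
    4 * k * r ≤ a 0 * a 1 + a 1 * a 2 + a 2 * a 0 := by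
  rcases le_total (a 0) (a 1) with h01 | h01 <;> rcases le_total (a 0) (a 2) with h02 | h02 <;>
    rcases le_total (a 1) (a 2) with h12 | h12
  all_goals first
    | linarith [four_mul_le_of_spread hr hk (h0 1) (h0 2) (by linarith) (ha 0) (by linarith)
        (by linarith)]
    | linarith [four_mul_le_of_spread hr hk (h0 2) (h0 0) (by linarith) (ha 1) (by linarith)
        (by linarith)]
    | linarith [four_mul_le_of_spread hr hk (h0 0) (h0 1) (by linarith) (ha 2) (by linarith)
        (by linarith)]

/-- The number of ordered pairs of entries of a `3 × 3` matrix in different rows and columns,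
weighted by the entries, compared with the square of the total. -/
theorem sum_offDiag_mul_le (a : Fin 3 → Fin 3 → ℝ) (h0 : ∀ i j, 0 ≤ a i j) (s : Fin 3) :
    ∑ e ∈ (Finset.univ : Finset (Fin 3)).offDiag, ∑ f ∈ (Finset.univ : Finset (Fin 3)).offDiag,
        a e.1 f.1 * a e.2 f.2 ≤
      2 * ((∑ i, ∑ j, a i j) ^ 2 / 3 - (a s 0 * a s 1 + a s 1 * a s 2 + a s 2 * a s 0)) := by
  have hoff : (Finset.univ : Finset (Fin 3)).offDiag =
      {(0, 1), (0, 2), (1, 0), (1, 2), (2, 0), (2, 1)} := by decide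
  have hrow : ∀ i, 0 ≤ a i 0 * a i 1 + a i 1 * a i 2 + a i 2 * a i 0 := fun i => by
    have := h0 i 0
    have := h0 i 1
    have := h0 i 2
    positivity
  have hs : a s 0 * a s 1 + a s 1 * a s 2 + a s 2 * a s 0 ≤
      ∑ i, (a i 0 * a i 1 + a i 1 * a i 2 + a i 2 * a i 0) :=
    Finset.single_le_sum (f := fun i => a i 0 * a i 1 + a i 1 * a i 2 + a i 2 * a i 0)
      (fun i _ => hrow i) (Finset.mem_univ s)
  rw [hoff]
  simp only [Fin.sum_univ_three] at hs ⊢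
  simp only [Finset.sum_insert, Finset.mem_insert, Finset.mem_singleton, Prod.mk.injEq,
    Finset.sum_singleton, Fin.reduceEq, and_false, false_and, or_self, and_self, not_false_eq_true]
  have q1 := sq_nonneg (a 0 0 + a 1 0 + a 2 0 - (a 0 1 + a 1 1 + a 2 1))
  have q2 := sq_nonneg (a 0 0 + a 1 0 + a 2 0 - (a 0 2 + a 1 2 + a 2 2))
  have q3 := sq_nonneg (a 0 1 + a 1 1 + a 2 1 - (a 0 2 + a 1 2 + a 2 2))
  linarith

theorem stmt12 {p : ℝ} (hp : p ∈ Set.Ioo (0 : ℝ) 1) {n k r₀ : ℕ} (hr₀ : 0 < r₀)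
    (X Y : Fin 3 → Finset (Fin n)) (x y : Fin 3 → Fin n)
    (hX : IsKTuple k X x) (hY : IsKTuple k Y y)
    (hr₀k : (r₀ : ℝ) < (k : ℝ) / 30)
    (hs : ∃ s : Fin 3,
      (k : ℝ) - (r₀ : ℝ) < (((Y s) ∩ (X 0 ∪ X 1 ∪ X 2)).card : ℝ) ∧
      ∀ j : Fin 3, (((Y s) ∩ X j).card : ℝ) < (k : ℝ) - 6 * (r₀ : ℝ)) :
    ProbabilityTheory.cond (gnp n p)
        {G : SimpleGraph (Fin n) | NoEdgesExcept G X x}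
        {G : SimpleGraph (Fin n) | NoEdgesExcept G Y y} ≤
      ENNReal.ofReal ((1 - p) ^
        (3 * (k : ℝ) ^ 2 -
          ((((X 0 ∪ X 1 ∪ X 2) ∩ (Y 0 ∪ Y 1 ∪ Y 2)).card : ℝ)) ^ 2 / 3 - 3 +
          4 * (k : ℝ) * (r₀ : ℝ))) := by
  classical
  obtain ⟨s, hs, hsj⟩ := hs
  have hset : ∀ (Z : Fin 3 → Finset (Fin n)) (z : Fin 3 → Fin n),
      {G : SimpleGraph (Fin n) | NoEdgesExcept G Z z} = {G | Disjoint G (forbiddenGraph Z z)} :=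
    fun Z z => Set.ext fun G => noEdgesExcept_iff G Z z
  rw [hset, hset, gnp_cond_disjoint hp, ← Real.rpow_natCast]
  refine ENNReal.ofReal_le_ofReal (Real.rpow_le_rpow_of_exponent_ge (by linarith [hp.2])
    (by linarith [hp.1]) ?_)
  set A : Fin 3 → Fin 3 → ℝ := fun i j => ((Y i ∩ X j).card : ℝ) with hA
  have hA0 : ∀ i j, 0 ≤ A i j := fun i j => Nat.cast_nonneg _
  have hr : (((X 0 ∪ X 1 ∪ X 2) ∩ (Y 0 ∪ Y 1 ∪ Y 2)).card : ℝ) = ∑ i, ∑ j, A i j := by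
    rw [hY.card_inter_union]
    simp only [Finset.inter_comm _ (Y _), hX.card_inter_union, Fin.sum_univ_three, hA]
    push_cast
    ring
  have hrow : 4 * (k : ℝ) * r₀ ≤ A s 0 * A s 1 + A s 1 * A s 2 + A s 2 * A s 0 := by
    refine four_mul_le_sum_mul_of_spread (by exact_mod_cast hr₀) (by linarith) (A s) (hA0 s) ?_ hsj
    rw [hX.card_inter_union] at hs
    push_cast at hs
    exact hs
  have hM := sum_offDiag_mul_le A hA0 s
  have hI : (2 : ℝ) * ((forbiddenGraph Y y).edgeFinset ∩ (forbiddenGraph X x).edgeFinset).card ≤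
      ∑ e ∈ (Finset.univ : Finset (Fin 3)).offDiag,
        ∑ f ∈ (Finset.univ : Finset (Fin 3)).offDiag, A e.1 f.1 * A e.2 f.2 := by
    simp only [hA]
    exact_mod_cast two_mul_card_inter_le X Y x y
  have hE : 3 * (k : ℝ) ^ 2 ≤ (forbiddenGraph Y y).edgeFinset.card + 3 := by
    exact_mod_cast hY.three_mul_sq_le
  have hD : ((forbiddenGraph Y y).edgeFinset.card : ℝ) =
      ((forbiddenGraph Y y).edgeFinset \ (forbiddenGraph X x).edgeFinset).card +
        ((forbiddenGraph Y y).edgeFinset ∩ (forbiddenGraph X x).edgeFinset).card := by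
    exact_mod_cast (Finset.card_sdiff_add_card_inter _ _).symm
  rw [hr]
  linarith
end

section
/- Fix p ∈ (0,1) and a positive integer r₀, and for each k set n = n_k = ⌊(1/(1−p))^k · k⌋. Then for every ε > 0 there exists K such that for all k ≥ K the following holds: for any two k-tuples 𝒳 = (X₁,x₁,X₂,x₂,X₃,x₃) and 𝒴 = (Y₁,y₁,Y₂,y₂,Y₃,y₃) on {1,…,n_k} with |(X₁∪X₂∪X₃) ∩ (Y₁∪Y₂∪Y₃)| ≤ r₀, the probability under G(n_k, p) that each of X₁, X₂, X₃, Y₁, Y₂, Y₃ dominates the set {1,…,n_k} ∖ ((X₁∪X₂∪X₃) ∪ (Y₁∪Y₂∪Y₃)) is at most (1+ε)·(1 − 6(1−p)^k)^{n_k}. -/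
open MeasureTheory Filter Real

/-- `A` dominates `S` in `G`: every vertex of `S` has a neighbor in `A`. -/
def DominatesSet {n : ℕ} (G : SimpleGraph (Fin n)) (A S : Finset (Fin n)) : Prop :=
  ∀ v ∈ S, ∃ u ∈ A, G.Adj v u

/-- The law of a biased coin: `true` with probability `p`, `false` with probability `1 - p`. -/
noncomputable def coinMeasure (p : ℝ) : Measure Bool :=
  ENNReal.ofReal p • Measure.dirac true + ENNReal.ofReal (1 - p) • Measure.dirac false

lemma coinMeasure_true (p : ℝ) : coinMeasure p {true} = ENNReal.ofReal p := by
  simp [coinMeasure]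

lemma coinMeasure_false (p : ℝ) : coinMeasure p {false} = ENNReal.ofReal (1 - p) := by
  simp [coinMeasure]

lemma isProbabilityMeasure_coinMeasure {p : ℝ} (h0 : 0 ≤ p) (h1 : p ≤ 1) :
    IsProbabilityMeasure (coinMeasure p) := by
  constructor
  simp only [coinMeasure, Measure.coe_add, Measure.coe_smul, Pi.add_apply, Pi.smul_apply,
    measure_univ, smul_eq_mul, mul_one]
  rw [← ENNReal.ofReal_add h0 (by linarith)]
  simp

/-- The graph whose edges are the non-diagonal pairs marked `true`. -/
def graphOfMarking {V : Type*} (f : Sym2 V → Bool) : SimpleGraph V :=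
  SimpleGraph.fromEdgeSet {e | f e = true}

lemma graphOfMarking_adj {V : Type*} (f : Sym2 V → Bool) {u v : V} (h : u ≠ v) :
    (graphOfMarking f).Adj u v ↔ f s(u, v) = true := by
  simp [graphOfMarking, h]

lemma preimage_graphOfMarking_singleton {V : Type*} [DecidableEq V] (G : SimpleGraph V)
    [DecidablePred (· ∈ G.edgeSet)] :
    graphOfMarking ⁻¹' {G} = Set.univ.pi fun e : Sym2 V =>
      if e.IsDiag then Set.univ else if e ∈ G.edgeSet then {true} else {false} := by
  ext f
  simp only [Set.mem_preimage, Set.mem_singleton_iff, Set.mem_pi, Set.mem_univ, true_implies]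
  constructor
  · rintro rfl e
    induction e with | _ u v
    by_cases h : u = v
    · simp [h]
    · by_cases hf : f s(u, v) = true <;> simp [h, graphOfMarking_adj f h, hf]
  · intro hf
    ext u v
    by_cases h : u = v
    · simp [h]
    · have := hf s(u, v)
      rw [graphOfMarking_adj f h]
      by_cases hG : G.Adj u v <;> simpa [h, hG] using this

lemma gnp_eq_map {p : ℝ} (hp : p ∈ Set.Ioo (0 : ℝ) 1) (n : ℕ) :
    gnp n p = (Measure.pi fun _ : Sym2 (Fin n) => coinMeasure p).map graphOfMarking := by
  classical
  have := isProbabilityMeasure_coinMeasure hp.1.le hp.2.le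
  have hm : Measurable (graphOfMarking (V := Fin n)) := measurable_of_countable _
  refine Measure.ext_of_singleton fun G => ?_
  rw [Measure.map_apply hm (by trivial), preimage_graphOfMarking_singleton, Measure.pi_pi]
  have hw : ∀ e : Sym2 (Fin n),
      coinMeasure p (if e.IsDiag then Set.univ else if e ∈ G.edgeSet then {true} else {false}) =
        if e.IsDiag then 1 else if e ∈ G.edgeSet then ENNReal.ofReal p
          else ENNReal.ofReal (1 - p) := by
    intro e
    split_ifs <;> simp only [measure_univ, coinMeasure_true, coinMeasure_false]
  simp_rw [hw]
  have hcard : (Finset.univ.filter fun e : Sym2 (Fin n) => ¬ e.IsDiag).card = n * (n - 1) / 2 := by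
    rw [← Fintype.card_subtype, Sym2.card_subtype_not_diag, Fintype.card_fin,
      Nat.choose_two_right]
  have hE : (Finset.univ.filter fun e : Sym2 (Fin n) => ¬ e.IsDiag).filter (· ∈ G.edgeSet) =
      G.edgeFinset := by
    ext e
    simpa using fun h => G.not_isDiag_of_mem_edgeSet h
  have hE' : ((Finset.univ.filter fun e : Sym2 (Fin n) => ¬ e.IsDiag).filter
      (· ∉ G.edgeSet)).card = n * (n - 1) / 2 - G.edgeFinset.card := by
    rw [← hcard, ← hE]
    exact Nat.eq_sub_of_add_eq' (Finset.card_filter_add_card_filter_not _)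
  rw [Finset.prod_ite, Finset.prod_const_one, one_mul, Finset.prod_ite, Finset.prod_const,
    Finset.prod_const, hE', hE, gnp, Measure.sum_apply _ (by trivial), tsum_eq_single G]
  · rw [ENNReal.ofReal_mul (by have := hp.1; positivity), ENNReal.ofReal_pow hp.1.le,
      ENNReal.ofReal_pow (by linarith [hp.2])]
    simp [SimpleGraph.edgeFinset_card]
  · intro H hH
    simp [hH]

lemma measure_pi_inter_of_dependsOn {ι : Type*} [Fintype ι] {α : Type*} [MeasurableSpace α]
    [Finite α] [MeasurableSingletonClass α] (ν : Measure α) [IsProbabilityMeasure ν]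
    {S T : Finset ι} (hST : Disjoint S T) {A B : Set (ι → α)}
    (hA : ∀ f g : ι → α, (∀ i ∈ S, f i = g i) → f ∈ A → g ∈ A)
    (hB : ∀ f g : ι → α, (∀ i ∈ T, f i = g i) → f ∈ B → g ∈ B) :
    Measure.pi (fun _ : ι => ν) (A ∩ B) =
      Measure.pi (fun _ : ι => ν) A * Measure.pi (fun _ : ι => ν) B := by
  have key : ∀ (S : Finset ι) (A : Set (ι → α)),
      (∀ f g : ι → α, (∀ i ∈ S, f i = g i) → f ∈ A → g ∈ A) →
      A = (fun (f : ι → α) (i : S) => f i) ⁻¹' ((fun (f : ι → α) (i : S) => f i) '' A) := by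
    intro S A hA
    refine (Set.subset_preimage_image _ _).antisymm ?_
    rintro g ⟨f, hf, hfg⟩
    exact hA f g (fun i hi => congrFun hfg ⟨i, hi⟩) hf
  have hind : ProbabilityTheory.iIndepFun (fun (i : ι) (f : ι → α) => f i)
      (Measure.pi (fun _ : ι => ν)) :=
    ProbabilityTheory.iIndepFun_pi (X := fun _ => id) fun _ => aemeasurable_id
  have h2 := (hind.indepFun_finset S T hST fun i => measurable_pi_apply i)
  have h3 := h2.measure_inter_preimage_eq_mul ((fun (f : ι → α) (i : S) => f i) '' A)
    ((fun (f : ι → α) (i : T) => f i) '' B) (Set.toFinite _).measurableSet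
    (Set.toFinite _).measurableSet
  rwa [← key S A hA, ← key T B hB] at h3

/-- Events depending on pairwise disjoint sets of coordinates are independent under a power of a
probability measure. -/
lemma measure_pi_biInter_of_dependsOn {ι κ : Type*} [Fintype ι] [DecidableEq ι] {α : Type*}
    [MeasurableSpace α] [Finite α] [MeasurableSingletonClass α] (ν : Measure α)
    [IsProbabilityMeasure ν] (s : Finset κ) {D : κ → Finset ι} {A : κ → Set (ι → α)}
    (hD : ∀ a ∈ s, ∀ b ∈ s, a ≠ b → Disjoint (D a) (D b))
    (hA : ∀ a ∈ s, ∀ f g : ι → α, (∀ i ∈ D a, f i = g i) → f ∈ A a → g ∈ A a) :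
    Measure.pi (fun _ : ι => ν) (⋂ a ∈ s, A a) =
      ∏ a ∈ s, Measure.pi (fun _ : ι => ν) (A a) := by
  classical
  induction s using Finset.induction_on with
  | empty => simp
  | insert a s ha ih =>
    rw [Finset.set_biInter_insert, Finset.prod_insert ha,
      measure_pi_inter_of_dependsOn ν (S := D a) (T := s.biUnion D), ih]
    · exact fun b hb c hc => hD b (by simp [hb]) c (by simp [hc])
    · exact fun b hb => hA b (by simp [hb])
    · rw [Finset.disjoint_biUnion_right]
      exact fun b hb => hD a (by simp) b (by simp [hb]) (by rintro rfl; exact ha hb)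
    · exact hA a (by simp)
    · intro f g hfg hf
      simp only [Set.mem_iInter] at hf ⊢
      exact fun b hb => hA b (by simp [hb]) f g
        (fun i hi => hfg i (Finset.mem_biUnion.2 ⟨b, hb, hi⟩)) (hf b hb)

/-- A Bonferroni inequality, with every pair counted twice. -/
lemma measureReal_iInter_compl_le {Ω ι : Type*} [MeasurableSpace Ω] [Fintype ι] [DecidableEq ι]
    (μ : Measure Ω) [IsProbabilityMeasure μ] {A : ι → Set Ω} (hA : ∀ i, MeasurableSet (A i)) :
    μ.real (⋂ i, (A i)ᶜ) ≤
      1 - ∑ i, μ.real (A i) + ∑ i, ∑ j ∈ Finset.univ.erase i, μ.real (A i ∩ A j) := by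
  set B : ι → Set Ω := fun i => A i \ ⋃ j ∈ Finset.univ.erase i, A i ∩ A j
  have hBm : ∀ i, MeasurableSet (B i) := fun i =>
    (hA i).diff (Finset.measurableSet_biUnion _ fun j _ => (hA i).inter (hA j))
  have hBd : Pairwise (Function.onFun Disjoint B) := by
    intro i j hij
    refine Set.disjoint_left.2 fun ω hi hj => hi.2 ?_
    simp only [Set.mem_iUnion]
    exact ⟨j, by simp [hij.symm], hi.1, hj.1⟩
  have hB : ∀ i, μ.real (A i) - ∑ j ∈ Finset.univ.erase i, μ.real (A i ∩ A j) ≤ μ.real (B i) := by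
    intro i
    have h1 := measureReal_biUnion_finset_le (μ := μ) (Finset.univ.erase i) fun j => A i ∩ A j
    have h2 := le_measureReal_sdiff (μ := μ) (s₁ := A i)
      (s₂ := ⋃ j ∈ Finset.univ.erase i, A i ∩ A j) (h := measure_ne_top _ _)
    linarith
  have hU : μ.real (⋃ i, B i) = ∑ i, μ.real (B i) := measureReal_iUnion_fintype hBd hBm
  have hle : μ.real (⋂ i, (A i)ᶜ) ≤ μ.real (⋃ i, B i)ᶜ := by
    refine measureReal_mono ?_
    rw [← Set.compl_iUnion]
    exact Set.compl_subset_compl.2 (Set.iUnion_mono fun i => Set.sdiff_subset)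
  rw [probReal_compl_eq_one_sub (MeasurableSet.iUnion hBm), hU] at hle
  have := Finset.sum_le_sum fun i (_ : i ∈ Finset.univ) => hB i
  rw [Finset.sum_sub_distrib] at this
  linarith

lemma measureReal_pi_coinMeasure_forall_false {ι : Type*} [Fintype ι] {p : ℝ}
    (hp : p ∈ Set.Ioo (0 : ℝ) 1) (T : Finset ι) :
    (Measure.pi fun _ : ι => coinMeasure p).real {f | ∀ e ∈ T, f e = false} =
      (1 - p) ^ T.card := by
  classical
  have := isProbabilityMeasure_coinMeasure hp.1.le hp.2.le
  have hT : {f : ι → Bool | ∀ e ∈ T, f e = false} =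
      Set.univ.pi fun e => if e ∈ T then {false} else Set.univ := by
    ext f
    simp only [Set.mem_ofPred_eq, Set.mem_pi, Set.mem_univ, true_implies]
    refine forall_congr' fun e => ?_
    by_cases h : e ∈ T <;> simp [h]
  have hw : ∀ e, coinMeasure p (if e ∈ T then {false} else Set.univ) =
      if e ∈ T then ENNReal.ofReal (1 - p) else 1 := by
    intro e
    split_ifs <;> simp only [measure_univ, coinMeasure_false]
  rw [measureReal_def, hT, Measure.pi_pi]
  simp_rw [hw]
  rw [Finset.prod_ite_mem, Finset.univ_inter, Finset.prod_const, ENNReal.toReal_pow,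
    ENNReal.toReal_ofReal (by linarith [hp.2])]

lemma measureReal_pi_coinMeasure_forall_exists_le {V ι : Type*} [Fintype V] [DecidableEq V]
    [Fintype ι] [DecidableEq ι] {p : ℝ} (hp : p ∈ Set.Ioo (0 : ℝ) 1) {k r : ℕ}
    {Z : ι → Finset V} (hZ : ∀ i, (Z i).card = k)
    (hr : ∀ i j, i ≠ j → (Z i ∩ Z j).card ≤ r) (v : V) :
    (Measure.pi fun _ : Sym2 V => coinMeasure p).real
        {f | ∀ i, ∃ u ∈ Z i, f s(v, u) = true} ≤
      1 - Fintype.card ι * (1 - p) ^ k +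
        Fintype.card ι * (Fintype.card ι - 1 : ℕ) * (1 - p) ^ (2 * k - r) := by
  have := isProbabilityMeasure_coinMeasure hp.1.le hp.2.le
  have hq0 : 0 ≤ 1 - p := by linarith [hp.2]
  have hq1 : 1 - p ≤ 1 := by linarith [hp.1]
  set μ := Measure.pi fun _ : Sym2 V => coinMeasure p
  set A : Finset V → Set (Sym2 V → Bool) := fun W => {f | ∀ u ∈ W, f s(v, u) = false}
  have hA : ∀ W, μ.real (A W) = (1 - p) ^ W.card := by
    intro W
    have hinj : Function.Injective fun u => s(v, u) := fun a b h => by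
      rcases Sym2.eq_iff.1 h with ⟨-, h⟩ | ⟨rfl, rfl⟩
      exacts [h, rfl]
    rw [← Finset.card_image_of_injective W hinj,
      ← measureReal_pi_coinMeasure_forall_false hp]
    simp [A, μ]
  have hinter : ∀ i j, A (Z i) ∩ A (Z j) = A (Z i ∪ Z j) := by
    intro i j
    ext f
    simp only [A, Set.mem_inter_iff, Set.mem_ofPred_eq, Finset.mem_union, or_imp, forall_and]
  have hset : {f : Sym2 V → Bool | ∀ i, ∃ u ∈ Z i, f s(v, u) = true} = ⋂ i, (A (Z i))ᶜ := by
    ext f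
    simp [A]
  have hpair : ∀ i, ∑ j ∈ Finset.univ.erase i, μ.real (A (Z i) ∩ A (Z j)) ≤
      (Fintype.card ι - 1 : ℕ) * (1 - p) ^ (2 * k - r) := by
    intro i
    rw [← Finset.card_univ, ← Finset.card_erase_of_mem (Finset.mem_univ i), ← nsmul_eq_mul]
    refine Finset.sum_le_card_nsmul _ _ _ fun j hj => ?_
    rw [hinter, hA]
    refine pow_le_pow_of_le_one hq0 hq1 ?_
    have h1 := Finset.card_union_add_card_inter (Z i) (Z j)
    have h2 := hr i j (Finset.ne_of_mem_erase hj).symm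
    have h3 := hZ i
    have h4 := hZ j
    omega
  have hsum := Finset.sum_le_card_nsmul Finset.univ _ _ fun i _ => hpair i
  have hbon := measureReal_iInter_compl_le μ (A := fun i => A (Z i))
    fun i => (Set.toFinite _).measurableSet
  simp only [hA, hZ, Finset.sum_const, Finset.card_univ, nsmul_eq_mul] at hbon hsum
  rw [hset, mul_assoc]
  linarith

lemma gnp_forall_dominatesSet_le {ι : Type*} [Fintype ι] [DecidableEq ι] {p : ℝ}
    (hp : p ∈ Set.Ioo (0 : ℝ) 1) {n k r : ℕ} {Z : ι → Finset (Fin n)}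
    (hZ : ∀ i, (Z i).card = k) (hr : ∀ i j, i ≠ j → (Z i ∩ Z j).card ≤ r)
    {U : Finset (Fin n)} (hU : ∀ i, Z i ⊆ U) :
    ((gnp n p) {G | ∀ i, DominatesSet G (Z i) (Finset.univ \ U)}).toReal ≤
      (1 - Fintype.card ι * (1 - p) ^ k +
        Fintype.card ι * (Fintype.card ι - 1 : ℕ) * (1 - p) ^ (2 * k - r)) ^ (n - U.card) := by
  have := isProbabilityMeasure_coinMeasure hp.1.le hp.2.le
  have hm : Measurable (graphOfMarking (V := Fin n)) := measurable_of_countable _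
  have hpre : graphOfMarking ⁻¹' {G | ∀ i, DominatesSet G (Z i) (Finset.univ \ U)} =
      ⋂ v ∈ Finset.univ \ U, {f | ∀ i, ∃ u ∈ Z i, f s(v, u) = true} := by
    ext f
    simp only [Set.mem_preimage, Set.mem_ofPred_eq, Set.mem_iInter, DominatesSet]
    rw [forall_comm]
    refine forall_congr' fun v => ?_
    rw [forall_comm]
    refine forall_congr' fun hv => forall_congr' fun i => exists_congr fun u =>
      and_congr_right fun hu => graphOfMarking_adj f ?_
    rintro rfl
    exact (Finset.mem_sdiff.1 hv).2 (hU i hu)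
  rw [gnp_eq_map hp, Measure.map_apply hm (by trivial), hpre,
    measure_pi_biInter_of_dependsOn (coinMeasure p) (Finset.univ \ U)
      (D := fun v => U.image fun u => s(v, u)), ENNReal.toReal_prod]
  · have hcard : (Finset.univ \ U).card = n - U.card := by
      rw [Finset.card_sdiff_of_subset (Finset.subset_univ U), Finset.card_univ, Fintype.card_fin]
    rw [← hcard, ← Finset.prod_const]
    exact Finset.prod_le_prod (fun v _ => ENNReal.toReal_nonneg) fun v _ =>
      measureReal_pi_coinMeasure_forall_exists_le hp hZ hr v
  · intro a ha b hb hab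
    simp only [Finset.mem_sdiff, Finset.mem_univ, true_and] at ha hb
    rw [Finset.disjoint_left]
    simp only [Finset.mem_image]
    rintro _ ⟨u, hu, rfl⟩ ⟨w, hw, h⟩
    rw [Sym2.eq_iff] at h
    rcases h with ⟨h, -⟩ | ⟨rfl, -⟩
    · exact hab h.symm
    · exact hb hu
  · intro v _ f g hfg hf i
    obtain ⟨u, hu, h⟩ := hf i
    exact ⟨u, hu, by rw [← hfg _ (Finset.mem_image_of_mem _ (hU i hu)), h]⟩

lemma eventually_pow_le_mul_pow {p : ℝ} (hp : p ∈ Set.Ioo (0 : ℝ) 1) (r : ℕ) {ε : ℝ}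
    (hε : 0 < ε) :
    ∀ᶠ k : ℕ in atTop, ∀ m ≤ nseq2 p k, nseq2 p k ≤ m + 6 * k →
      (1 - 6 * (1 - p) ^ k + 30 * (1 - p) ^ (2 * k - r)) ^ m ≤
        (1 + ε) * (1 - 6 * (1 - p) ^ k) ^ nseq2 p k := by
  have hq0 : 0 < 1 - p := by linarith [hp.2]
  have hq1 : 1 - p < 1 := by linarith [hp.1]
  set q := 1 - p
  have ht : Tendsto (fun k : ℕ => (k : ℝ) * q ^ k) atTop (nhds 0) :=
    tendsto_self_mul_const_pow_of_lt_one hq0.le hq1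
  have hlim : ∀ᶠ t : ℝ in nhds 0, exp (60 / q ^ r * t) < (1 + ε) * (1 - 36 * t) := by
    refine ContinuousAt.eventually_lt (by fun_prop) (by fun_prop) ?_
    simpa using hε
  filter_upwards [ht.eventually hlim, eventually_ge_atTop r, eventually_ge_atTop 1,
    ht.eventually (gt_mem_nhds (show (0 : ℝ) < 1 / 12 by norm_num))] with k hk hkr hk1 hk12 m hm hnm
  have hqk : 0 < q ^ k := pow_pos hq0 k
  have hk1' : (1 : ℝ) ≤ k := by exact_mod_cast hk1
  have hqk12 : q ^ k ≤ 1 / 12 := by nlinarith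
  have hn : (nseq2 p k : ℝ) ≤ k / q ^ k := by
    refine (Nat.floor_le (by positivity)).trans_eq ?_
    change (1 / q) ^ k * (k : ℝ) = _
    rw [one_div, inv_pow]
    field_simp
  set δ := 30 * q ^ (2 * k - r)
  have hδ : 0 ≤ δ := by positivity
  have hδm : 2 * δ * m ≤ 60 / q ^ r * (k * q ^ k) := by
    have hpow : q ^ (2 * k - r) * q ^ r = q ^ k * q ^ k := by
      rw [← pow_add, ← pow_add]
      congr 1
      omega
    calc 2 * δ * m ≤ 2 * δ * (k / q ^ k) := by
          have : (m : ℝ) ≤ nseq2 p k := by exact_mod_cast hm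
          gcongr
          exact this.trans hn
      _ = 60 / q ^ r * (k * q ^ k) := by
          simp only [δ]
          field_simp
          linear_combination 60 * hpow
  set b := 1 - 6 * q ^ k
  have hb : 1 / 2 ≤ b := by simp only [b]; linarith
  have hb1 : b ≤ 1 := by simp only [b]; linarith
  have hb0 : 0 ≤ b := by linarith
  have hber : 1 - 36 * (k * q ^ k) ≤ b ^ (6 * k) := by
    have h := one_add_mul_le_pow (a := -(6 * q ^ k)) (by linarith) (6 * k)
    rw [← sub_eq_add_neg] at h
    refine le_trans (le_of_eq ?_) h
    push_cast
    ring
  calc (b + δ) ^ m ≤ (b * exp (2 * δ)) ^ m := by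
        gcongr
        nlinarith [add_one_le_exp (2 * δ)]
    _ = b ^ m * exp (2 * δ * m) := by
        rw [mul_pow, ← exp_nat_mul, mul_comm (m : ℝ)]
    _ ≤ b ^ m * ((1 + ε) * (1 - 36 * (k * q ^ k))) := by
        gcongr
        exact (exp_le_exp.2 hδm).trans hk.le
    _ ≤ b ^ m * ((1 + ε) * b ^ (6 * k)) := by gcongr
    _ = (1 + ε) * b ^ (m + 6 * k) := by rw [pow_add]; ring
    _ ≤ (1 + ε) * b ^ nseq2 p k := by
        gcongr ?_ * ?_
        exact pow_le_pow_of_le_one hb0 hb1 hnm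

theorem stmt13 {p : ℝ} (hp : p ∈ Set.Ioo (0 : ℝ) 1) (r₀ : ℕ) (hr₀ : 0 < r₀) :
    ∀ ε : ℝ, 0 < ε → ∃ K : ℕ, ∀ k : ℕ, K ≤ k →
      ∀ (X Y : Fin 3 → Finset (Fin (nseq2 p k))) (x y : Fin 3 → Fin (nseq2 p k)),
        IsKTuple k X x → IsKTuple k Y y →
        ((X 0 ∪ X 1 ∪ X 2) ∩ (Y 0 ∪ Y 1 ∪ Y 2)).card ≤ r₀ →
        ((gnp (nseq2 p k) p) {G : SimpleGraph (Fin (nseq2 p k)) | ∀ i : Fin 3,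
            DominatesSet G (X i)
              (Finset.univ \ ((X 0 ∪ X 1 ∪ X 2) ∪ (Y 0 ∪ Y 1 ∪ Y 2))) ∧
            DominatesSet G (Y i)
              (Finset.univ \ ((X 0 ∪ X 1 ∪ X 2) ∪ (Y 0 ∪ Y 1 ∪ Y 2)))}).toReal ≤
          (1 + ε) * (1 - 6 * (1 - p) ^ k) ^ (nseq2 p k) := by
  intro ε hε
  obtain ⟨K, hK⟩ := eventually_atTop.1 (eventually_pow_le_mul_pow hp r₀ hε)
  refine ⟨K, fun k hk X Y x y hX hY hXY => ?_⟩
  set UX := X 0 ∪ X 1 ∪ X 2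
  set UY := Y 0 ∪ Y 1 ∪ Y 2
  have hXU : ∀ i, X i ⊆ UX := by
    intro i u hu
    fin_cases i <;> simp_all [UX]
  have hYU : ∀ i, Y i ⊆ UY := by
    intro i u hu
    fin_cases i <;> simp_all [UY]
  have hcard : ∀ Z : Fin 3 → Finset (Fin (nseq2 p k)), (∀ i, (Z i).card = k) →
      (Z 0 ∪ Z 1 ∪ Z 2).card ≤ 3 * k := by
    intro Z hZ
    have h1 := Finset.card_union_le (Z 0 ∪ Z 1) (Z 2)
    have h2 := Finset.card_union_le (Z 0) (Z 1)
    simp only [hZ] at h1 h2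
    omega
  have hUcard : (UX ∪ UY).card ≤ 6 * k := by
    have h1 := Finset.card_union_le UX UY
    have h2 : UX.card ≤ 3 * k := hcard X hX.1
    have h3 : UY.card ≤ 3 * k := hcard Y hY.1
    omega
  have hr : ∀ i j : Fin 3 ⊕ Fin 3, i ≠ j →
      (Sum.elim X Y i ∩ Sum.elim X Y j).card ≤ r₀ := by
    have hXYij : ∀ i j, (X i ∩ Y j).card ≤ r₀ := fun i j =>
      (Finset.card_le_card (Finset.inter_subset_inter (hXU i) (hYU j))).trans hXY
    rintro (i | i) (j | j) hij
    · simp [Finset.disjoint_iff_inter_eq_empty.1 (hX.2.1 i j (by simpa using hij))]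
    · exact hXYij i j
    · simpa only [Sum.elim_inl, Sum.elim_inr, Finset.inter_comm] using hXYij j i
    · simp [Finset.disjoint_iff_inter_eq_empty.1 (hY.2.1 i j (by simpa using hij))]
  have hmain := gnp_forall_dominatesSet_le hp (Z := Sum.elim X Y) (k := k) (r := r₀)
    (by rintro (i | i); exacts [hX.1 i, hY.1 i]) hr (U := UX ∪ UY) (by
      rintro (i | i)
      exacts [(hXU i).trans Finset.subset_union_left, (hYU i).trans Finset.subset_union_right])
  simp only [Sum.forall, Sum.elim_inl, Sum.elim_inr, ← forall_and, Fintype.card_sum,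
    Fintype.card_fin] at hmain
  refine hmain.trans (le_trans (le_of_eq ?_) (hK k hk (nseq2 p k - (UX ∪ UY).card)
    (Nat.sub_le _ _) (by omega)))
  norm_num
end
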